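/- For every p ∈ (0,1/2), there exists a probability measure Q̄ on {0,1}^{E₂} × {0,1}^{E₂} whose first marginal is μ_p and whose second marginal is μ_{1−p}, such that Q̄-almost surely, for all x, y ∈ Z², if x and y are connected by a path of open edges in the first configuration ω, then they are connected by a path of open edges in the second configuration ω̃. In particular, the law of the connectivity field (1_{x↔y})_{(x,y)∈Z²×Z²} under μ_p is stochastically dominated by its law under μ_{1−p}. -/

import Mathlib

open MeasureTheory
open scoped BigOperators

noncomputable section

/-- Vertices of the square lattice `ℤ²`. -/
abbrev V : Type := ℤ × ℤ

/-- Nearest-neighbour adjacency on `ℤ²` (`ℓ¹`-distance one). -/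
def latAdj (x y : V) : Prop := |x.1 - y.1| + |x.2 - y.2| = 1

/-- The edge set `E₂` of the square lattice, as a set of unordered pairs of vertices. -/
def E2 : Set (Sym2 V) := {e | ∃ x y : V, latAdj x y ∧ e = s(x, y)}

abbrev Edge : Type := ↥E2

/-- An edge configuration: an element of `{0,1}^{E₂}` (`true` = open). -/
abbrev Config : Type := Edge → Bool

/-- The four unit directions. -/
def dir : Fin 4 → V := ![(1, 0), (-1, 0), (0, 1), (0, -1)]

lemma latAdj_dir (x : V) (d : Fin 4) : latAdj x (x + dir d) := by
  fin_cases d <;> simp [latAdj, dir, Prod.fst_add, Prod.snd_add]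

/-- The edge from `x` in direction `d`, as an element of `E₂`. -/
def incEdge (x : V) (d : Fin 4) : Edge :=
  ⟨s(x, x + dir d), ⟨x, x + dir d, latAdj_dir x d, rfl⟩⟩

/-- The vertex `x` has even degree in the configuration `ω` (the four incident edges
of `x` are `incEdge x d`, `d : Fin 4`, each counted once). -/
def degEven (ω : Config) (x : V) : Prop :=
  Even ((Finset.univ.filter (fun d : Fin 4 => ω (incEdge x d) = true)).card)

/-- The set `Ω_EP` of even (Eulerian) configurations. -/
def ΩEP : Set Config := {ω | ∀ x : V, degEven ω x}

/-- Concatenation: the configuration equal to `η` on `Λ` and to `ω` off `Λ`. -/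
def patch (Λ : Finset Edge) (η : ↥Λ → Bool) (ω : Config) : Config :=
  fun e => if h : e ∈ Λ then η ⟨e, h⟩ else ω e

def qratio (p : ℝ) : ℝ := p / (1 - p)

/-- Number of open edges in a local configuration. -/
def numOpen {Λ : Finset Edge} (η : ↥Λ → Bool) : ℕ :=
  (Finset.univ.filter (fun e : ↥Λ => η e = true)).card

open Classical in
/-- The operator `M^p_Λ`. -/
def Mop (p : ℝ) (Λ : Finset Edge) (f : Config → ℝ) (ω : Config) : ℝ :=
  ∑ η : ↥Λ → Bool,
    (if patch Λ η ω ∈ ΩEP then f (patch Λ η ω) * qratio p ^ numOpen η else 0)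

/-- The finite-volume conditional expectation `μ^p_Λ f = (M^p_Λ f)/(M^p_Λ 1)`. -/
def muOp (p : ℝ) (Λ : Finset Edge) (f : Config → ℝ) (ω : Config) : ℝ :=
  Mop p Λ f ω / Mop p Λ (fun _ => 1) ω

/-- `μ` is a Gibbs measure for Eulerian percolation with opening parameter `p`. -/
def IsGibbsEP (p : ℝ) (μ : Measure Config) : Prop :=
  IsProbabilityMeasure μ ∧ μ ΩEP = 1 ∧
    ∀ f : Config → ℝ, Continuous f → ∀ Λ : Finset Edge,
      ∫ ω, f ω ∂μ = ∫ ω, muOp p Λ f ω ∂μ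

/-- `x` and `y` are joined by an open edge of `ω`. -/
def openAdj (ω : Config) (x y : V) : Prop :=
  ∃ h : s(x, y) ∈ E2, ω ⟨s(x, y), h⟩ = true

/-- `x` and `y` are connected by a path of open edges of `ω`. -/
def openConn (ω : Config) : V → V → Prop := Relation.ReflTransGen (openAdj ω)

/-- The cluster of `x` in `ω`: the connected component of `x` in the graph of open edges. -/
def cluster (ω : Config) (x : V) : Set V := {y | openConn ω x y}

/-- The configuration `ω` has an infinite cluster of open edges. -/
def HasInfiniteCluster (ω : Config) : Prop := ∃ x : V, (cluster ω x).Infinite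

/-- The percolation event `𝒞`: there exists an infinite open cluster. -/
def percEvent : Set Config := {ω | HasInfiniteCluster ω}

namespace EP

/-! ### Characters of `ZMod 2`-valued functions -/

/-- The nontrivial sign character of `ZMod 2`. -/
def sg (a : ZMod 2) : ℝ := if a = 0 then 1 else -1

lemma zmod2_cases (a : ZMod 2) : a = 0 ∨ a = 1 := by revert a; decide

lemma sg_zero : sg 0 = 1 := by simp [sg]

lemma sg_one : sg 1 = -1 := by simp [sg]

lemma sg_add (a b : ZMod 2) : sg (a + b) = sg a * sg b := by
  rcases zmod2_cases a with rfl | rfl <;> rcases zmod2_cases b with rfl | rfl <;>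
    simp [sg, show (1 : ZMod 2) + 1 = 0 from by decide]

lemma sg_eq (a : ZMod 2) : sg a = 1 ∨ sg a = -1 := by
  unfold sg; split_ifs <;> simp

lemma abs_sg (a : ZMod 2) : |sg a| = 1 := by rcases sg_eq a with h | h <;> simp [h]

lemma add_self {W : Type*} (A : W → ZMod 2) : A + A = 0 := by
  funext v; exact CharTwo.add_self_eq_zero (A v)

lemma add_eq_iff {W : Type*} {A B C : W → ZMod 2} : A + B = C ↔ A = C + B := by
  constructor
  · rintro rfl; rw [add_assoc, add_self, add_zero]
  · rintro rfl; rw [add_assoc, add_self, add_zero]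

/-- The character `∏_{v ∈ T} (-1)^{B v}`. -/
def chi {W : Type*} (T : Finset W) (B : W → ZMod 2) : ℝ := ∏ v ∈ T, sg (B v)

section
variable {W E : Type*}

lemma chi_zero (T : Finset W) : chi T 0 = 1 := by simp [chi, sg_zero]

lemma chi_add (T : Finset W) (A B : W → ZMod 2) : chi T (A + B) = chi T A * chi T B := by
  simp [chi, sg_add, Finset.prod_mul_distrib]

lemma abs_chi (T : Finset W) (B : W → ZMod 2) : |chi T B| = 1 := by
  simp [chi, Finset.abs_prod, abs_sg]

lemma chi_eq (T : Finset W) (B : W → ZMod 2) : chi T B = 1 ∨ chi T B = -1 := by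
  have h := abs_chi T B
  rcases abs_cases (chi T B) with h1 | h1
  · left; linarith
  · right; linarith

lemma chi_sum (T : Finset W) (η : Finset E) (D : E → W → ZMod 2) :
    chi T (∑ e ∈ η, D e) = ∏ e ∈ η, chi T (D e) := by
  classical
  induction η using Finset.induction_on with
  | empty => simp [chi_zero]
  | insert a s ha ih => rw [Finset.sum_insert ha, Finset.prod_insert ha, chi_add, ih]

open Classical in
lemma sum_chi (S : Finset W) (B : W → ZMod 2) (hB : ∀ v ∉ S, B v = 0) :
    ∑ T ∈ S.powerset, chi T B = (2 : ℝ) ^ S.card * (if B = 0 then 1 else 0) := by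
  have h1 : ∑ T ∈ S.powerset, chi T B = ∏ v ∈ S, (1 + sg (B v)) := by
    simp [chi, Finset.prod_one_add]
  rw [h1]
  split_ifs with h
  · subst h
    simp [sg_zero]
    norm_num
  · obtain ⟨v, hv⟩ := Function.ne_iff.1 h
    have hvS : v ∈ S := by
      by_contra hvS; exact hv (hB v hvS)
    rw [mul_zero]
    apply Finset.prod_eq_zero hvS
    have : B v = 1 := (zmod2_cases (B v)).resolve_left hv
    rw [this, sg_one]; norm_num

/-! ### Boundaries and partition functions -/

/-- The sum of the vectors `D e` over a finite set of edges. -/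
def bdy (D : E → W → ZMod 2) (η : Finset E) : W → ZMod 2 := ∑ e ∈ η, D e

lemma bdy_empty (D : E → W → ZMod 2) : bdy D ∅ = 0 := by simp [bdy]

lemma bdy_singleton (D : E → W → ZMod 2) (e : E) : bdy D {e} = D e := by simp [bdy]

variable [DecidableEq E]

lemma bdy_insert (D : E → W → ZMod 2) {e : E} {η : Finset E} (h : e ∉ η) :
    bdy D (insert e η) = D e + bdy D η := by
  simp [bdy, Finset.sum_insert h]

lemma bdy_symmDiff (D : E → W → ZMod 2) (η ξ : Finset E) :
    bdy D (symmDiff η ξ) = bdy D η + bdy D ξ := by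
  unfold bdy
  have h1 := Finset.sum_sdiff_eq_sub (f := D) (Finset.inter_subset_left : η ∩ ξ ⊆ η)
  have h2 := Finset.sum_sdiff_eq_sub (f := D) (Finset.inter_subset_right : η ∩ ξ ⊆ ξ)
  rw [Finset.sdiff_inter_self_left] at h1
  rw [Finset.sdiff_inter_self_right] at h2
  have hd : symmDiff η ξ = (η \ ξ) ∪ (ξ \ η) := rfl
  rw [hd, Finset.sum_union, h1, h2]
  · have := add_self (∑ e ∈ η ∩ ξ, D e)
    rw [sub_add_sub_comm, this, sub_zero]
  · exact disjoint_sdiff_sdiff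

lemma sum_powerset_symmDiff (Λ ξ : Finset E) (hξ : ξ ⊆ Λ) (f : Finset E → ℝ) :
    ∑ η ∈ Λ.powerset, f (symmDiff η ξ) = ∑ η ∈ Λ.powerset, f η := by
  have key : ∀ η ∈ Λ.powerset, symmDiff η ξ ∈ Λ.powerset := by
    intro η hη
    rw [Finset.mem_powerset] at *
    intro e he
    rw [Finset.mem_symmDiff] at he
    rcases he with h | h
    · exact hη h.1
    · exact hξ h.1
  apply Finset.sum_nbij' (fun η => symmDiff η ξ) (fun η => symmDiff η ξ) key key
  · intro η _; simp
  · intro η _; simp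
  · intro η _; rfl

open Classical in
/-- Weighted count of the subsets of `Λ` with boundary `A`. -/
def Zw (D : E → W → ZMod 2) (w : E → ℝ) (Λ : Finset E) (A : W → ZMod 2) : ℝ :=
  ∑ η ∈ Λ.powerset, if bdy D η = A then ∏ e ∈ η, w e else 0

open Classical in
/-- Fourier coefficient of the duplicated system. -/
def Wt (D : E → W → ZMod 2) (w : E → ℝ) (Λ : Finset E) (T : Finset W) (C : W → ZMod 2) : ℝ :=
  ∑ η ∈ Λ.powerset, if bdy D η = C then
    (∏ e ∈ η, w e) * ∏ e ∈ Λ, (1 + if e ∈ η then chi T (D e) else w e ^ 2 * chi T (D e)) else 0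

lemma Wt_nonneg (D : E → W → ZMod 2) (w : E → ℝ) (hw : ∀ e, 0 ≤ w e ∧ w e ≤ 1)
    (Λ : Finset E) (T : Finset W) (C : W → ZMod 2) : 0 ≤ Wt D w Λ T C := by
  unfold Wt
  apply Finset.sum_nonneg
  intro η _
  split_ifs
  · apply mul_nonneg (Finset.prod_nonneg fun e _ => (hw e).1)
    apply Finset.prod_nonneg
    intro e _
    have := hw e
    rcases chi_eq T (D e) with h | h <;> rw [h] <;> split_ifs <;> nlinarith
  · exact le_rfl

lemma prod_symmDiff_mul (w : E → ℝ) (η ξ : Finset E) :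
    (∏ e ∈ symmDiff η ξ, w e) * ∏ e ∈ ξ, w e =
      (∏ e ∈ η, w e) * ∏ e ∈ ξ, (if e ∈ η then 1 else w e ^ 2) := by
  have hd : symmDiff η ξ = (η \ ξ) ∪ (ξ \ η) := rfl
  rw [hd, Finset.prod_union disjoint_sdiff_sdiff, Finset.prod_ite]
  have e1 : ξ.filter (fun e => e ∉ η) = ξ \ η := by
    ext e; simp
  have e2 : ∏ e ∈ ξ, w e = (∏ e ∈ ξ \ η, w e) * ∏ e ∈ η ∩ ξ, w e := by
    rw [← Finset.prod_sdiff (Finset.inter_subset_right : η ∩ ξ ⊆ ξ), Finset.sdiff_inter_self_right]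
  have e3 : ∏ e ∈ η, w e = (∏ e ∈ η \ ξ, w e) * ∏ e ∈ η ∩ ξ, w e := by
    rw [← Finset.prod_sdiff (Finset.inter_subset_left : η ∩ ξ ⊆ η), Finset.sdiff_inter_self_left]
  rw [e1, e2, e3, Finset.prod_const_one, Finset.prod_pow]
  ring

lemma Zw_mul (D : E → W → ZMod 2) (w : E → ℝ) (Λ : Finset E) (S : Finset W)
    (hD : ∀ e ∈ Λ, ∀ v ∉ S, D e v = 0) (A B : W → ZMod 2)
    (hB : ∀ v ∉ S, B v = 0) :
    Zw D w Λ A * Zw D w Λ B =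
      ((2 : ℝ) ^ S.card)⁻¹ * ∑ T ∈ S.powerset, chi T B * Wt D w Λ T (A + B) := by
  classical
  have hbd : ∀ ξ ∈ Λ.powerset, ∀ v ∉ S, bdy D ξ v = 0 := by
    intro ξ hξ v hv
    rw [Finset.mem_powerset] at hξ
    simp only [bdy, Finset.sum_apply]
    exact Finset.sum_eq_zero fun e he => hD e (hξ he) v hv
  have hpos : (2 : ℝ) ^ S.card ≠ 0 := by positivity
  rw [eq_inv_mul_iff_mul_eq₀ hpos]
  have hind : ∀ ξ ∈ Λ.powerset, (2 : ℝ) ^ S.card * (if bdy D ξ = B then 1 else 0) =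
      ∑ T ∈ S.powerset, chi T B * chi T (bdy D ξ) := by
    intro ξ hξ
    have h := sum_chi S (B + bdy D ξ) (fun v hv => by simp [hB v hv, hbd ξ hξ v hv])
    simp_rw [chi_add] at h
    rw [h]
    congr 2
    rw [add_eq_iff, zero_add]
    exact propext eq_comm
  have hW : ∀ T, Wt D w Λ T (A + B) = ∑ η ∈ Λ.powerset, ∑ ξ ∈ Λ.powerset,
      if bdy D η = A + B then
        (∏ e ∈ symmDiff η ξ, w e) * (∏ e ∈ ξ, w e) * chi T (bdy D ξ) else 0 := by
    intro T
    unfold Wt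
    apply Finset.sum_congr rfl
    intro η hη
    split_ifs with h
    · rw [Finset.prod_one_add, Finset.mul_sum]
      apply Finset.sum_congr rfl
      intro ξ _
      rw [prod_symmDiff_mul, mul_assoc, bdy, chi_sum, ← Finset.prod_mul_distrib]
      congr 1
      apply Finset.prod_congr rfl
      intro e _
      split_ifs <;> simp
    · simp
  simp_rw [hW]
  have lhs : Zw D w Λ A * Zw D w Λ B = ∑ ξ ∈ Λ.powerset, ∑ η ∈ Λ.powerset,
      (if bdy D η = A + B then (if bdy D ξ = B then 1 else 0) *
        ((∏ e ∈ symmDiff η ξ, w e) * (∏ e ∈ ξ, w e)) else 0) := by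
    rw [mul_comm]
    unfold Zw
    rw [Finset.sum_mul]
    apply Finset.sum_congr rfl
    intro ξ hξ
    rw [← sum_powerset_symmDiff Λ ξ (Finset.mem_powerset.1 hξ), Finset.mul_sum]
    apply Finset.sum_congr rfl
    intro η _
    rw [bdy_symmDiff]
    by_cases h1 : bdy D ξ = B
    · have : bdy D η + bdy D ξ = A ↔ bdy D η = A + B := by rw [add_eq_iff, h1]
      simp only [this]
      simp only [h1, if_pos]
      split_ifs <;> ring
    · simp [h1]
  rw [lhs, Finset.sum_comm, Finset.mul_sum]
  simp_rw [Finset.mul_sum]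
  conv_rhs => rw [Finset.sum_comm]
  apply Finset.sum_congr rfl
  intro η _
  conv_rhs => rw [Finset.sum_comm]
  apply Finset.sum_congr rfl
  intro ξ hξ
  by_cases h : bdy D η = A + B
  · simp only [if_pos h]
    rw [← mul_assoc, hind ξ hξ, Finset.sum_mul]
    apply Finset.sum_congr rfl
    intro T _
    ring
  · simp [h]

/-! ### Correlation inequalities -/

lemma exists_support (D : E → W → ZMod 2) (hDf : ∀ e, (Function.support (D e)).Finite)
    (Λ : Finset E) (B : W → ZMod 2) (hB : (Function.support B).Finite) :
    ∃ S : Finset W, (∀ e ∈ Λ, ∀ v ∉ S, D e v = 0) ∧ ∀ v ∉ S, B v = 0 := by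
  classical
  refine ⟨hB.toFinset ∪ Λ.biUnion fun e => (hDf e).toFinset, ?_, ?_⟩
  · intro e he v hv
    by_contra h
    apply hv
    simp only [Finset.mem_union, Finset.mem_biUnion]
    exact Or.inr ⟨e, he, by simpa using h⟩
  · intro v hv
    by_contra h
    apply hv
    simp only [Finset.mem_union]
    exact Or.inl (by simpa using h)

lemma Zw_nonneg (D : E → W → ZMod 2) (w : E → ℝ) (hw : ∀ e, 0 ≤ w e)
    (Λ : Finset E) (A : W → ZMod 2) : 0 ≤ Zw D w Λ A := by
  unfold Zw
  apply Finset.sum_nonneg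
  intro η _
  split_ifs
  · exact Finset.prod_nonneg fun e _ => hw e
  · exact le_rfl

lemma prod_le_Zw (D : E → W → ZMod 2) (w : E → ℝ) (hw : ∀ e, 0 ≤ w e)
    (Λ : Finset E) {η : Finset E} (hη : η ⊆ Λ) : ∏ e ∈ η, w e ≤ Zw D w Λ (bdy D η) := by
  classical
  unfold Zw
  have := Finset.single_le_sum (f := fun ξ => if bdy D ξ = bdy D η then ∏ e ∈ ξ, w e else 0)
    (s := Λ.powerset) (fun ξ _ => by
      split_ifs
      · exact Finset.prod_nonneg fun e _ => hw e
      · exact le_rfl) (Finset.mem_powerset.2 hη)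
  simpa using this

lemma one_le_Zw_zero (D : E → W → ZMod 2) (w : E → ℝ) (hw : ∀ e, 0 ≤ w e)
    (Λ : Finset E) : 1 ≤ Zw D w Λ 0 := by
  have := prod_le_Zw D w hw Λ (Finset.empty_subset Λ)
  simpa [bdy_empty] using this

variable {D : E → W → ZMod 2} {w : E → ℝ}

/-- Griffiths' second inequality. -/
lemma griffiths (hDf : ∀ e, (Function.support (D e)).Finite) (hw : ∀ e, 0 ≤ w e ∧ w e ≤ 1)
    (Λ : Finset E)
    (A B : W → ZMod 2) (hB : (Function.support B).Finite) :
    Zw D w Λ A * Zw D w Λ B ≤ Zw D w Λ 0 * Zw D w Λ (A + B) := by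
  obtain ⟨S, h1, h2⟩ := exists_support D hDf Λ B hB
  rw [Zw_mul D w Λ S h1 A B h2, mul_comm (Zw D w Λ 0),
    Zw_mul D w Λ S h1 (A + B) 0 (by simp)]
  apply mul_le_mul_of_nonneg_left _ (by positivity)
  apply Finset.sum_le_sum
  intro T _
  rw [chi_zero, add_zero]
  apply mul_le_mul_of_nonneg_right _ (Wt_nonneg D w hw Λ T _)
  rcases chi_eq T B with h | h <;> rw [h] <;> norm_num

/-- A Lebowitz-type comparison inequality. -/
lemma lebowitz (hDf : ∀ e, (Function.support (D e)).Finite) (hw : ∀ e, 0 ≤ w e ∧ w e ≤ 1)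
    (Λ : Finset E)
    (A B : W → ZMod 2) (hB : (Function.support B).Finite) (e : E) :
    |Zw D w Λ (A + B + D e) * Zw D w Λ B - Zw D w Λ (A + B) * Zw D w Λ (B + D e)| ≤
      Zw D w Λ (A + D e) * Zw D w Λ 0 - Zw D w Λ A * Zw D w Λ (D e) := by
  have hB' : (Function.support (B + D e)).Finite :=
    (hB.union (hDf e)).subset (Function.support_add _ _)
  obtain ⟨S₁, h1, h2⟩ := exists_support D hDf Λ B hB
  obtain ⟨S₂, h3, h4⟩ := exists_support D hDf Λ (D e) (hDf e)
  classical
  have hS : ∀ e ∈ Λ, ∀ v ∉ S₁ ∪ S₂, D e v = 0 := fun e he v hv =>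
    h1 e he v (fun h => hv (Finset.mem_union_left _ h))
  have hSB : ∀ v ∉ S₁ ∪ S₂, B v = 0 := fun v hv =>
    h2 v (fun h => hv (Finset.mem_union_left _ h))
  have hSe : ∀ v ∉ S₁ ∪ S₂, D e v = 0 := fun v hv =>
    h4 v (fun h => hv (Finset.mem_union_right _ h))
  rw [Zw_mul D w Λ _ hS (A + B + D e) B hSB,
    Zw_mul D w Λ _ hS (A + B) (B + D e) (fun v hv => by simp [hSB v hv, hSe v hv]),
    Zw_mul D w Λ _ hS (A + D e) 0 (by simp),
    Zw_mul D w Λ _ hS A (D e) hSe, ← mul_sub, ← mul_sub, abs_mul,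
    abs_of_nonneg (by positivity : (0 : ℝ) ≤ ((2 : ℝ) ^ (S₁ ∪ S₂).card)⁻¹)]
  apply mul_le_mul_of_nonneg_left _ (by positivity)
  rw [← Finset.sum_sub_distrib, ← Finset.sum_sub_distrib]
  refine (Finset.abs_sum_le_sum_abs _ _).trans (Finset.sum_le_sum ?_)
  intro T _
  have e1 : A + B + D e + B = A + D e := by
    rw [add_right_comm, add_assoc A B B, add_self, add_zero]
  have e2 : A + B + (B + D e) = A + D e := by
    rw [← add_assoc, add_assoc A B B, add_self, add_zero]
  rw [e1, e2, add_zero, chi_zero, chi_add, ← sub_mul, ← sub_mul, abs_mul,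
    abs_of_nonneg (Wt_nonneg D w hw Λ T _)]
  apply mul_le_mul_of_nonneg_right _ (Wt_nonneg D w hw Λ T _)
  rcases chi_eq T B with h | h <;> rcases chi_eq T (D e) with h' | h' <;> rw [h, h'] <;> norm_num

lemma Zw_insert (D : E → W → ZMod 2) (w : E → ℝ) {Λ : Finset E} {e : E} (he : e ∉ Λ)
    (A : W → ZMod 2) :
    Zw D w (insert e Λ) A = Zw D w Λ A + w e * Zw D w Λ (A + D e) := by
  unfold Zw
  rw [Finset.sum_powerset_insert he, Finset.mul_sum]
  congr 1
  apply Finset.sum_congr rfl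
  intro η hη
  have hη' : e ∉ η := fun h => he (Finset.mem_powerset.1 hη h)
  rw [bdy_insert D hη', Finset.prod_insert hη', add_comm (D e), add_eq_iff]
  split_ifs <;> simp

lemma Zw_congr (D : E → W → ZMod 2) {w w' : E → ℝ} {Λ : Finset E} (h : ∀ e ∈ Λ, w e = w' e)
    (A : W → ZMod 2) : Zw D w Λ A = Zw D w' Λ A := by
  unfold Zw
  apply Finset.sum_congr rfl
  intro η hη
  rw [Finset.prod_congr rfl fun e he => h e (Finset.mem_powerset.1 hη he)]

lemma Zw_mono_edge (hDf : ∀ e, (Function.support (D e)).Finite) (hw : ∀ e, 0 ≤ w e ∧ w e ≤ 1)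
    (Λ : Finset E)
    {w' : E → ℝ} (hw' : ∀ e, 0 ≤ w' e ∧ w' e ≤ 1) (e : E)
    (hle : w e ≤ w' e) (hoff : ∀ f, f ≠ e → w f = w' f)
    (B : W → ZMod 2) (hB : (Function.support B).Finite) :
    Zw D w Λ B * Zw D w' Λ 0 ≤ Zw D w' Λ B * Zw D w Λ 0 := by
  by_cases he : e ∈ Λ
  · obtain ⟨Λ', h', rfl⟩ : ∃ Λ', e ∉ Λ' ∧ insert e Λ' = Λ :=
      ⟨Λ.erase e, Finset.notMem_erase e Λ, Finset.insert_erase he⟩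
    have hc : ∀ A, Zw D w' Λ' A = Zw D w Λ' A := fun A =>
      Zw_congr D (fun f hf => (hoff f (fun h => h' (h ▸ hf))).symm) A
    simp only [Zw_insert _ _ h', hc, zero_add]
    have h := griffiths hDf hw Λ' (D e) B hB
    rw [add_comm (D e) B] at h
    nlinarith
  · have hc : ∀ A, Zw D w' Λ A = Zw D w Λ A := fun A =>
      Zw_congr D (fun f hf => (hoff f (fun h => he (h ▸ hf))).symm) A
    simp [hc]

/-- The normalised partition function with sources. -/
def Dw (D : E → W → ZMod 2) (w : E → ℝ) (Λ : Finset E) (B : W → ZMod 2) : ℝ :=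
  Zw D w Λ B / Zw D w Λ 0

lemma Dw_mono_weight (hDf : ∀ e, (Function.support (D e)).Finite) (hw : ∀ e, 0 ≤ w e ∧ w e ≤ 1)
    (Λ : Finset E)
    {w' : E → ℝ} (hw' : ∀ e, 0 ≤ w' e ∧ w' e ≤ 1)
    (hle : ∀ e, w e ≤ w' e) (B : W → ZMod 2) (hB : (Function.support B).Finite) :
    Dw D w Λ B ≤ Dw D w' Λ B := by
  have key : ∀ Ξ : Finset E, Dw D w Λ B ≤ Dw D (fun e => if e ∈ Ξ then w' e else w e) Λ B := by
    intro Ξ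
    induction Ξ using Finset.induction_on with
    | empty => simp
    | insert e Ξ he ih =>
      refine ih.trans ?_
      set w₁ : E → ℝ := fun f => if f ∈ Ξ then w' f else w f with hw₁
      set w₂ : E → ℝ := fun f => if f ∈ insert e Ξ then w' f else w f with hw₂
      have b1 : ∀ f, 0 ≤ w₁ f ∧ w₁ f ≤ 1 := fun f => by
        simp only [hw₁]; split_ifs
        · exact hw' f
        · exact hw f
      have b2 : ∀ f, 0 ≤ w₂ f ∧ w₂ f ≤ 1 := fun f => by
        simp only [hw₂]; split_ifs
        · exact hw' f
        · exact hw f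
      have p1 := one_le_Zw_zero D w₁ (fun f => (b1 f).1) Λ
      have p2 := one_le_Zw_zero D w₂ (fun f => (b2 f).1) Λ
      unfold Dw
      rw [div_le_div_iff₀ (by linarith) (by linarith)]
      refine Zw_mono_edge hDf b1 Λ b2 e ?_ ?_ B hB
      · simp [hw₁, hw₂, he, hle e]
      · intro f hf
        simp [hw₁, hw₂, hf]
  have h := key Λ
  unfold Dw at h ⊢
  rwa [Zw_congr D (w := fun e => if e ∈ Λ then w' e else w e) (w' := w')
      (fun e he => by simp [he]) B,
    Zw_congr D (w := fun e => if e ∈ Λ then w' e else w e) (w' := w')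
      (fun e he => by simp [he]) 0] at h

lemma Zw_zero_off (D : E → W → ZMod 2) (w : E → ℝ) {Λ Λ' : Finset E} (h : Λ ⊆ Λ')
    (A : W → ZMod 2) : Zw D (fun e => if e ∈ Λ then w e else 0) Λ' A = Zw D w Λ A := by
  rw [← Zw_congr D (w := fun e => if e ∈ Λ then w e else 0) (w' := w)
    (fun e he => by simp [he]) A]
  unfold Zw
  symm
  apply Finset.sum_subset (Finset.powerset_mono.2 h)
  intro η _ hη
  rw [Finset.mem_powerset, Finset.not_subset] at hη
  obtain ⟨e, he, heΛ⟩ := hη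
  rw [Finset.prod_eq_zero he (by simp [heΛ])]
  simp

lemma Dw_mono_set (hDf : ∀ e, (Function.support (D e)).Finite) (hw : ∀ e, 0 ≤ w e ∧ w e ≤ 1)
    {Λ Λ' : Finset E} (h : Λ ⊆ Λ') (B : W → ZMod 2)
    (hB : (Function.support B).Finite) : Dw D w Λ B ≤ Dw D w Λ' B := by
  have := Dw_mono_weight (D := D) (w := fun e => if e ∈ Λ then w e else 0) (w' := w) hDf
    (fun e => by split_ifs; exacts [hw e, by simp]) Λ' hw
    (fun e => by split_ifs; exacts [le_rfl, (hw e).1]) B hB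
  unfold Dw at this ⊢
  rwa [Zw_zero_off D w h, Zw_zero_off D w h] at this

lemma mul_Zw_le_add (D : E → W → ZMod 2) {x : ℝ} (hx0 : 0 ≤ x) (hx1 : x ≤ 1) {Λ : Finset E}
    {e : E} (he : e ∈ Λ) (A : W → ZMod 2) :
    x * Zw D (fun _ => x) Λ A ≤ Zw D (fun _ => x) Λ (A + D e) := by
  obtain ⟨Λ', h', rfl⟩ : ∃ Λ', e ∉ Λ' ∧ insert e Λ' = Λ :=
    ⟨Λ.erase e, Finset.notMem_erase e Λ, Finset.insert_erase he⟩
  rw [Zw_insert _ _ h', Zw_insert _ _ h', add_assoc, add_self, add_zero]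
  have h1 := Zw_nonneg D (fun _ => x) (fun _ => hx0) Λ' A
  have h2 := Zw_nonneg D (fun _ => x) (fun _ => hx0) Λ' (A + D e)
  nlinarith [mul_nonneg (mul_nonneg hx0 h2) (sub_nonneg.2 hx1), mul_nonneg h2 (sub_nonneg.2 hx1)]

end

/-! ### The lattice Green function -/

/-- The first unit vector. -/
def e1 : V := (1, 0)

/-- The second unit vector. -/
def e2 : V := (0, 1)

/-- Sum of a function over the four neighbours. -/
def lap (f : V → ℝ) (v : V) : ℝ := f (v + e1) + f (v - e1) + f (v + e2) + f (v - e2)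

/-- The point mass at the origin. -/
def del (v : V) : ℝ := if v = 0 then 1 else 0

/-- Number of lattice paths of length `n` from the origin to `v`. -/
def pathCount : ℕ → V → ℝ
  | 0 => del
  | n + 1 => lap (pathCount n)

lemma pathCount_nonneg (n : ℕ) : ∀ v, 0 ≤ pathCount n v := by
  induction n with
  | zero => intro v; simp only [pathCount, del]; split_ifs <;> norm_num
  | succ n ih =>
    intro v
    simp only [pathCount, lap]
    have := ih (v + e1); have := ih (v - e1); have := ih (v + e2); have := ih (v - e2)
    linarith

lemma pathCount_le (n : ℕ) : ∀ v, pathCount n v ≤ 4 ^ n := by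
  induction n with
  | zero => intro v; simp only [pathCount, del]; split_ifs <;> norm_num
  | succ n ih =>
    intro v
    simp only [pathCount, lap]
    have := ih (v + e1); have := ih (v - e1); have := ih (v + e2); have := ih (v - e2)
    rw [pow_succ]
    linarith

/-- The `ℓ¹` norm on `ℤ²`. -/
def l1 (v : V) : ℕ := v.1.natAbs + v.2.natAbs

lemma pathCount_eq_zero (n : ℕ) : ∀ v, n < l1 v → pathCount n v = 0 := by
  induction n with
  | zero =>
    intro v hv
    simp only [pathCount, del]
    rw [if_neg]
    rintro rfl
    simp [l1] at hv
  | succ n ih =>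
    intro v hv
    obtain ⟨i, j⟩ := v
    simp only [l1] at hv
    simp only [pathCount, lap]
    rw [ih, ih, ih, ih]
    · simp
    all_goals simp only [l1, e1, e2, Prod.fst_add, Prod.snd_add, Prod.fst_sub, Prod.snd_sub]; omega

lemma pathCount_refl (n : ℕ) : ∀ v : V, pathCount n (-v.1, v.2) = pathCount n v := by
  induction n with
  | zero =>
    intro v
    obtain ⟨i, j⟩ := v
    simp [pathCount, del, Prod.ext_iff]
  | succ n ih =>
    intro v
    obtain ⟨i, j⟩ := v
    have h1 := ih (i + 1, j); have h2 := ih (i - 1, j)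
    have h3 := ih (i, j + 1); have h4 := ih (i, j - 1)
    simp only [pathCount, lap, e1, e2, Prod.mk_add_mk, Prod.mk_sub_mk, add_zero, sub_zero] at *
    rw [show -i + 1 = -(i - 1) by ring, show -i - 1 = -(i + 1) by ring, h1, h2, h3, h4]
    ring

lemma pathCount_swap (n : ℕ) : ∀ v : V, pathCount n (v.2, v.1) = pathCount n v := by
  induction n with
  | zero =>
    intro v
    obtain ⟨i, j⟩ := v
    simp [pathCount, del, Prod.ext_iff, and_comm]
  | succ n ih =>
    intro v
    obtain ⟨i, j⟩ := v
    have h1 := ih (i + 1, j); have h2 := ih (i - 1, j)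
    have h3 := ih (i, j + 1); have h4 := ih (i, j - 1)
    simp only [pathCount, lap, e1, e2, Prod.mk_add_mk, Prod.mk_sub_mk, add_zero, sub_zero] at *
    rw [h1, h2, h3, h4]
    ring

/-- The Green function `(l - A)⁻¹ δ₀`. -/
def green (l : ℝ) (v : V) : ℝ := ∑' n, pathCount n v / l ^ (n + 1)

variable {l : ℝ}

lemma green_term_le (hl : 4 < l) (n : ℕ) (v : V) :
    pathCount n v / l ^ (n + 1) ≤ l⁻¹ * (4 / l) ^ n := by
  rw [div_pow, pow_succ, div_le_iff₀ (by positivity)]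
  have := pathCount_le n v
  have h : l⁻¹ * (4 ^ n / l ^ n) * (l ^ n * l) = 4 ^ n := by field_simp
  linarith

lemma green_term_nonneg (hl : 4 < l) (n : ℕ) (v : V) : 0 ≤ pathCount n v / l ^ (n + 1) := by
  have := pathCount_nonneg n v
  positivity

lemma geom_lt (hl : 4 < l) : 4 / l < 1 := by rw [div_lt_one] <;> linarith

lemma geom_nonneg (hl : 4 < l) : 0 ≤ 4 / l := by have : 0 < l := by linarith
                                                 positivity

lemma green_summable (hl : 4 < l) (v : V) :
    Summable fun n => pathCount n v / l ^ (n + 1) :=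
  Summable.of_nonneg_of_le (green_term_nonneg hl · v) (green_term_le hl · v)
    ((summable_geometric_of_lt_one (geom_nonneg hl) (geom_lt hl)).mul_left _)

lemma green_nonneg (hl : 4 < l) (v : V) : 0 ≤ green l v :=
  tsum_nonneg (green_term_nonneg hl · v)

lemma green_le (hl : 4 < l) (v : V) : green l v ≤ 1 / (l - 4) := by
  have h := (green_summable hl v).tsum_le_tsum (green_term_le hl · v)
    ((summable_geometric_of_lt_one (geom_nonneg hl) (geom_lt hl)).mul_left _)
  rw [tsum_mul_left, tsum_geometric_of_lt_one (geom_nonneg hl) (geom_lt hl)] at h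
  refine h.trans (le_of_eq ?_)
  have : l ≠ 0 := by linarith
  have : l - 4 ≠ 0 := by linarith
  field_simp

lemma green_eq (hl : 4 < l) (v : V) : l * green l v = lap (green l) v + del v := by
  have hl0 : l ≠ 0 := by linarith
  have hs := green_summable hl
  unfold green
  rw [(hs v).tsum_eq_zero_add, mul_add, ← tsum_mul_left, add_comm]
  congr 1
  · unfold lap
    rw [← (hs _).tsum_add (hs _), ← ((hs _).add (hs _)).tsum_add (hs _),
      ← (((hs _).add (hs _)).add (hs _)).tsum_add (hs _)]
    apply tsum_congr
    intro n
    simp only [pathCount, lap]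
    field_simp
    ring
  · simp only [pathCount]
    field_simp
    ring

lemma green_refl (v : V) : green l (-v.1, v.2) = green l v := by
  unfold green; simp_rw [pathCount_refl]

lemma green_swap (v : V) : green l (v.2, v.1) = green l v := by
  unfold green; simp_rw [pathCount_swap]

lemma green_neg (v : V) : green l (-v) = green l v := by
  rw [← green_refl (-v), ← green_swap, ← green_refl, ← green_swap]
  obtain ⟨i, j⟩ := v
  simp

lemma green_step (hl : 4 < l) (v : V) :
    green l (v + e1) ≤ l * green l v ∧ green l (v - e1) ≤ l * green l v ∧
    green l (v + e2) ≤ l * green l v ∧ green l (v - e2) ≤ l * green l v := by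
  have h := green_eq hl v
  unfold lap at h
  have hd : 0 ≤ del v := by unfold del; split_ifs <;> norm_num
  have h1 := green_nonneg hl (v + e1)
  have h2 := green_nonneg hl (v - e1)
  have h3 := green_nonneg hl (v + e2)
  have h4 := green_nonneg hl (v - e2)
  refine ⟨?_, ?_, ?_, ?_⟩ <;> linarith

lemma green_add_le (hl : 4 < l) (n : ℕ) :
    ∀ z v : V, l1 z = n → green l (v + z) ≤ l ^ n * green l v := by
  have hl0 : 0 < l := by linarith
  induction n with
  | zero =>
    rintro ⟨i, j⟩ v hz
    simp only [l1] at hz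
    obtain ⟨rfl, rfl⟩ : i = 0 ∧ j = 0 := by omega
    have : v + (0, 0) = v := by simp
    simp [this]
  | succ n ih =>
    rintro ⟨i, j⟩ v hz
    simp only [l1] at hz
    have key : ∀ u z' : V, l1 z' = n → (i, j) = z' + u →
        green l (v + z' + u) ≤ l * green l (v + z') →
        green l (v + (i, j)) ≤ l ^ (n + 1) * green l v := by
      intro u z' hz' hzu h
      rw [hzu, ← add_assoc, pow_succ']
      refine h.trans ?_
      rw [mul_assoc]
      exact mul_le_mul_of_nonneg_left (ih z' v hz') hl0.le
    rcases lt_trichotomy i 0 with hi | hi | hi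
    · refine key (-e1) (i + 1, j) (by simp only [l1]; omega) (by simp [e1]) ?_
      exact (green_step hl _).2.1
    · rcases lt_trichotomy j 0 with hj | hj | hj
      · refine key (-e2) (i, j + 1) (by simp only [l1]; omega) (by simp [e2]) ?_
        exact (green_step hl _).2.2.2
      · subst hi hj; simp at hz
      · refine key e2 (i, j - 1) (by simp only [l1]; omega) (by simp [e2]) ?_
        exact (green_step hl _).2.2.1
    · refine key e1 (i - 1, j) (by simp only [l1]; omega) (by simp [e1]) ?_
      exact (green_step hl _).1

lemma green_zero_ge (hl : 4 < l) : 1 / l ≤ green l 0 := by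
  have h := green_eq hl 0
  have h1 := green_nonneg hl
  have hl0 : 0 < l := by linarith
  rw [div_le_iff₀ hl0, mul_comm]
  simp only [lap, del, if_true] at h
  linarith [h1 (0 + e1), h1 (0 - e1), h1 (0 + e2), h1 (0 - e2)]

lemma green_pos (hl : 4 < l) (v : V) : 0 < green l v := by
  have hl0 : 0 < l := by linarith
  have h := green_add_le hl _ (-v) v rfl
  rw [add_neg_cancel] at h
  have h0 := green_zero_ge hl
  have : 0 < 1 / l := by positivity
  by_contra hc
  have : green l v = 0 := le_antisymm (not_lt.1 hc) (green_nonneg hl v)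
  rw [this, mul_zero] at h
  linarith

lemma green_decay (hl : 4 < l) {ε : ℝ} (hε : 0 ≤ ε) (v : V) :
    green (l + ε) v ≤ (l / (l + ε)) ^ l1 v * green l v := by
  have hl0 : 0 < l := by linarith
  unfold green
  rw [← tsum_mul_left]
  apply (green_summable (by linarith : 4 < l + ε) v).tsum_le_tsum _
    ((green_summable hl v).mul_left _)
  intro n
  by_cases hn : n < l1 v
  · simp [pathCount_eq_zero n v hn]
  · push Not at hn
    have hp := pathCount_nonneg n v
    have h1 : pathCount n v / (l + ε) ^ (n + 1) =
        (l / (l + ε)) ^ (n + 1) * (pathCount n v / l ^ (n + 1)) := by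
      rw [div_pow]; field_simp
    rw [h1]
    apply mul_le_mul_of_nonneg_right _ (by positivity)
    apply pow_le_pow_of_le_one (by positivity) _ (by omega)
    rw [div_le_one] <;> linarith

lemma green_anti (hl : 4 < l) {l' : ℝ} (h : l ≤ l') (v : V) : green l' v ≤ green l v := by
  have h1 := green_decay hl (sub_nonneg.2 h) v
  rw [add_sub_cancel] at h1
  refine h1.trans (mul_le_of_le_one_left (green_nonneg hl v) ?_)
  apply pow_le_one₀ (div_nonneg (by linarith) (by linarith))
  rw [div_le_one] <;> linarith

/-! ### Maximum principle -/

lemma max_principle (hl : 4 < l) {f : V → ℝ} {B M : ℝ} (hB : ∀ v, f v ≤ B) (hM : 0 ≤ M)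
    (h : ∀ v, f v ≤ M ∨ l * f v ≤ lap f v) (v : V) : f v ≤ M := by
  have hl0 : 0 < l := by linarith
  obtain ⟨C, hC, hBC⟩ : ∃ C, 0 ≤ C ∧ B ≤ M + C := ⟨|B|, abs_nonneg B, by linarith [le_abs_self B]⟩
  have key : ∀ k : ℕ, ∀ v, f v ≤ M + (4 / l) ^ k * C := by
    intro k
    induction k with
    | zero => intro v; simpa using (hB v).trans hBC
    | succ k ih =>
      intro v
      have hk : 0 ≤ (4 / l) ^ k * C := mul_nonneg (pow_nonneg (geom_nonneg hl) k) hC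
      rcases h v with h | h
      · have : 0 ≤ (4 / l) ^ (k + 1) * C := mul_nonneg (pow_nonneg (geom_nonneg hl) _) hC
        linarith
      · unfold lap at h
        have h2 : l * f v ≤ 4 * (M + (4 / l) ^ k * C) := by
          linarith [ih (v + e1), ih (v - e1), ih (v + e2), ih (v - e2)]
        have h3 : l * (M + (4 / l) ^ (k + 1) * C) = l * M + 4 * ((4 / l) ^ k * C) := by
          rw [pow_succ]; field_simp
        have : l * f v ≤ l * (M + (4 / l) ^ (k + 1) * C) := by
          rw [h3]; nlinarith
        exact le_of_mul_le_mul_left this hl0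
  have ht : Filter.Tendsto (fun k : ℕ => M + (4 / l) ^ k * C) Filter.atTop (nhds (M + 0 * C)) :=
    ((tendsto_pow_atTop_nhds_zero_of_lt_one (geom_nonneg hl) (geom_lt hl)).mul_const C).const_add M
  simpa using ge_of_tendsto' ht (fun k => key k v)

lemma bounded_unique (hl : 4 < l) {f g s : V → ℝ} {B : ℝ} (hf : ∀ v, |f v| ≤ B)
    (hg : ∀ v, |g v| ≤ B) (h1 : ∀ v, l * f v = lap f v + s v)
    (h2 : ∀ v, l * g v = lap g v + s v) : f = g := by
  have key : ∀ f g : V → ℝ, (∀ v, |f v| ≤ B) → (∀ v, |g v| ≤ B) →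
      (∀ v, l * f v = lap f v + s v) → (∀ v, l * g v = lap g v + s v) → ∀ v, f v ≤ g v := by
    intro f g hf hg h1 h2 v
    have := max_principle hl (f := fun v => f v - g v) (B := 2 * B) (M := 0)
      (fun v => by linarith [abs_le.1 (hf v), abs_le.1 (hg v)]) le_rfl
      (fun v => Or.inr (by
        have a := h1 v
        have b := h2 v
        simp only [lap] at *
        linarith)) v
    linarith
  exact funext fun v => le_antisymm (key f g hf hg h1 h2 v) (key g f hg hf h2 h1 v)

lemma green_halfplane (hl : 4 < l) (v : V) (hv : v.1 ≤ 0) : green l (v - e1) ≤ green l v := by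
  have hl0 : 0 < l := by linarith
  set f : V → ℝ := fun v => green l (v - e1) - green l v with hf
  have hanti : ∀ v : V, f (1 - v.1, v.2) = - f v := by
    rintro ⟨i, j⟩
    simp only [hf, e1, Prod.mk_sub_mk, sub_zero]
    rw [show (1 - i - 1 : ℤ) = -i by ring, show (1 - i : ℤ) = -(i - 1) by ring,
      green_refl (i, j), green_refl (i - 1, j)]
    ring
  have heq : ∀ v, l * f v = lap f v + (del (v - e1) - del v) := by
    intro v
    have a := green_eq hl v
    have b := green_eq hl (v - e1)
    simp only [lap, hf] at *
    rw [show v - e1 + e1 = v by abel, show v - e1 + e2 = v + e2 - e1 by abel,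
      show v - e1 - e2 = v - e2 - e1 by abel] at b
    rw [show v + e1 - e1 = v by abel]
    linarith
  have key : ∀ k : ℕ, ∀ v : V, v.1 ≤ 0 → f v ≤ (4 / l) ^ k * (1 / (l - 4)) := by
    intro k
    induction k with
    | zero =>
      intro v _
      have := green_le hl (v - e1)
      have := green_nonneg hl v
      simp only [hf]
      simp only [pow_zero, one_mul]
      linarith
    | succ k ih =>
      intro v hv
      set c := (4 / l) ^ k * (1 / (l - 4)) with hc
      have hl4 : 0 < l - 4 := by linarith
      have hc0 : 0 ≤ c := mul_nonneg (pow_nonneg (geom_nonneg hl) k) (by positivity)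
      have e : l * ((4 / l) ^ (k + 1) * (1 / (l - 4))) = 4 * c := by
        rw [pow_succ, hc]; field_simp
      by_contra hcon
      push Not at hcon
      have hfv : 4 * c < l * f v := by
        rw [← e]; exact mul_lt_mul_of_pos_left hcon hl0
      have hfpos : 0 < f v := by
        by_contra h
        have : l * f v ≤ 0 := mul_nonpos_of_nonneg_of_nonpos hl0.le (not_lt.1 h)
        linarith
      have h1 : f (v + e1) ≤ c := by
        rcases eq_or_lt_of_le hv with h0 | h0
        · have h := hanti v
          have : (1 - v.1, v.2) = v + e1 := by
            ext <;> simp [e1, h0]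
          rw [this] at h
          linarith
        · exact ih _ (by simp [e1]; omega)
      have h2 := ih (v - e1) (by simp [e1]; omega)
      have h3 := ih (v + e2) (by simp [e2]; omega)
      have h4 := ih (v - e2) (by simp [e2]; omega)
      have hd : del (v - e1) - del v ≤ 0 := by
        have : v - e1 ≠ 0 := by
          intro h
          have := congrArg Prod.fst h
          simp [e1] at this
          omega
        simp only [del, this, if_false]
        split_ifs <;> norm_num
      have := heq v
      simp only [lap] at this
      linarith
  have ht : Filter.Tendsto (fun k : ℕ => (4 / l) ^ k * (1 / (l - 4))) Filter.atTop
      (nhds (0 * (1 / (l - 4)))) :=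
    (tendsto_pow_atTop_nhds_zero_of_lt_one (geom_nonneg hl) (geom_lt hl)).mul_const _
  have := ge_of_tendsto' ht (fun k => key k v hv)
  simp only [hf, zero_mul] at this
  linarith

/-! ### Continuity in the spectral parameter -/

lemma green_resolvent (hl : 4 < l) {l' : ℝ} (hl' : l ≤ l') (v : V) :
    green l v - green l' v ≤ (l' - l) / (l - 4) / (l - 4) := by
  have h4 : 0 < l - 4 := by linarith
  have hl'4 : 4 < l' := by linarith
  set M := (l' - l) / (l - 4) / (l - 4) with hM
  have hM0 : 0 ≤ M := by
    have : 0 ≤ l' - l := by linarith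
    positivity
  have hM1 : (l - 4) * M = (l' - l) * (1 / (l - 4)) := by rw [hM]; field_simp
  have := max_principle hl (f := fun v => green l v - green l' v - M) (B := 1 / (l - 4)) (M := 0)
    (fun v => by have := green_le hl v; have := green_nonneg hl'4 v; linarith) le_rfl
    (fun v => Or.inr (by
      have a := green_eq hl v
      have b := green_eq hl'4 v
      have c := green_nonneg hl'4 v
      have d := (green_anti hl hl' v).trans (green_le hl v)
      have e : (l' - l) * green l' v ≤ (l' - l) * (1 / (l - 4)) :=
        mul_le_mul_of_nonneg_left d (by linarith)
      simp only [lap] at *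
      linarith)) v
  linarith

lemma green_continuousAt (hl : 4 < l) (v : V) : ContinuousAt (fun l => green l v) l := by
  have hc : ∀ m : ℝ, 4 < m → ∀ᶠ l' in nhds m, |green l' v - green m v| ≤
      |l' - m| * (4 / (m - 4) / (m - 4)) := by
    intro m hm
    have : ∀ᶠ l' in nhds m, m - (m - 4) / 2 < l' := lt_mem_nhds (by linarith)
    filter_upwards [this] with l' h
    have hm4 : 0 < m - 4 := by linarith
    rcases le_total m l' with h' | h'
    · have a := green_resolvent hm h' v
      have b := green_anti hm h' v
      rw [abs_sub_comm, abs_of_nonneg (by linarith), abs_of_nonneg (by linarith)]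
      refine a.trans ?_
      rw [div_div, div_div, mul_div_assoc']
      apply div_le_div_of_nonneg_right _ (by positivity)
      linarith
    · have hl'4 : 4 < l' := by linarith
      have a := green_resolvent hl'4 h' v
      have b := green_anti hl'4 h' v
      rw [abs_of_nonneg (by linarith), abs_sub_comm l' m, abs_of_nonneg (by linarith)]
      refine a.trans ?_
      rw [div_div, div_div, mul_div_assoc', div_le_div_iff₀ (by nlinarith) (by positivity)]
      have h1 : (m - 4) * (m - 4) ≤ 4 * ((l' - 4) * (l' - 4)) := by nlinarith
      have := mul_le_mul_of_nonneg_left h1 (by linarith : 0 ≤ m - l')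
      linarith
  rw [ContinuousAt, tendsto_iff_norm_sub_tendsto_zero]
  refine squeeze_zero' (Filter.Eventually.of_forall fun _ => norm_nonneg _) (hc l hl) ?_
  have : Filter.Tendsto (fun l' => |l' - l| * (4 / (l - 4) / (l - 4))) (nhds l)
      (nhds (|l - l| * (4 / (l - 4) / (l - 4)))) := by
    apply Continuous.tendsto (f := fun l' => |l' - l| * (4 / (l - 4) / (l - 4)))
    fun_prop
  simpa using this

/-! ### Growth at the critical value -/

lemma green_lipschitz (hl : 4 < l) (v : V) :
    green l v - green l (v + e1) ≤ 1 / 4 ∧ green l v - green l (v + e2) ≤ 1 / 4 := by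
  have key : ∀ v, green l v - green l (v + e1) ≤ 1 / 4 := by
    apply max_principle hl (f := fun v => green l v - green l (v + e1)) (B := 1 / (l - 4))
      (fun v => by have := green_le hl v; have := green_nonneg hl (v + e1); linarith) (by norm_num)
    intro v
    by_cases hv : v = 0
    · left
      subst hv
      have h := green_eq hl 0
      have a : green l (0 - e1) = green l (0 + e1) := by
        rw [zero_sub, green_neg, zero_add]
      have b : green l (0 - e2) = green l (0 + e1) := by
        rw [zero_sub, green_neg, zero_add, ← green_swap]; rfl
      have c : green l (0 + e2) = green l (0 + e1) := by
        rw [zero_add, zero_add, ← green_swap]; rfl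
      have := green_nonneg hl 0
      simp only [lap, del, if_true, a, b, c] at h
      nlinarith
    · right
      have a := green_eq hl v
      have b := green_eq hl (v + e1)
      have hd : 0 ≤ del (v + e1) := by unfold del; split_ifs <;> norm_num
      simp only [del, hv, if_false] at a
      simp only [lap] at *
      rw [show v + e1 + e2 = v + e2 + e1 by abel, show v + e1 - e1 = v - e1 + e1 by abel,
        show v + e1 - e2 = v - e2 + e1 by abel] at b
      linarith
  refine ⟨key v, ?_⟩
  have := key (v.2, v.1)
  rw [green_swap] at this
  have h2 : green l ((v.2, v.1) + e1) = green l (v + e2) := by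
    rw [← green_swap]
    congr 1
  rwa [h2] at this

lemma green_box_le (hl : 4 < l) (s : Finset V) : ∑ w ∈ s, green l w ≤ 1 / (l - 4) := by
  have h4 : 0 < l - 4 := by linarith
  have := max_principle hl (f := fun v => ∑ w ∈ s, green l (v - w) - 1 / (l - 4))
    (B := ∑ w ∈ s, 1 / (l - 4)) (M := 0)
    (fun v => by
      have : ∑ w ∈ s, green l (v - w) ≤ ∑ w ∈ s, 1 / (l - 4) :=
        Finset.sum_le_sum fun w _ => green_le hl _
      have : 0 < 1 / (l - 4) := by positivity
      linarith) le_rfl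
    (fun v => Or.inr (by
      have h : l * ∑ w ∈ s, green l (v - w) =
          lap (fun v => ∑ w ∈ s, green l (v - w)) v + ∑ w ∈ s, del (v - w) := by
        simp only [lap]
        rw [Finset.mul_sum, ← Finset.sum_add_distrib, ← Finset.sum_add_distrib,
          ← Finset.sum_add_distrib, ← Finset.sum_add_distrib]
        apply Finset.sum_congr rfl
        intro w _
        rw [green_eq hl, lap, show v + e1 - w = v - w + e1 by abel,
          show v + e2 - w = v - w + e2 by abel, show v - e1 - w = v - w - e1 by abel,
          show v - e2 - w = v - w - e2 by abel]
      have hd : ∑ w ∈ s, del (v - w) ≤ 1 := by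
        simp only [del, sub_eq_zero]
        rw [Finset.sum_ite_eq]
        split_ifs <;> norm_num
      have e : (l - 4) * (1 / (l - 4)) = 1 := by field_simp
      simp only [lap] at *
      linarith)) 0
  simp only [zero_sub, green_neg] at this
  linarith

lemma green_cube (hl : 4 < l) : (l - 4) * green l 0 ^ 3 ≤ 8 + (l - 4) := by
  have h4 : 0 < l - 4 := by linarith
  have hg := green_nonneg hl 0
  rcases le_total (green l 0) 1 with h | h
  · have : green l 0 ^ 3 ≤ 1 := pow_le_one₀ hg h
    nlinarith
  · set k := ⌊green l 0⌋₊ with hk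
    have hk1 : (k : ℝ) ≤ green l 0 := Nat.floor_le hg
    have hk2 : green l 0 < k + 1 := Nat.lt_floor_add_one _
    have hk3 : 1 ≤ k := Nat.le_floor (by simpa using h)
    have hk4 : (1 : ℝ) ≤ k := by exact_mod_cast hk3
    have hrow : ∀ i : ℕ, green l 0 - i / 4 ≤ green l ((i : ℤ), 0) := by
      intro i
      induction i with
      | zero => simp; exact le_of_eq rfl
      | succ i ih =>
        have := (green_lipschitz hl ((i : ℤ), 0)).1
        have e : ((i : ℤ), (0 : ℤ)) + e1 = (((i + 1 : ℕ) : ℤ), 0) := by simp [e1]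
        rw [e] at this
        push_cast at *
        linarith
    have hbox : ∀ i j : ℕ, green l 0 - i / 4 - j / 4 ≤ green l ((i : ℤ), (j : ℤ)) := by
      intro i j
      induction j with
      | zero => simpa using hrow i
      | succ j ih =>
        have := (green_lipschitz hl ((i : ℤ), (j : ℤ))).2
        have e : ((i : ℤ), (j : ℤ)) + e2 = ((i : ℤ), ((j + 1 : ℕ) : ℤ)) := by simp [e2]
        rw [e] at this
        push_cast at *
        linarith
    have hs := green_box_le hl ((Finset.range k ×ˢ Finset.range k).map
      ⟨fun q : ℕ × ℕ => (((q.1 : ℤ), (q.2 : ℤ)) : V), fun a b h => by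
        simpa [Prod.ext_iff] using h⟩)
    rw [Finset.sum_map] at hs
    have hlow : ∑ q ∈ Finset.range k ×ˢ Finset.range k, green l 0 / 2 ≤
        ∑ q ∈ Finset.range k ×ˢ Finset.range k, green l ((q.1 : ℤ), (q.2 : ℤ)) := by
      apply Finset.sum_le_sum
      intro q hq
      simp only [Finset.mem_product, Finset.mem_range] at hq
      refine le_trans ?_ (hbox q.1 q.2)
      have a : (q.1 : ℝ) ≤ k := by exact_mod_cast hq.1.le
      have b : (q.2 : ℝ) ≤ k := by exact_mod_cast hq.2.le
      linarith
    rw [Finset.sum_const, Finset.card_product, Finset.card_range, nsmul_eq_mul] at hlow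
    have h5 : (k : ℝ) * k * (green l 0 / 2) ≤ 1 / (l - 4) := by
      push_cast at hlow
      exact hlow.trans hs
    rw [le_div_iff₀ h4] at h5
    have h6 : green l 0 ≤ 2 * k := by linarith
    have h8 : green l 0 * green l 0 ≤ (2 * k) * (2 * k) := mul_le_mul h6 h6 hg (by positivity)
    have h7 : green l 0 ^ 3 ≤ 8 * (k * k * (green l 0 / 2)) := by
      have := mul_le_mul_of_nonneg_right h8 hg
      linarith [show green l 0 ^ 3 = green l 0 * green l 0 * green l 0 by ring]
    have := mul_le_mul_of_nonneg_left h7 h4.le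
    linarith

/-! ### Smoothing by binomial averages -/

lemma sum_choose_sq (N : ℕ) :
    ∑ i ∈ Finset.range (N + 1), (N.choose i : ℝ) * (2 * i - N) ^ 2 = (N : ℝ) * 2 ^ N := by
  have h := congrArg (Polynomial.eval (1 / 2 : ℝ)) (bernsteinPolynomial.variance ℝ N)
  simp only [bernsteinPolynomial, Polynomial.eval_finsetSum, Polynomial.eval_mul,
    Polynomial.eval_pow, Polynomial.eval_sub, Polynomial.eval_X, Polynomial.eval_one,
    Polynomial.eval_natCast, Polynomial.eval_smul, nsmul_eq_mul] at h
  have e : ∀ i ∈ Finset.range (N + 1), (N.choose i : ℝ) * (2 * i - N) ^ 2 =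
      4 * 2 ^ N * ((N * (1 / 2 : ℝ) - i) ^ 2 * ((N.choose i : ℝ) * (1 / 2) ^ i *
        (1 - 1 / 2) ^ (N - i))) := by
    intro i hi
    have hi' : i ≤ N := by simpa [Nat.lt_succ_iff] using hi
    have : (1 / 2 : ℝ) ^ i * (1 - 1 / 2) ^ (N - i) * 2 ^ N = 1 := by
      rw [show (1 - 1 / 2 : ℝ) = 1 / 2 by norm_num, ← pow_add, Nat.add_sub_cancel' hi', ← mul_pow]
      norm_num
    linear_combination (-(N.choose i : ℝ) * (2 * i - N) ^ 2) * this
  rw [Finset.sum_congr rfl e, ← Finset.mul_sum, h]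
  ring

lemma sum_choose_abs (N : ℕ) :
    ∑ i ∈ Finset.range (N + 1), (N.choose i : ℝ) * |2 * (i : ℝ) - N| ≤ Real.sqrt N * 2 ^ N := by
  have h := Finset.sum_mul_sq_le_sq_mul_sq (Finset.range (N + 1))
    (fun i => Real.sqrt (N.choose i : ℝ)) (fun i => Real.sqrt (N.choose i : ℝ) * |2 * (i : ℝ) - N|)
  have e1 : ∀ i : ℕ, Real.sqrt (N.choose i : ℝ) * (Real.sqrt (N.choose i : ℝ) *
      |2 * (i : ℝ) - N|) = (N.choose i : ℝ) * |2 * (i : ℝ) - N| := by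
    intro i
    rw [← mul_assoc, Real.mul_self_sqrt (by positivity)]
  have e2 : ∑ i ∈ Finset.range (N + 1), Real.sqrt (N.choose i : ℝ) ^ 2 = 2 ^ N := by
    simp_rw [Real.sq_sqrt (Nat.cast_nonneg _)]
    exact_mod_cast Nat.sum_range_choose N
  have e3 : ∑ i ∈ Finset.range (N + 1), (Real.sqrt (N.choose i : ℝ) * |2 * (i : ℝ) - N|) ^ 2 =
      (N : ℝ) * 2 ^ N := by
    simp_rw [mul_pow, Real.sq_sqrt (Nat.cast_nonneg _), sq_abs]
    exact sum_choose_sq N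
  simp_rw [e1] at h
  rw [e2, e3] at h
  apply le_of_sq_le_sq _ (by positivity)
  rw [mul_pow, Real.sq_sqrt (Nat.cast_nonneg _)]
  linarith

lemma choose_diff (j : ℕ) (a : ℕ → ℝ) :
    ((j + 1 : ℕ) : ℝ) * ∑ i ∈ Finset.range (j + 1), (j.choose i : ℝ) * (a (i + 1) - a i) =
      ∑ i ∈ Finset.range (j + 2), ((j + 1).choose i : ℝ) * (2 * i - (j + 1 : ℕ)) * a i := by
  have h1 : ∀ i, ((j + 1 : ℕ) : ℝ) * (j.choose i : ℝ) = ((j + 1).choose (i + 1) : ℝ) * (i + 1 : ℕ) := by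
    intro i
    exact_mod_cast Nat.add_one_mul_choose_eq j i
  have h2 : ∀ i ∈ Finset.range (j + 1), ((j + 1 : ℕ) : ℝ) * (j.choose i : ℝ) =
      ((j + 1).choose i : ℝ) * ((j + 1 : ℕ) - i) := by
    intro i hi
    have hi' : i ≤ j := by simpa [Nat.lt_succ_iff] using hi
    have := Nat.choose_mul_succ_eq j i
    have h3 : ((j + 1 - i : ℕ) : ℝ) = (j + 1 : ℕ) - i := by
      rw [Nat.cast_sub (by omega)]
    rw [← h3, mul_comm]
    exact_mod_cast this
  have s1 : ∑ i ∈ Finset.range (j + 1), ((j + 1 : ℕ) : ℝ) * (j.choose i : ℝ) * a (i + 1) =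
      ∑ i ∈ Finset.range (j + 2), ((j + 1).choose i : ℝ) * i * a i := by
    rw [Finset.sum_range_succ' _ (j + 1)]
    simp only [Nat.cast_zero, mul_zero, zero_mul, add_zero]
    exact Finset.sum_congr rfl fun i _ => by rw [h1]
  have s2 : ∑ i ∈ Finset.range (j + 1), ((j + 1 : ℕ) : ℝ) * (j.choose i : ℝ) * a i =
      ∑ i ∈ Finset.range (j + 2), ((j + 1).choose i : ℝ) * ((j + 1 : ℕ) - i) * a i := by
    rw [Finset.sum_range_succ _ (j + 1)]
    simp only [sub_self, mul_zero, zero_mul, add_zero]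
    exact Finset.sum_congr rfl fun i hi => by rw [h2 i hi]
  rw [Finset.mul_sum]
  calc _ = ∑ i ∈ Finset.range (j + 1), ((j + 1 : ℕ) : ℝ) * (j.choose i : ℝ) * a (i + 1) -
        ∑ i ∈ Finset.range (j + 1), ((j + 1 : ℕ) : ℝ) * (j.choose i : ℝ) * a i := by
        rw [← Finset.sum_sub_distrib]
        exact Finset.sum_congr rfl fun i _ => by ring
    _ = _ := by
        rw [s1, s2, ← Finset.sum_sub_distrib]
        exact Finset.sum_congr rfl fun i _ => by ring

lemma binomial_smoothing (j : ℕ) (a : ℕ → ℝ) {K : ℝ} (ha : ∀ i, |a i| ≤ K) :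
    |∑ i ∈ Finset.range (j + 1), (j.choose i : ℝ) * (a (i + 1) - a i)| ≤
      2 ^ j * (2 / Real.sqrt (j + 1)) * K := by
  have hK : 0 ≤ K := (abs_nonneg _).trans (ha 0)
  have hj : (0 : ℝ) < (j + 1 : ℕ) := by positivity
  have hs : 0 < Real.sqrt (j + 1 : ℕ) := Real.sqrt_pos.2 hj
  have h1 : |((j + 1 : ℕ) : ℝ) * ∑ i ∈ Finset.range (j + 1), (j.choose i : ℝ) * (a (i + 1) - a i)| ≤
      Real.sqrt (j + 1 : ℕ) * 2 ^ (j + 1) * K := by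
    rw [choose_diff]
    refine (Finset.abs_sum_le_sum_abs _ _).trans ?_
    refine le_trans ?_ (mul_le_mul_of_nonneg_right (sum_choose_abs (j + 1)) hK)
    rw [Finset.sum_mul]
    apply Finset.sum_le_sum
    intro i _
    rw [abs_mul, abs_mul, Nat.abs_cast]
    exact mul_le_mul_of_nonneg_left (ha i) (by positivity)
  rw [abs_mul, abs_of_pos hj] at h1
  have h2 : ((j + 1 : ℕ) : ℝ) * (2 ^ j * (2 / Real.sqrt (j + 1)) * K) =
      Real.sqrt (j + 1 : ℕ) * 2 ^ (j + 1) * K := by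
    have e : ((j + 1 : ℕ) : ℝ) = Real.sqrt (j + 1 : ℕ) * Real.sqrt (j + 1 : ℕ) :=
      (Real.mul_self_sqrt hj.le).symm
    have e' : Real.sqrt ((j : ℝ) + 1) = Real.sqrt (j + 1 : ℕ) := by push_cast; rfl
    rw [e', pow_succ]
    nth_rewrite 1 [e]
    field_simp
  rw [← h2] at h1
  exact le_of_mul_le_mul_left h1 hj

/-! ### Shift operators -/

/-- Shift of a function of two lattice points. -/
def shift₂ (a b : V) : Module.End ℝ (V → V → ℝ) where
  toFun f := fun c d => f (c + a) (d + b)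
  map_add' _ _ := rfl
  map_smul' _ _ := rfl

/-- Shift of a function of one lattice point. -/
def shift₁ (a : V) : Module.End ℝ (V → ℝ) where
  toFun f := fun c => f (c + a)
  map_add' _ _ := rfl
  map_smul' _ _ := rfl

lemma shift₂_comm (a b a' b' : V) : Commute (shift₂ a b) (shift₂ a' b') := by
  refine LinearMap.ext fun f => ?_
  funext c d
  show f (c + a + a') (d + b + b') = f (c + a' + a) (d + b' + b)
  rw [add_right_comm c, add_right_comm d]

lemma shift₁_comm (a a' : V) : Commute (shift₁ a) (shift₁ a') := by
  refine LinearMap.ext fun f => ?_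
  funext c
  show f (c + a + a') = f (c + a' + a)
  rw [add_right_comm c]

/-- Symmetric sum of two shifts in one variable. -/
def sym₁ (u : V) : Module.End ℝ (V → ℝ) := shift₁ u + shift₁ (-u)

lemma sym₁_comm (u w : V) : Commute (sym₁ u) (sym₁ w) :=
  ((shift₁_comm _ _).add_right (shift₁_comm _ _)).add_left
    ((shift₁_comm _ _).add_right (shift₁_comm _ _))

/-- Average over a diagonal step. -/
def diagAvg (u : V) : Module.End ℝ (V → V → ℝ) := (1 / 2 : ℝ) • (1 + shift₂ u u)

/-- Relative displacement along `u`. -/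
def relShift (u : V) : Module.End ℝ (V → V → ℝ) := shift₂ 0 (-u) + shift₂ (-u) 0

/-- Half the sum of the shifts along `w` in either variable. -/
def sideShift (w : V) : Module.End ℝ (V → V → ℝ) :=
  (1 / 2 : ℝ) • (shift₂ w 0 + shift₂ (-w) 0 + shift₂ 0 w + shift₂ 0 (-w))

lemma shift_sideShift (a b w : V) : Commute (shift₂ a b) (sideShift w) :=
  ((((shift₂_comm _ _ _ _).add_right (shift₂_comm _ _ _ _)).add_right
    (shift₂_comm _ _ _ _)).add_right (shift₂_comm _ _ _ _)).smul_right _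

lemma relShift_sideShift (u w : V) : Commute (relShift u) (sideShift w) :=
  (shift_sideShift _ _ _).add_left (shift_sideShift _ _ _)

lemma diagAvg_sideShift (u w : V) : Commute (diagAvg u) (sideShift w) :=
  ((Commute.one_left _).add_left (shift_sideShift _ _ _)).smul_left _

lemma diagAvg_relShift (u : V) : Commute (diagAvg u) (relShift u) :=
  ((Commute.one_left _).add_left
    ((shift₂_comm _ _ _ _).add_right (shift₂_comm _ _ _ _))).smul_left _

lemma shift_pow (u : V) (i : ℕ) (g : V → V → ℝ) (c d : V) :
    ((shift₂ u u) ^ i) g c d = g (c + i • u) (d + i • u) := by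
  induction i generalizing c d with
  | zero => simp
  | succ i ih =>
    rw [pow_succ']
    show ((shift₂ u u) ^ i) g (c + u) (d + u) = _
    rw [ih, succ_nsmul', add_assoc, add_assoc]

lemma diagAvg_pow (u : V) (j : ℕ) (g : V → V → ℝ) (c d : V) :
    ((diagAvg u) ^ j) g c d =
      (1 / 2 : ℝ) ^ j * ∑ i ∈ Finset.range (j + 1), (j.choose i : ℝ) * g (c + i • u) (d + i • u) := by
  unfold diagAvg
  rw [smul_pow, add_comm, (Commute.one_right (shift₂ u u)).add_pow]
  simp only [one_pow, mul_one, LinearMap.smul_apply, Pi.smul_apply, smul_eq_mul,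
    LinearMap.sum_apply, Finset.sum_apply]
  congr 1
  apply Finset.sum_congr rfl
  intro i _
  rw [← nsmul_eq_mul', LinearMap.smul_apply, Pi.smul_apply, Pi.smul_apply, shift_pow, nsmul_eq_mul]

lemma diag_diff_le (u : V) (j : ℕ) (g : V → V → ℝ) {P : V → ℝ}
    (hg : ∀ c d, |g c d| ≤ P (c - d)) (c d : V) :
    |((diagAvg u) ^ j) g (c + u) (d + u) - ((diagAvg u) ^ j) g c d| ≤
      2 / Real.sqrt (j + 1) * P (c - d) := by
  rw [diagAvg_pow, diagAvg_pow, ← mul_sub, ← Finset.sum_sub_distrib]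
  have h := binomial_smoothing j (fun i => g (c + i • u) (d + i • u)) (K := P (c - d))
    (fun i => by simpa using hg (c + i • u) (d + i • u))
  have e : ∀ i : ℕ, (j.choose i : ℝ) * g (c + u + i • u) (d + u + i • u) -
      (j.choose i : ℝ) * g (c + i • u) (d + i • u) =
      (j.choose i : ℝ) * (g (c + (i + 1) • u) (d + (i + 1) • u) - g (c + i • u) (d + i • u)) := by
    intro i
    rw [succ_nsmul', ← add_assoc, ← add_assoc, mul_sub]
  simp_rw [e]
  rw [abs_mul, abs_of_pos (by positivity : (0 : ℝ) < (1 / 2) ^ j)]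
  calc _ ≤ (1 / 2 : ℝ) ^ j * (2 ^ j * (2 / Real.sqrt (j + 1)) * P (c - d)) :=
        mul_le_mul_of_nonneg_left h (by positivity)
    _ = ((1 / 2 : ℝ) ^ j * 2 ^ j) * (2 / Real.sqrt (j + 1) * P (c - d)) := by ring
    _ = _ := by rw [← mul_pow]; norm_num

lemma relShift_dom (u : V) {g : V → V → ℝ} {P : V → ℝ} (hg : ∀ c d, |g c d| ≤ P (c - d)) (c d : V) :
    |relShift u g c d| ≤ sym₁ u P (c - d) := by
  show |g (c + 0) (d + -u) + g (c + -u) (d + 0)| ≤ P (c - d + u) + P (c - d + -u)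
  refine (abs_add_le _ _).trans (add_le_add ?_ ?_)
  · have h := hg (c + 0) (d + -u)
    rwa [show c + 0 - (d + -u) = c - d + u by abel] at h
  · have h := hg (c + -u) (d + 0)
    rwa [show c + -u - (d + 0) = c - d + -u by abel] at h

lemma sideShift_dom (w : V) {g : V → V → ℝ} {P : V → ℝ} (hg : ∀ c d, |g c d| ≤ P (c - d)) (c d : V) :
    |sideShift w g c d| ≤ sym₁ w P (c - d) := by
  show |(1 / 2 : ℝ) * (g (c + w) (d + 0) + g (c + -w) (d + 0) + g (c + 0) (d + w) +
    g (c + 0) (d + -w))| ≤ P (c - d + w) + P (c - d + -w)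
  have h1 := abs_le.1 (hg (c + w) (d + 0))
  have h2 := abs_le.1 (hg (c + -w) (d + 0))
  have h3 := abs_le.1 (hg (c + 0) (d + w))
  have h4 := abs_le.1 (hg (c + 0) (d + -w))
  rw [show c + w - (d + 0) = c - d + w by abel] at h1
  rw [show c + -w - (d + 0) = c - d + -w by abel] at h2
  rw [show c + 0 - (d + w) = c - d + -w by abel] at h3
  rw [show c + 0 - (d + -w) = c - d + w by abel] at h4
  rw [abs_le]
  constructor <;> linarith

lemma pow_dom {T : Module.End ℝ (V → V → ℝ)} {t : Module.End ℝ (V → ℝ)}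
    (hT : ∀ (g : V → V → ℝ) (P : V → ℝ), (∀ c d, |g c d| ≤ P (c - d)) →
      ∀ c d, |T g c d| ≤ t P (c - d)) (j : ℕ) (g : V → V → ℝ) (P : V → ℝ)
    (hg : ∀ c d, |g c d| ≤ P (c - d)) : ∀ c d, |(T ^ j) g c d| ≤ (t ^ j) P (c - d) := by
  induction j with
  | zero => simpa using hg
  | succ j ih =>
    rw [pow_succ', pow_succ']
    exact hT _ _ ih

lemma pow_mono {t : Module.End ℝ (V → ℝ)} (ht : ∀ f g : V → ℝ, f ≤ g → t f ≤ t g) (j : ℕ)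
    (f g : V → ℝ) (h : f ≤ g) : (t ^ j) f ≤ (t ^ j) g := by
  induction j with
  | zero => simpa using h
  | succ j ih =>
    rw [pow_succ']
    exact ht _ _ ih

lemma sym₁_mono (u : V) (f g : V → ℝ) (h : f ≤ g) : sym₁ u f ≤ sym₁ u g := fun v =>
  add_le_add (h (v + u)) (h (v + -u))

lemma sqrt_sum_bound (n : ℕ) (P : ℕ → ℝ) (hP : ∀ j, 0 ≤ P j) {X Y : ℝ}
    (hX : ∑ j ∈ Finset.range (n + 1), (n.choose j : ℝ) * P j ≤ X)
    (hY : ∑ j ∈ Finset.range (n + 1), (n.choose j : ℝ) / (j + 1) * P j ≤ Y) :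
    ∑ j ∈ Finset.range (n + 1), (n.choose j : ℝ) * (2 / Real.sqrt (j + 1) * P j) ≤
      2 * Real.sqrt (X * Y) := by
  have h := Finset.sum_mul_sq_le_sq_mul_sq (Finset.range (n + 1))
    (fun j => Real.sqrt ((n.choose j : ℝ) * P j))
    (fun j => Real.sqrt ((n.choose j : ℝ) / (j + 1) * P j))
  have p1 : ∀ j, 0 ≤ (n.choose j : ℝ) * P j := fun j => mul_nonneg (by positivity) (hP j)
  have p2 : ∀ j : ℕ, 0 ≤ (n.choose j : ℝ) / (j + 1) * P j := fun j => mul_nonneg (by positivity) (hP j)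
  have e1 : ∀ j : ℕ, Real.sqrt ((n.choose j : ℝ) * P j) * Real.sqrt ((n.choose j : ℝ) / (j + 1) * P j) =
      (n.choose j : ℝ) * P j / Real.sqrt (j + 1) := by
    intro j
    rw [← Real.sqrt_mul (p1 j), show (n.choose j : ℝ) * P j * ((n.choose j : ℝ) / (j + 1) * P j) =
      ((n.choose j : ℝ) * P j) ^ 2 / (j + 1) by ring, Real.sqrt_div (by positivity),
      Real.sqrt_sq (p1 j)]
  simp_rw [e1, Real.sq_sqrt (p1 _), Real.sq_sqrt (p2 _)] at h
  have e2 : ∑ j ∈ Finset.range (n + 1), (n.choose j : ℝ) * (2 / Real.sqrt (j + 1) * P j) =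
      2 * ∑ j ∈ Finset.range (n + 1), (n.choose j : ℝ) * P j / Real.sqrt (j + 1) := by
    rw [Finset.mul_sum]
    exact Finset.sum_congr rfl fun j _ => by ring
  rw [e2]
  apply mul_le_mul_of_nonneg_left _ (by norm_num)
  apply Real.le_sqrt_of_sq_le
  refine h.trans (mul_le_mul hX hY (Finset.sum_nonneg fun j _ => p2 j) ?_)
  exact (Finset.sum_nonneg fun j _ => p1 j).trans hX

lemma shift_bound {u w : V}
    (huw : ∀ (f : V → ℝ) v, lap f v = f (v + u) + f (v + -u) + (f (v + w) + f (v + -w)))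
    {l M κ K : ℝ} (hl : 0 < l) (hM : 0 ≤ M) (hκ : 0 < κ) {Ψ : V → ℝ} (hΨ0 : ∀ z, 0 ≤ Ψ z)
    (hΨ : ∀ z, lap Ψ z ≤ M * Ψ z) (hΨκ : ∀ z, κ * Ψ z ≤ Ψ (z + u) + Ψ (z + -u))
    {f : V → V → ℝ} (hfc : ∀ c d, l * f c d = lap (fun c => f c d) c)
    (hfd : ∀ c d, l * f c d = lap (f c) d) (hK : 0 ≤ K)
    (hf : ∀ c d, |f c d| ≤ K * Ψ (c - d)) (n : ℕ) (c d : V) :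
    |f (c + u) (d + u) - f c d| ≤
      2 * K * (M / l) ^ n * Real.sqrt (M / ((n + 1) * κ)) * Ψ (c - d) := by
  set T := diagAvg u * relShift u with hT
  have hstep : l • f = (T + sideShift w) f := by
    funext c d
    have h1 := hfc c d
    have h2 := hfd c d
    rw [huw] at h1 h2
    show l * f c d = (1 / 2 : ℝ) * ((f (c + 0) (d + -u) + f (c + -u) (d + 0)) +
      (f (c + u + 0) (d + u + -u) + f (c + u + -u) (d + u + 0))) +
      (1 / 2 : ℝ) * (f (c + w) (d + 0) + f (c + -w) (d + 0) + f (c + 0) (d + w) + f (c + 0) (d + -w))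
    simp only [add_zero, add_neg_cancel_right]
    linarith
  have hpow : ∀ n : ℕ, l ^ n • f = ((T + sideShift w) ^ n) f := by
    intro n
    induction n with
    | zero => simp
    | succ n ih =>
      rw [pow_succ, mul_smul, hstep, pow_succ, Module.End.mul_apply, ← hstep, map_smul, ← ih,
        smul_comm]
  have hcomm : Commute T (sideShift w) := (diagAvg_sideShift u w).mul_left (relShift_sideShift u w)
  have hexp : ∀ c d, l ^ n * f c d = ∑ j ∈ Finset.range (n + 1), (n.choose j : ℝ) *
      ((diagAvg u) ^ j) (((relShift u) ^ j) (((sideShift w) ^ (n - j)) f)) c d := by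
    intro c d
    have h := congrFun (congrFun (hpow n) c) d
    rw [hcomm.add_pow] at h
    simp only [LinearMap.sum_apply, Finset.sum_apply] at h
    rw [show (l ^ n • f) c d = l ^ n * f c d from rfl] at h
    rw [h]
    apply Finset.sum_congr rfl
    intro j _
    rw [← nsmul_eq_mul', LinearMap.smul_apply, Pi.smul_apply, Pi.smul_apply, nsmul_eq_mul, hT,
      (diagAvg_relShift u).mul_pow]
    rfl
  set P : ℕ → V → ℝ := fun j => ((sym₁ u) ^ j) (((sym₁ w) ^ (n - j)) (K • Ψ)) with hP
  have hdom : ∀ j c d, |((relShift u) ^ j) (((sideShift w) ^ (n - j)) f) c d| ≤ P j (c - d) := by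
    intro j
    apply pow_dom (fun g P h => relShift_dom u h)
    apply pow_dom (fun g P h => sideShift_dom w h)
    exact hf
  have hPnn : ∀ j z, 0 ≤ P j z := fun j z => by
    have := hdom j z 0
    rw [sub_zero] at this
    exact (abs_nonneg _).trans this
  have hmono : ∀ f g : V → ℝ, f ≤ g → (sym₁ u + sym₁ w) f ≤ (sym₁ u + sym₁ w) g := fun f g h v =>
    add_le_add (sym₁_mono u f g h v) (sym₁_mono w f g h v)
  have hlapop : ∀ g : V → ℝ, (sym₁ u + sym₁ w) g = lap g := fun g => by
    funext v; rw [huw]; rfl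
  have hMpow : ∀ m : ℕ, ((sym₁ u + sym₁ w) ^ m) (K • Ψ) ≤ (M ^ m * K) • Ψ := by
    intro m
    induction m with
    | zero => simp
    | succ m ih =>
      rw [pow_succ', Module.End.mul_apply]
      refine (hmono _ _ ih).trans ?_
      rw [map_smul, hlapop]
      intro z
      show M ^ m * K * lap Ψ z ≤ M ^ (m + 1) * K * Ψ z
      have := mul_le_mul_of_nonneg_left (hΨ z) (by positivity : 0 ≤ M ^ m * K)
      calc _ ≤ _ := this
        _ = _ := by ring
  have hsum : ∀ z, ∑ j ∈ Finset.range (n + 1), (n.choose j : ℝ) * P j z ≤ M ^ n * K * Ψ z := by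
    intro z
    have h := hMpow n z
    rw [(sym₁_comm u w).add_pow] at h
    simp only [LinearMap.sum_apply, Finset.sum_apply] at h
    refine le_trans (le_of_eq ?_) h
    apply Finset.sum_congr rfl
    intro j _
    rw [← nsmul_eq_mul', LinearMap.smul_apply, Pi.smul_apply, nsmul_eq_mul]
    rfl
  have hPκ : ∀ j z, κ * P j z ≤ ((sym₁ u) ^ (j + 1)) (((sym₁ w) ^ (n - j)) (K • Ψ)) z := by
    intro j z
    have h : κ • (K • Ψ) ≤ sym₁ u (K • Ψ) := by
      intro v
      show κ * (K * Ψ v) ≤ K * Ψ (v + u) + K * Ψ (v + -u)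
      have := mul_le_mul_of_nonneg_left (hΨκ v) hK
      linarith
    have h2 := pow_mono (sym₁_mono u) j _ _ (pow_mono (sym₁_mono w) (n - j) _ _ h) z
    rw [map_smul, map_smul] at h2
    refine le_trans h2 (le_of_eq ?_)
    rw [pow_succ, Module.End.mul_apply]
    have hc : Commute ((sym₁ w) ^ (n - j)) (sym₁ u) := (sym₁_comm w u).pow_left _
    have := LinearMap.congr_fun hc.eq (K • Ψ)
    rw [Module.End.mul_apply, Module.End.mul_apply] at this
    rw [this]
  have hsum2 : ∀ z, ∑ j ∈ Finset.range (n + 1), (n.choose j : ℝ) / (j + 1) * P j z ≤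
      M ^ (n + 1) * K * Ψ z / ((n + 1) * κ) := by
    intro z
    have h := hMpow (n + 1) z
    rw [(sym₁_comm u w).add_pow] at h
    simp only [LinearMap.sum_apply, Finset.sum_apply] at h
    rw [Finset.sum_range_succ'] at h
    rw [le_div_iff₀ (by positivity), Finset.sum_mul]
    have h0 : 0 ≤ ((sym₁ u ^ 0 * sym₁ w ^ (n + 1 - 0) * ((n + 1).choose 0 : Module.End ℝ (V → ℝ)))
        (K • Ψ)) z := by
      simp only [pow_zero, one_mul, Nat.choose_zero_right, Nat.cast_one, mul_one]
      have := pow_mono (sym₁_mono w) (n + 1 - 0) 0 (K • Ψ) (fun v => mul_nonneg hK (hΨ0 v)) z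
      rwa [map_zero] at this
    refine le_trans ?_ ((le_add_of_nonneg_right h0).trans h)
    apply Finset.sum_le_sum
    intro j _
    rw [← nsmul_eq_mul', LinearMap.smul_apply, Pi.smul_apply, nsmul_eq_mul, Nat.add_sub_add_right,
      Module.End.mul_apply]
    have e : ((n : ℝ) + 1) * (n.choose j : ℝ) = ((n + 1).choose (j + 1) : ℝ) * (j + 1) := by
      exact_mod_cast Nat.add_one_mul_choose_eq n j
    have hj : (0 : ℝ) < j + 1 := by positivity
    have e2 : (n.choose j : ℝ) / (j + 1) * P j z * ((n + 1) * κ) =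
        ((n + 1).choose (j + 1) : ℝ) * (κ * P j z) := by
      field_simp
      linear_combination (P j z) * e
    rw [e2]
    exact mul_le_mul_of_nonneg_left (hPκ j z) (by positivity)
  have hmain : |l ^ n * (f (c + u) (d + u) - f c d)| ≤
      2 * Real.sqrt (M ^ n * K * Ψ (c - d) * (M ^ (n + 1) * K * Ψ (c - d) / ((n + 1) * κ))) := by
    rw [mul_sub, hexp, hexp, ← Finset.sum_sub_distrib]
    refine (Finset.abs_sum_le_sum_abs _ _).trans ?_
    refine le_trans (Finset.sum_le_sum fun j _ => ?_)
      (sqrt_sum_bound n (fun j => P j (c - d)) (fun j => hPnn j _) (hsum _) (hsum2 _))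
    rw [← mul_sub, abs_mul, Nat.abs_cast]
    exact mul_le_mul_of_nonneg_left (diag_diff_le u j _ (hdom j) c d) (by positivity)
  have hln : 0 < l ^ n := by positivity
  have hn : (0 : ℝ) < n + 1 := by positivity
  have hA : 0 ≤ M ^ n * K * Ψ (c - d) := mul_nonneg (by positivity) (hΨ0 _)
  rw [show M ^ n * K * Ψ (c - d) * (M ^ (n + 1) * K * Ψ (c - d) / ((n + 1) * κ)) =
    (M ^ n * K * Ψ (c - d)) ^ 2 * (M / ((n + 1) * κ)) by rw [pow_succ]; ring,
    Real.sqrt_mul (by positivity), Real.sqrt_sq hA, abs_mul, abs_of_pos hln] at hmain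
  rw [div_pow]
  have : |f (c + u) (d + u) - f c d| ≤
      2 * (M ^ n * K * Ψ (c - d) * Real.sqrt (M / ((n + 1) * κ))) / l ^ n := by
    rw [le_div_iff₀ hln, mul_comm]
    exact hmain
  refine this.trans (le_of_eq ?_)
  field_simp

/-! ### A supersolution dominating the inverse Green function -/

lemma geom_natAbs_summable {q : ℝ} (hq0 : 0 ≤ q) (hq1 : q < 1) :
    Summable fun i : ℤ => q ^ i.natAbs := by
  apply Summable.of_nat_of_neg <;> simpa using summable_geometric_of_lt_one hq0 hq1

lemma geom_natAbs_tsum_le {q : ℝ} (hq0 : 0 ≤ q) (hq1 : q < 1) :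
    ∑' i : ℤ, q ^ i.natAbs ≤ 2 / (1 - q) := by
  have h1 : Summable fun n : ℕ => q ^ ((n : ℤ)).natAbs := by
    simpa using summable_geometric_of_lt_one hq0 hq1
  have h2 : Summable fun n : ℕ => q ^ (-((n : ℤ) + 1)).natAbs := by
    have : Summable fun n : ℕ => q ^ (n + 1) :=
      (summable_nat_add_iff 1).2 (summable_geometric_of_lt_one hq0 hq1)
    refine this.congr fun n => ?_
    congr 1
  rw [tsum_of_nat_of_neg_add_one (f := fun i : ℤ => q ^ i.natAbs) h1 h2]
  have e1 : ∑' n : ℕ, q ^ ((n : ℤ)).natAbs = 1 / (1 - q) := by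
    simp [tsum_geometric_of_lt_one hq0 hq1]
  have e2 : ∑' n : ℕ, q ^ (-((n : ℤ) + 1)).natAbs ≤ 1 / (1 - q) := by
    rw [← e1]
    refine h2.tsum_le_tsum (fun n => ?_) h1
    exact pow_le_pow_of_le_one hq0 hq1.le (by omega)
  calc _ ≤ 1 / (1 - q) + 1 / (1 - q) := add_le_add e1.le e2
    _ = _ := by ring

lemma geom_l1_summable {q : ℝ} (hq0 : 0 ≤ q) (hq1 : q < 1) :
    Summable fun v : V => q ^ l1 v := by
  have h := geom_natAbs_summable hq0 hq1
  have := h.mul_of_nonneg h (fun i => by positivity) (fun i => by positivity)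
  refine this.congr fun v => ?_
  rw [l1, pow_add]

lemma geom_l1_tsum_le {q : ℝ} (hq0 : 0 ≤ q) (hq1 : q < 1) :
    ∑' v : V, q ^ l1 v ≤ (2 / (1 - q)) ^ 2 := by
  have h := geom_natAbs_summable hq0 hq1
  have hs := h.mul_of_nonneg h (fun i => by positivity) (fun i => by positivity)
  have e : ∑' v : V, q ^ l1 v = (∑' i : ℤ, q ^ i.natAbs) * ∑' i : ℤ, q ^ i.natAbs := by
    rw [h.tsum_mul_tsum h hs]
    exact tsum_congr fun v => by rw [l1, pow_add]
  rw [e, sq]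
  have h0 : 0 ≤ ∑' i : ℤ, q ^ i.natAbs := tsum_nonneg fun i => by positivity
  have := geom_natAbs_tsum_le hq0 hq1
  exact mul_le_mul this this h0 (h0.trans this)

/-- The Green function with mass `M` integrated against the inverse Green function with mass `l`. -/
def invGreen (l M : ℝ) (z : V) : ℝ := ∑' w, green M w / green l (z + w)

variable {l : ℝ}

lemma invGreen_term_le (hl : 4 < l) {ε : ℝ} (hε : 0 < ε) (z w : V) :
    green (l + ε) w / green l (z + w) ≤ l ^ l1 z * (l / (l + ε)) ^ l1 w := by
  have hl0 : 0 < l := by linarith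
  have h1 := green_decay hl hε.le w
  have h2 := green_add_le hl _ (-z) (z + w) rfl
  rw [show z + w + -z = w by abel, show l1 (-z) = l1 z by simp [l1]] at h2
  rw [div_le_iff₀ (green_pos hl _)]
  calc _ ≤ (l / (l + ε)) ^ l1 w * green l w := h1
    _ ≤ (l / (l + ε)) ^ l1 w * (l ^ l1 z * green l (z + w)) :=
        mul_le_mul_of_nonneg_left h2 (by positivity)
    _ = _ := by ring

lemma invGreen_summable (hl : 4 < l) {ε : ℝ} (hε : 0 < ε) (z : V) :
    Summable fun w => green (l + ε) w / green l (z + w) := by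
  have hl0 : 0 < l := by linarith
  refine Summable.of_nonneg_of_le
    (fun w => div_nonneg (green_nonneg (by linarith) _) (green_nonneg hl _))
    (invGreen_term_le hl hε z) ?_
  exact (geom_l1_summable (by positivity) (by rw [div_lt_one (by positivity)]; linarith)).mul_left _

lemma invGreen_le (hl : 4 < l) {ε : ℝ} (hε : 0 < ε) (z : V) :
    invGreen l (l + ε) z ≤ l ^ l1 z * (2 * (l + ε) / ε) ^ 2 := by
  have hl0 : 0 < l := by linarith
  have hq0 : 0 ≤ l / (l + ε) := by positivity
  have hq1 : l / (l + ε) < 1 := by rw [div_lt_one (by positivity)]; linarith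
  have h := (invGreen_summable hl hε z).tsum_le_tsum (invGreen_term_le hl hε z)
    ((geom_l1_summable hq0 hq1).mul_left _)
  rw [tsum_mul_left] at h
  refine h.trans (mul_le_mul_of_nonneg_left ((geom_l1_tsum_le hq0 hq1).trans (le_of_eq ?_))
    (by positivity))
  congr 1
  have : 1 - l / (l + ε) = ε / (l + ε) := by field_simp; ring
  rw [this]
  field_simp

lemma invGreen_ge (hl : 4 < l) {ε : ℝ} (hε : 0 < ε) (z : V) :
    1 / green l z ≤ (l + ε) * invGreen l (l + ε) z := by
  have h0 : (0 : ℝ) < l + ε := by linarith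
  have h := (invGreen_summable hl hε z).le_tsum 0
    (fun w _ => div_nonneg (green_nonneg (by linarith) _) (green_nonneg hl _))
  rw [add_zero] at h
  have h2 := green_zero_ge (by linarith : 4 < l + ε)
  have hz := green_pos hl z
  refine le_trans ?_ (mul_le_mul_of_nonneg_left h h0.le)
  rw [← mul_div_assoc]
  apply div_le_div_of_nonneg_right _ hz.le
  rwa [div_le_iff₀ h0, mul_comm] at h2

lemma invGreen_nonneg (hl : 4 < l) {ε : ℝ} (hε : 0 < ε) (z : V) :
    0 ≤ invGreen l (l + ε) z :=
  tsum_nonneg fun w => div_nonneg (green_nonneg (by linarith) _) (green_nonneg hl _)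

lemma invGreen_shift (hl : 4 < l) {ε : ℝ} (hε : 0 < ε) (z e : V) :
    HasSum (fun w => green (l + ε) (w - e) / green l (z + w)) (invGreen l (l + ε) (z + e)) := by
  have h := (invGreen_summable hl hε (z + e)).hasSum
  rw [← (Equiv.subRight e).hasSum_iff] at h
  refine (congrArg (fun g => HasSum g _) (funext fun w => ?_)).mpr h
  simp only [Function.comp, Equiv.subRight_apply]
  rw [show z + e + (w - e) = z + w by abel]

lemma lap_invGreen (hl : 4 < l) {ε : ℝ} (hε : 0 < ε) (z : V) :
    lap (invGreen l (l + ε)) z ≤ (l + ε) * invGreen l (l + ε) z := by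
  have h := (((invGreen_shift hl hε z e1).add (invGreen_shift hl hε z (-e1))).add
    (invGreen_shift hl hε z e2)).add (invGreen_shift hl hε z (-e2))
  have h2 := (invGreen_summable hl hε z).hasSum.mul_left (l + ε)
  refine hasSum_le (fun w => ?_) h h2
  have := green_eq (by linarith : 4 < l + ε) w
  have hd : 0 ≤ del w := by unfold del; split_ifs <;> norm_num
  rw [← add_div, ← add_div, ← add_div, ← mul_div_assoc]
  apply div_le_div_of_nonneg_right _ (green_nonneg hl _)
  unfold lap at this
  rw [sub_neg_eq_add, sub_neg_eq_add]
  linarith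

lemma invGreen_step (hl : 4 < l) {ε : ℝ} (hε : 0 < ε) {e : V}
    (he : ∀ v, green l (v + e) ≤ l * green l v) (z : V) :
    invGreen l (l + ε) z ≤ l * invGreen l (l + ε) (z + e) := by
  have hl0 : 0 < l := by linarith
  refine hasSum_le (fun w => ?_) (invGreen_summable hl hε z).hasSum
    ((invGreen_summable hl hε (z + e)).hasSum.mul_left l)
  have h1 := he (z + w)
  rw [show z + w + e = z + e + w by abel] at h1
  have h2 := green_pos hl (z + w)
  have h3 := green_pos hl (z + e + w)
  have h4 := green_nonneg (by linarith : 4 < l + ε) w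
  rw [← mul_div_assoc, div_le_div_iff₀ h2 h3]
  nlinarith

/-! ### Liouville property for two-point solutions -/

/-- `f` solves the Helmholtz equation in each of its two variables. -/
def IsBisol (l : ℝ) (f : V → V → ℝ) : Prop :=
  (∀ c d, l * f c d = lap (fun c => f c d) c) ∧ ∀ c d, l * f c d = lap (f c) d

/-- Difference along a diagonal step. -/
def diagDiff (u : V) (f : V → V → ℝ) (c d : V) : ℝ := f (c + u) (d + u) - f c d

lemma lap_shift (f : V → ℝ) (u v : V) : lap (fun v => f (v + u)) v = lap f (v + u) := by
  unfold lap
  beta_reduce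
  rw [add_right_comm v u, add_right_comm v u, sub_add_eq_add_sub, sub_add_eq_add_sub]

lemma lap_sub (f g : V → ℝ) (v : V) : lap (fun v => f v - g v) v = lap f v - lap g v := by
  unfold lap; ring

lemma IsBisol.diagDiff {f : V → V → ℝ} (hf : IsBisol l f) (u : V) : IsBisol l (diagDiff u f) := by
  constructor
  · intro c d
    have h : lap (fun c => f (c + u) (d + u)) c = lap (fun c => f c (d + u)) (c + u) :=
      lap_shift (fun c => f c (d + u)) u c
    unfold EP.diagDiff
    rw [lap_sub, h, ← hf.1, ← hf.1]
    ring
  · intro c d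
    have h : lap (fun d => f (c + u) (d + u)) d = lap (f (c + u)) (d + u) :=
      lap_shift (f (c + u)) u d
    show l * (f (c + u) (d + u) - f c d) = lap (fun d => f (c + u) (d + u) - f c d) d
    rw [lap_sub, h, ← hf.2, ← hf.2]
    ring

lemma IsBisol.diagDiff_iter {f : V → V → ℝ} (hf : IsBisol l f) (u : V) (k : ℕ) :
    IsBisol l ((EP.diagDiff u)^[k] f) := by
  induction k with
  | zero => exact hf
  | succ k ih => rw [Function.iterate_succ_apply']; exact ih.diagDiff u

lemma diagDiff_eq_zero_of_sq {f : V → V → ℝ} {B : V → ℝ} (hB : ∀ c d, |f c d| ≤ B (c - d)) {u : V}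
    (h : ∀ c d, diagDiff u (diagDiff u f) c d = 0) (c d : V) : diagDiff u f c d = 0 := by
  have h1 : ∀ n : ℕ, diagDiff u f (c + n • u) (d + n • u) = diagDiff u f c d := by
    intro n
    induction n with
    | zero => simp
    | succ n ih =>
      have := h (c + n • u) (d + n • u)
      unfold diagDiff at this ih ⊢
      rw [succ_nsmul, ← add_assoc, ← add_assoc]
      linarith
  have h2 : ∀ n : ℕ, f (c + n • u) (d + n • u) = f c d + n * diagDiff u f c d := by
    intro n
    induction n with
    | zero => simp
    | succ n ih =>
      have := h1 n
      rw [diagDiff] at this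
      rw [succ_nsmul, ← add_assoc, ← add_assoc]
      push_cast
      linarith
  by_contra hne
  have hpos : 0 < |diagDiff u f c d| := abs_pos.2 hne
  obtain ⟨n, hn⟩ := exists_nat_gt (2 * B (c - d) / |diagDiff u f c d|)
  rw [div_lt_iff₀ hpos] at hn
  have h3 := hB (c + n • u) (d + n • u)
  rw [show c + n • u - (d + n • u) = c - d by abel, h2 n] at h3
  have h4 := hB c d
  have h5 : |(n : ℝ) * diagDiff u f c d| ≤ 2 * B (c - d) := by
    calc _ = |(f c d + n * diagDiff u f c d) - f c d| := by ring_nf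
      _ ≤ |f c d + n * diagDiff u f c d| + |f c d| := abs_sub _ _
      _ ≤ _ := by linarith
  rw [abs_mul, Nat.abs_cast] at h5
  linarith

lemma diagDiff_bound {f : V → V → ℝ} {B : V → ℝ} (hB : ∀ c d, |f c d| ≤ B (c - d)) (u c d : V) :
    |diagDiff u f c d| ≤ 2 * B (c - d) := by
  have h1 := hB (c + u) (d + u)
  rw [show c + u - (d + u) = c - d by abel] at h1
  have := abs_sub (f (c + u) (d + u)) (f c d)
  have h2 := hB c d
  unfold diagDiff
  linarith

lemma diagDiff_eq_zero_of_iter (u : V) (k : ℕ) : ∀ {f : V → V → ℝ} {B : V → ℝ},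
    (∀ c d, |f c d| ≤ B (c - d)) → (∀ c d, (diagDiff u)^[k + 1] f c d = 0) →
    ∀ c d, diagDiff u f c d = 0 := by
  induction k with
  | zero => intro f B _ h; exact h
  | succ k ih =>
    intro f B hB h
    apply diagDiff_eq_zero_of_sq hB
    apply ih (B := fun v => 2 * B v) (fun c d => diagDiff_bound hB u c d)
    intro c d
    rw [← Function.iterate_succ_apply]
    exact h c d

lemma liouville {u w : V}
    (huw : ∀ (f : V → ℝ) v, lap f v = f (v + u) + f (v + -u) + (f (v + w) + f (v + -w)))
    (hl : 4 ≤ l) {f : V → V → ℝ} (hf : IsBisol l f) {C : ℝ}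
    (hC : ∀ ε : ℝ, 0 < ε → ε < 1 → ∃ l', 4 < l' ∧ l' ≤ l + 2 * ε ∧
      ∀ c d, |f c d| * (ε * green l' (c - d)) ≤ C) (c d : V) :
    f (c + u) (d + u) = f c d := by
  have hC0 : 0 ≤ C := by
    obtain ⟨l', h4, -, h⟩ := hC (1 / 2) (by norm_num) (by norm_num)
    exact (mul_nonneg (abs_nonneg _) (mul_nonneg (by norm_num) (green_nonneg h4 _))).trans (h 0 0)
  have hb : ∃ B : V → ℝ, ∀ c d, |f c d| ≤ B (c - d) := by
    obtain ⟨l', h4, -, h⟩ := hC (1 / 2) (by norm_num) (by norm_num)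
    refine ⟨fun v => C / (1 / 2 * green l' v), fun c d => ?_⟩
    rw [le_div_iff₀ (by have := green_pos h4 (c - d); positivity)]
    exact h c d
  obtain ⟨B, hB⟩ := hb
  suffices h8 : ∀ c d, (diagDiff u)^[7 + 1] f c d = 0 by
    have := diagDiff_eq_zero_of_iter u 7 hB h8 c d
    unfold diagDiff at this
    linarith
  clear c d
  intro c d
  set A : ℝ := C * (l + 3) * ((6 * (l + 3)) ^ 8 * ((l + 2) ^ l1 (c - d) * (2 * (l + 3)) ^ 2))
    with hA
  have key : ∀ ε : ℝ, 0 < ε → ε < 1 → |(diagDiff u)^[7 + 1] f c d| ≤ A * ε := by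
    intro ε hε0 hε1
    obtain ⟨l', h4, hl', hb⟩ := hC ε hε0 hε1
    have hl'0 : 0 < l' := by linarith
    have hl0 : 0 < l := by linarith
    set M := l' + ε with hM
    set t := 6 * (l + 3) * Real.sqrt ε with ht
    have ht0 : 0 ≤ t := by positivity
    have hst : ∀ v, green l' (v + u) ≤ l' * green l' v ∧ green l' (v + -u) ≤ l' * green l' v := by
      intro v
      have h := green_eq h4 v
      rw [huw] at h
      have hd : 0 ≤ del v := by unfold del; split_ifs <;> norm_num
      have h1 := green_nonneg h4 (v + u)
      have h2 := green_nonneg h4 (v + -u)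
      have h3 := green_nonneg h4 (v + w)
      have h5 := green_nonneg h4 (v + -w)
      constructor <;> linarith
    have hfac : ∃ n : ℕ, 2 * (M / l) ^ n * Real.sqrt (M / ((n + 1) * (2 / l'))) ≤ t := by
      refine ⟨⌊1 / ε⌋₊, ?_⟩
      set n := ⌊1 / ε⌋₊
      have hn1 : (n : ℝ) ≤ 1 / ε := Nat.floor_le (by positivity)
      have hn2 : 1 / ε < n + 1 := Nat.lt_floor_add_one _
      have h1 : (M / l) ^ n ≤ 3 := by
        have a1 : M / l ≤ Real.exp ε := by
          refine le_trans ?_ (Real.add_one_le_exp ε)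
          rw [div_le_iff₀ hl0]
          nlinarith
        calc (M / l) ^ n ≤ Real.exp ε ^ n := by
              apply pow_le_pow_left₀ (by positivity) a1
          _ = Real.exp (n * ε) := (Real.exp_nat_mul ε n).symm
          _ ≤ Real.exp 1 := by
              apply Real.exp_le_exp.2
              rwa [le_div_iff₀ hε0] at hn1
          _ ≤ 3 := by linarith [Real.exp_one_lt_d9]
      have h2 : Real.sqrt (M / ((n + 1) * (2 / l'))) ≤ (l + 3) * Real.sqrt ε := by
        rw [← Real.sqrt_sq (by linarith : 0 ≤ l + 3), ← Real.sqrt_mul (by positivity)]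
        apply Real.sqrt_le_sqrt
        rw [div_le_iff₀ (by positivity)]
        have a1 : 1 ≤ ε * (n + 1) := by
          rw [div_lt_iff₀ hε0] at hn2
          linarith
        have a2 : M ≤ l + 3 := by linarith
        have a3 : 1 ≤ (l + 3) * (2 / l') := by
          rw [← mul_div_assoc, le_div_iff₀ hl'0]; linarith
        have a4 : 1 ≤ (ε * (n + 1)) * ((l + 3) * (2 / l')) := one_le_mul_of_one_le_of_one_le a1 a3
        calc M ≤ (l + 3) * 1 := by linarith
          _ ≤ (l + 3) * ((ε * (n + 1)) * ((l + 3) * (2 / l'))) :=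
              mul_le_mul_of_nonneg_left a4 (by linarith)
          _ = _ := by ring
      calc 2 * (M / l) ^ n * Real.sqrt (M / ((n + 1) * (2 / l')))
          ≤ 2 * 3 * ((l + 3) * Real.sqrt ε) := by
            apply mul_le_mul _ h2 (Real.sqrt_nonneg _) (by norm_num)
            linarith
        _ = t := by rw [ht]; ring
    obtain ⟨n, hn⟩ := hfac
    set Ψ := invGreen l' M with hΨ
    have hΨ0 : ∀ z, 0 ≤ Ψ z := invGreen_nonneg h4 hε0
    have hiter : ∀ k : ℕ, ∀ c d, |(diagDiff u)^[k] f c d| ≤ C / ε * M * t ^ k * Ψ (c - d) := by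
      intro k
      induction k with
      | zero =>
        intro c d
        have g0 := green_pos h4 (c - d)
        have h1 := hb c d
        have h2 := invGreen_ge h4 hε0 (c - d)
        simp only [Function.iterate_zero, id, pow_zero, mul_one]
        calc |f c d| ≤ C / ε * (1 / green l' (c - d)) := by
              rw [div_mul_div_comm, mul_one, le_div_iff₀ (by positivity)]
              exact h1
          _ ≤ C / ε * (M * Ψ (c - d)) := mul_le_mul_of_nonneg_left h2 (by positivity)
          _ = _ := by ring
      | succ k ih =>
        intro c d
        rw [Function.iterate_succ_apply']
        have hs := hf.diagDiff_iter u k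
        have := shift_bound huw hl0 (by positivity : 0 ≤ M) (by positivity : 0 < 2 / l') hΨ0
          (lap_invGreen h4 hε0) (fun z => by
            have s1 := invGreen_step h4 hε0 (fun v => (hst v).1) z
            have s2 := invGreen_step h4 hε0 (fun v => (hst v).2) z
            rw [div_mul_eq_mul_div, div_le_iff₀ hl'0]
            show 2 * invGreen l' (l' + ε) z ≤ (invGreen l' (l' + ε) (z + u) +
              invGreen l' (l' + ε) (z + -u)) * l'
            linarith) hs.1 hs.2 (by positivity : 0 ≤ C / ε * M * t ^ k) ih n c d
        refine this.trans ?_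
        apply mul_le_mul_of_nonneg_right _ (hΨ0 _)
        calc _ = (C / ε * M * t ^ k) * (2 * (M / l) ^ n * Real.sqrt (M / ((n + 1) * (2 / l')))) := by
              ring
          _ ≤ (C / ε * M * t ^ k) * t := mul_le_mul_of_nonneg_left hn (by positivity)
          _ = _ := by ring
    refine (hiter (7 + 1) c d).trans ?_
    have hΨle := invGreen_le h4 hε0 (c - d)
    have h1 : Ψ (c - d) ≤ (l + 2) ^ l1 (c - d) * ((2 * (l + 3)) ^ 2 / ε ^ 2) := by
      refine hΨle.trans ?_
      rw [div_pow]
      apply mul_le_mul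
      · exact pow_le_pow_left₀ hl'0.le (by linarith) _
      · apply div_le_div_of_nonneg_right _ (by positivity)
        apply pow_le_pow_left₀ (by positivity)
        linarith
      · positivity
      · positivity
    have h2 : t ^ (7 + 1) = (6 * (l + 3)) ^ 8 * ε ^ 4 := by
      rw [ht, mul_pow, show Real.sqrt ε ^ (7 + 1) = (Real.sqrt ε ^ 2) ^ 4 by ring,
        Real.sq_sqrt hε0.le]
    calc _ ≤ C / ε * (l + 3) * ((6 * (l + 3)) ^ 8 * ε ^ 4) *
          ((l + 2) ^ l1 (c - d) * ((2 * (l + 3)) ^ 2 / ε ^ 2)) := by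
          rw [h2]
          apply mul_le_mul _ h1 (hΨ0 _) (by positivity)
          apply mul_le_mul_of_nonneg_right _ (by positivity)
          apply mul_le_mul_of_nonneg_left _ (by positivity)
          linarith
      _ = A * ε := by
          rw [hA]
          field_simp
  by_contra hne
  have hpos : 0 < |(diagDiff u)^[7 + 1] f c d| := abs_pos.2 hne
  have hA0 : 0 ≤ A := by
    have : 0 ≤ l := by linarith
    positivity
  set y := |(diagDiff u)^[7 + 1] f c d|
  have h := key (min (1 / 2) (y / (2 * (A + 1)))) (by positivity)
    (lt_of_le_of_lt (min_le_left _ _) (by norm_num))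
  have h2 : A * min (1 / 2) (y / (2 * (A + 1))) ≤ A * (y / (2 * (A + 1))) :=
    mul_le_mul_of_nonneg_left (min_le_right _ _) hA0
  have h3 : A * (y / (2 * (A + 1))) < y := by
    rw [← mul_div_assoc, div_lt_iff₀ (by positivity)]
    nlinarith
  linarith

lemma lap_e1 (f : V → ℝ) (v : V) :
    lap f v = f (v + e1) + f (v + -e1) + (f (v + e2) + f (v + -e2)) := by
  unfold lap; rw [sub_eq_add_neg, sub_eq_add_neg]; ring

lemma lap_e2 (f : V → ℝ) (v : V) :
    lap f v = f (v + e2) + f (v + -e2) + (f (v + e1) + f (v + -e1)) := by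
  unfold lap; rw [sub_eq_add_neg, sub_eq_add_neg]; ring

/-! ### Two-point functions with disorder lines -/

/-- Oriented coordinates for the edges: `(v, true)` is the vertical edge above `v` and `(v, false)`
the horizontal edge to the right of `v`. -/
abbrev Ed := V × Bool

/-- The first endpoint of an edge. -/
def tl (e : Ed) : V := e.1

/-- The second endpoint of an edge. -/
def hd (e : Ed) : V := e.1 + if e.2 then e2 else e1

/-- The coboundary of a vertex set modulo two. -/
def cob (U : V → ZMod 2) (e : Ed) : ZMod 2 := U (tl e) + U (hd e)

/-- Order-disorder two-point functions: `Φ v w δ` stands for the correlation of the spins at `v`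
and `w` in the presence of the disorder line `δ`. -/
structure IsState (a b : ℝ) (Φ : V → V → (Ed → ZMod 2) → ℝ) : Prop where
  symm : ∀ v w δ, Φ v w δ = Φ w v δ
  diag : ∀ v w δ, Φ v v δ = Φ w w δ
  one : ∀ v, Φ v v 0 = 1
  step : ∀ e w δ, Φ (hd e) w δ =
    sg (δ e) * (a * Φ (tl e) w δ - b * Φ (tl e) w (δ + Pi.single e 1))
  step' : ∀ e w δ, Φ (tl e) w δ =
    sg (δ e) * (a * Φ (hd e) w δ - b * Φ (hd e) w (δ + Pi.single e 1))
  gauge : ∀ v w δ U, (Function.support U).Finite → Φ v w (δ + cob U) = sg (U v + U w) * Φ v w δ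
  bound : ∀ v w δ, |Φ v w δ| ≤ Φ v w 0

/-- Transport of two-point functions along a graph automorphism. -/
def pull (σ : V ≃ V) (τ : Ed ≃ Ed) (Φ : V → V → (Ed → ZMod 2) → ℝ) (v w : V) (δ : Ed → ZMod 2) : ℝ :=
  Φ (σ v) (σ w) (δ ∘ τ.symm)

/-- `τ` is the action of the graph automorphism `σ` on edges. -/
def Compat (σ : V ≃ V) (τ : Ed ≃ Ed) : Prop :=
  ∀ e, (tl (τ e) = σ (tl e) ∧ hd (τ e) = σ (hd e)) ∨ (tl (τ e) = σ (hd e) ∧ hd (τ e) = σ (tl e))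

variable {a b : ℝ} {Φ : V → V → (Ed → ZMod 2) → ℝ}

lemma single_comp_symm (τ : Ed ≃ Ed) (e : Ed) (δ : Ed → ZMod 2) :
    (δ + Pi.single e 1) ∘ τ.symm = δ ∘ τ.symm + Pi.single (τ e) 1 := by
  funext e'
  simp [Pi.single_apply, Equiv.symm_apply_eq]

lemma cob_comp_symm {σ : V ≃ V} {τ : Ed ≃ Ed} (h : Compat σ τ) (U : V → ZMod 2) (δ : Ed → ZMod 2) :
    (δ + cob U) ∘ τ.symm = δ ∘ τ.symm + cob (U ∘ σ.symm) := by
  funext e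
  obtain ⟨e, rfl⟩ := τ.surjective e
  simp only [Function.comp, Pi.add_apply, Equiv.symm_apply_apply, cob]
  rcases h e with h | h
  · rw [h.1, h.2]; simp
  · rw [h.1, h.2]; simp [add_comm]

lemma IsState.pull (hΦ : IsState a b Φ) {σ : V ≃ V} {τ : Ed ≃ Ed} (h : Compat σ τ) :
    IsState a b (EP.pull σ τ Φ) where
  symm v w δ := hΦ.symm _ _ _
  diag v w δ := hΦ.diag _ _ _
  one v := hΦ.one _
  step e w δ := by
    unfold EP.pull
    rw [single_comp_symm]
    have e0 : δ e = (δ ∘ τ.symm) (τ e) := by simp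
    rw [e0]
    rcases h e with h | h
    · rw [← h.1, ← h.2]; exact hΦ.step _ _ _
    · rw [← h.1, ← h.2]; exact hΦ.step' _ _ _
  step' e w δ := by
    unfold EP.pull
    rw [single_comp_symm]
    have e0 : δ e = (δ ∘ τ.symm) (τ e) := by simp
    rw [e0]
    rcases h e with h | h
    · rw [← h.1, ← h.2]; exact hΦ.step' _ _ _
    · rw [← h.1, ← h.2]; exact hΦ.step _ _ _
  gauge v w δ U hU := by
    unfold EP.pull
    rw [cob_comp_symm h, hΦ.gauge]
    · simp
    · rw [Function.support_comp_eq_preimage]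
      exact hU.preimage (σ.symm.injective.injOn)
  bound v w δ := hΦ.bound _ _ _

/-- Translation of vertices. -/
def trV (d : V) : V ≃ V := Equiv.addRight d

/-- Translation of edges. -/
def trE (d : V) : Ed ≃ Ed := (Equiv.addRight d).prodCongr (Equiv.refl _)

lemma compat_tr (d : V) : Compat (trV d) (trE d) := fun e => Or.inl
  ⟨rfl, by simp only [hd, trE, trV, Equiv.prodCongr_apply, Prod.map]; exact add_right_comm _ _ _⟩

/-- Reflection of vertices in the vertical axis. -/
def reV : V ≃ V where
  toFun v := (-v.1, v.2)
  invFun v := (-v.1, v.2)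
  left_inv v := by simp
  right_inv v := by simp

/-- Reflection of edges in the vertical axis. -/
def reE : Ed ≃ Ed where
  toFun e := if e.2 then ((-e.1.1, e.1.2), true) else ((-e.1.1 - 1, e.1.2), false)
  invFun e := if e.2 then ((-e.1.1, e.1.2), true) else ((-e.1.1 - 1, e.1.2), false)
  left_inv e := by obtain ⟨⟨i, j⟩, _ | _⟩ := e <;> simp
  right_inv e := by obtain ⟨⟨i, j⟩, _ | _⟩ := e <;> simp

lemma compat_re : Compat reV reE := by
  rintro ⟨⟨i, j⟩, _ | _⟩
  · right; simp [tl, hd, reE, reV, e1]; ring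
  · left; simp [tl, hd, reE, reV, e2]

/-- Exchange of the two coordinates on vertices. -/
def swV : V ≃ V := Equiv.prodComm _ _

/-- Exchange of the two coordinates on edges. -/
def swE : Ed ≃ Ed where
  toFun e := (e.1.swap, !e.2)
  invFun e := (e.1.swap, !e.2)
  left_inv e := by simp
  right_inv e := by simp

lemma compat_sw : Compat swV swE := by
  rintro ⟨⟨i, j⟩, _ | _⟩ <;> left <;> simp [tl, hd, swE, swV, e1, e2]

/-! ### Disorder lines from the origin -/

/-- Indicator of an integer interval oriented from `0` to `n`. -/
def ivl (n x : ℤ) : Prop := 1 ≤ x ∧ x ≤ n ∨ n + 1 ≤ x ∧ x ≤ 0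

instance (n x : ℤ) : Decidable (ivl n x) := by unfold ivl; infer_instance

/-- The dual path from the face of the origin to the face `g`, first horizontal, then vertical. -/
def dpath (g : V) (e : Ed) : ZMod 2 :=
  if e.2 then (if e.1.2 = 0 ∧ ivl g.1 e.1.1 then 1 else 0)
  else (if e.1.1 = g.1 ∧ ivl g.2 e.1.2 then 1 else 0)

/-- The column of vertices between the axis and `(i, j)`. -/
def column (i j : ℤ) (v : V) : ZMod 2 := if v.1 = i ∧ ivl j v.2 then 1 else 0

lemma column_finite (i j : ℤ) : (Function.support (column i j)).Finite := by
  apply Set.Finite.subset ((Set.finite_Icc (-|i| - |j|) (|i| + |j|)).prod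
    (Set.finite_Icc (-|i| - |j|) (|i| + |j|)))
  rintro ⟨x, y⟩ h
  have h' : x = i ∧ ivl j y := by
    by_contra hc
    exact h (by simp only [column]; rw [if_neg hc])
  obtain ⟨rfl, h₂⟩ := h'
  unfold ivl at h₂
  simp only [Set.mem_prod, Set.mem_Icc]
  have := abs_nonneg j
  rcases abs_cases x with hx | hx <;> rcases abs_cases j with hj | hj <;>
    refine ⟨⟨?_, ?_⟩, ?_, ?_⟩ <;> omega

lemma ite_add_ite_zmod2 {P Q R : Prop} [Decidable P] [Decidable Q] [Decidable R]
    (h : R ↔ ¬ (P ↔ Q)) :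
    (if R then (1 : ZMod 2) else 0) = (if P then 1 else 0) + (if Q then 1 else 0) := by
  by_cases hP : P <;> by_cases hQ : Q <;> simp [hP, hQ, h] <;> decide

lemma dpath_zero : dpath 0 = 0 := by
  funext e
  obtain ⟨⟨x, y⟩, _ | _⟩ := e <;> simp only [dpath, ivl] <;> simp <;> intros <;> omega

lemma dpath_down (i j : ℤ) : dpath (i, j - 1) = dpath (i, j) + Pi.single ((i, j), false) 1 := by
  funext e
  obtain ⟨⟨x, y⟩, _ | _⟩ := e
  · simp only [dpath, Pi.add_apply, Pi.single_apply, Prod.mk.injEq, Bool.false_eq_true, if_false,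
      and_true]
    apply ite_add_ite_zmod2
    unfold ivl
    omega
  · simp [dpath, Pi.single_apply]

lemma dpath_left (i j : ℤ) : dpath (i, j) + Pi.single ((i, j), true) 1 =
    dpath (i - 1, j) + cob (column i j) := by
  funext e
  obtain ⟨⟨x, y⟩, _ | _⟩ := e
  · have e : cob (column i j) ((x, y), false) = column i j (x, y) + column i j (x + 1, y) := by
      simp [cob, tl, hd, e1]
    simp only [Pi.add_apply, e, column, dpath, Pi.single_apply, Prod.mk.injEq, Bool.false_eq_true,
      if_false, and_false, add_zero]
    rw [← ite_add_ite_zmod2 (R := ¬ ((x = i ∧ ivl j y) ↔ (x + 1 = i ∧ ivl j y))) Iff.rfl]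
    apply ite_add_ite_zmod2
    unfold ivl
    omega
  · have e : cob (column i j) ((x, y), true) = column i j (x, y) + column i j (x, y + 1) := by
      simp [cob, tl, hd, e2]
    simp only [Pi.add_apply, e, column, dpath, Pi.single_apply, Prod.mk.injEq, if_true, and_true]
    rw [← ite_add_ite_zmod2 (R := ¬ ((x = i ∧ ivl j y) ↔ (x = i ∧ ivl j (y + 1)))) Iff.rfl,
      ← ite_add_ite_zmod2 (R := ¬ ((y = 0 ∧ ivl i x) ↔ (x = i ∧ y = j))) Iff.rfl]
    apply ite_add_ite_zmod2
    unfold ivl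
    omega

/-! ### The Dirac equation -/

/-- Sign of the corner to the upper right of `v`. -/
def kNE (i j : ℤ) : ℝ := if 1 ≤ j then 1 else if j = 0 then (if i ≤ 0 then 1 else -1)
  else (if i ≤ -1 then 1 else -1)

/-- Sign of the corner to the upper left of `v`. -/
def kNW (i j : ℤ) : ℝ := if 1 ≤ j then -1 else if i ≤ 0 then 1 else -1

/-- Sign of the corner to the lower right of `v`. -/
def kSE (i j : ℤ) : ℝ := if 1 ≤ j then 1 else if i ≤ -1 then 1 else -1

/-- Sign of the corner to the lower left of `v`. -/
def kSW (i j : ℤ) : ℝ := if 1 ≤ j then -1 else if i ≤ 0 then 1 else -1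

/-- Corner correlation seen from the upper right. -/
def cNE (Φ : V → V → (Ed → ZMod 2) → ℝ) (i j : ℤ) : ℝ := kNE i j * Φ (i, j) 0 (dpath (i, j))

/-- Corner correlation seen from the upper left. -/
def cNW (Φ : V → V → (Ed → ZMod 2) → ℝ) (i j : ℤ) : ℝ := kNW i j * Φ (i, j) 0 (dpath (i - 1, j))

/-- Corner correlation seen from the lower right. -/
def cSE (Φ : V → V → (Ed → ZMod 2) → ℝ) (i j : ℤ) : ℝ := kSE i j * Φ (i, j) 0 (dpath (i, j - 1))

/-- Corner correlation seen from the lower left. -/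
def cSW (Φ : V → V → (Ed → ZMod 2) → ℝ) (i j : ℤ) : ℝ :=
  kSW i j * Φ (i, j) 0 (dpath (i - 1, j - 1))

lemma sg_ite (P : Prop) [Decidable P] : sg (if P then 1 else 0) = if P then -1 else 1 := by
  split_ifs <;> simp [sg]

lemma IsState.step_right (hΦ : IsState a b Φ) (i j : ℤ) (g : Ed → ZMod 2) :
    Φ (i + 1, j) 0 g = sg (g ((i, j), false)) *
      (a * Φ (i, j) 0 g - b * Φ (i, j) 0 (g + Pi.single ((i, j), false) 1)) := by
  have := hΦ.step ((i, j), false) 0 g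
  simpa [hd, tl, e1] using this

lemma IsState.step_up (hΦ : IsState a b Φ) (i j : ℤ) (g : Ed → ZMod 2) :
    Φ (i, j + 1) 0 g = sg (g ((i, j), true)) *
      (a * Φ (i, j) 0 g - b * Φ (i, j) 0 (g + Pi.single ((i, j), true) 1)) := by
  have := hΦ.step ((i, j), true) 0 g
  simpa [hd, tl, e2] using this

lemma pi_single_add_self (e : Ed) (g : Ed → ZMod 2) : g + Pi.single e 1 + Pi.single e 1 = g := by
  rw [add_assoc, add_self, add_zero]

lemma IsState.dirac_right_up (hΦ : IsState a b Φ) (i j : ℤ) :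
    cNW Φ (i + 1) j = a * cNE Φ i j - b * cSE Φ i j - (if i = 0 ∧ j = 0 then 2 * a else 0) := by
  have h := hΦ.step_right i j (dpath (i, j))
  rw [← dpath_down] at h
  have hd : dpath (i, j) ((i, j), false) = if 1 ≤ j then 1 else 0 := by
    simp only [dpath, ivl, Bool.false_eq_true, if_false]
    congr 1
    simp
  rw [hd, sg_ite] at h
  have h0 : i = 0 → j = 0 → Φ (i, j) 0 (dpath (i, j)) = 1 := by
    rintro rfl rfl
    rw [show ((0 : ℤ), (0 : ℤ)) = (0 : V) from rfl, dpath_zero, hΦ.one]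
  unfold cNW cNE cSE kNW kNE kSE
  rw [show i + 1 - 1 = i by ring, h]
  split_ifs with c1 c2 c3 c4 c5 c6 c7 c8 <;> first | omega | (ring_nf; done) | skip
  all_goals first | (rw [h0 (by omega) (by omega)]; ring) | omega

lemma IsState.dirac_right_down (hΦ : IsState a b Φ) (i j : ℤ) :
    cSW Φ (i + 1) j = b * cNE Φ i j - a * cSE Φ i j - (if i = 0 ∧ j = 0 then 2 * b else 0) := by
  have h := hΦ.step_right i j (dpath (i, j - 1))
  rw [show dpath (i, j - 1) + Pi.single ((i, j), false) 1 = dpath (i, j) by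
    rw [dpath_down, pi_single_add_self]] at h
  have hd : dpath (i, j - 1) ((i, j), false) = if j ≤ 0 then 1 else 0 := by
    simp only [dpath, ivl, Bool.false_eq_true, if_false]
    congr 1
    simp
  rw [hd, sg_ite] at h
  have h0 : i = 0 → j = 0 → Φ (i, j) 0 (dpath (i, j)) = 1 := by
    rintro rfl rfl
    rw [show ((0 : ℤ), (0 : ℤ)) = (0 : V) from rfl, dpath_zero, hΦ.one]
  unfold cSW cNE cSE kSW kNE kSE
  rw [show i + 1 - 1 = i by ring, h]
  split_ifs with c1 c2 c3 c4 c5 c6 c7 c8 <;> first | omega | (ring_nf; done) | skip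
  all_goals first | (rw [h0 (by omega) (by omega)]; ring) | omega

lemma column_sign (i j : ℤ) : sg (column i j (i, j) + column i j 0) =
    if j = 0 then 1 else if 1 ≤ j then -1 else if i = 0 then -1 else 1 := by
  unfold column ivl
  rw [sg_add, sg_ite, sg_ite]
  simp only [Prod.fst_zero, Prod.snd_zero, true_and]
  split_ifs <;> first | omega | norm_num

lemma IsState.dirac_up_right (hΦ : IsState a b Φ) (i j : ℤ) :
    cSE Φ i (j + 1) = a * cNE Φ i j - b * cNW Φ i j := by
  have h := hΦ.step_up i j (dpath (i, j))
  rw [dpath_left, hΦ.gauge _ _ _ _ (column_finite i j), column_sign] at h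
  have hd : dpath (i, j) ((i, j), true) = if j = 0 ∧ 1 ≤ i then 1 else 0 := by
    simp only [dpath, ivl, if_true]
    congr 1
    simp
  rw [hd, sg_ite] at h
  unfold cSE cNE cNW kSE kNE kNW
  rw [show j + 1 - 1 = j by ring, h]
  split_ifs with c1 c2 c3 c4 c5 c6 c7 c8 <;> first | omega | (ring_nf; done)

lemma IsState.dirac_up_left (hΦ : IsState a b Φ) (i j : ℤ) :
    cSW Φ i (j + 1) = a * cNW Φ i j - b * cNE Φ i j := by
  have h := hΦ.step_up i j (dpath (i - 1, j))
  have e : dpath (i - 1, j) + Pi.single ((i, j), true) 1 = dpath (i, j) + cob (column i j) := by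
    have := dpath_left i j
    calc _ = (dpath (i - 1, j) + cob (column i j)) + cob (column i j) + Pi.single ((i, j), true) 1 := by
          rw [add_assoc (dpath (i - 1, j)), add_self, add_zero]
      _ = _ := by rw [← this, add_right_comm _ _ (Pi.single _ _), pi_single_add_self]
  rw [e, hΦ.gauge _ _ _ _ (column_finite i j), column_sign] at h
  have hd : dpath (i - 1, j) ((i, j), true) = if j = 0 ∧ i ≤ 0 then 1 else 0 := by
    simp only [dpath, ivl, if_true]
    congr 1
    simp
  rw [hd, sg_ite] at h
  unfold cSW cNE cNW kSW kNE kNW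
  rw [show j + 1 - 1 = j by ring, h]
  split_ifs with c1 c2 c3 c4 c5 c6 c7 c8 <;> first | omega | (ring_nf; done)

/-- The strength of the source at the origin. -/
def src (i j : ℤ) : ℝ := if i = 0 ∧ j = 0 then 1 else 0

lemma IsState.helmholtz (hΦ : IsState a b Φ) (hb : 0 < b) (hab : a ^ 2 - b ^ 2 = 1) (i j : ℤ) :
    2 * a ^ 2 / b * cNW Φ (i + 1) (j + 1) =
      cNW Φ (i + 1 + 1) (j + 1) + cNW Φ i (j + 1) + cNW Φ (i + 1) (j + 1 + 1) + cNW Φ (i + 1) j +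
      (2 * a * src (i + 1) (j + 1) - 2 * a / b * src i (j + 1)) := by
  have r (i j) : cNW Φ (i + 1) j = a * cNE Φ i j - b * cSE Φ i j - 2 * a * src i j := by
    rw [hΦ.dirac_right_up]; unfold src; split_ifs <;> ring
  have q (i j) : cSW Φ (i + 1) j = b * cNE Φ i j - a * cSE Φ i j - 2 * b * src i j := by
    rw [hΦ.dirac_right_down]; unfold src; split_ifs <;> ring
  have u := hΦ.dirac_up_right
  have w := hΦ.dirac_up_left
  have hNE (i j) : cNE Φ i j = a * cNW Φ (i + 1) j - b * cSW Φ (i + 1) j + 2 * src i j := by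
    rw [r, q]; linear_combination (-(cNE Φ i j) + 2 * src i j) * hab
  have hSE (i j) : cSE Φ i j = b * cNW Φ (i + 1) j - a * cSW Φ (i + 1) j := by
    rw [r, q]; linear_combination (-(cSE Φ i j)) * hab
  have s1 (i j) : cSW Φ i (j + 1) = a * cNW Φ i j - a * b * cNW Φ (i + 1) j +
      b ^ 2 * cSW Φ (i + 1) j - 2 * b * src i j := by
    rw [w, hNE]; ring
  have s2 (i j) : b * cNW Φ (i + 1) (j + 1) - a * cSW Φ (i + 1) (j + 1) - a ^ 2 * cNW Φ (i + 1) j +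
      a * b * cSW Φ (i + 1) j + b * cNW Φ i j = 2 * a * src i j := by
    have := u i j
    rw [hSE, hNE] at this
    linear_combination this
  have t1 := s2 i (j + 1)
  have t2 := s2 (i + 1) j
  have t3 := s1 (i + 1) (j + 1)
  have t4 := s1 (i + 1) j
  have e : b * (2 * a ^ 2 / b * cNW Φ (i + 1) (j + 1)) = 2 * a ^ 2 * cNW Φ (i + 1) (j + 1) := by
    field_simp
  apply mul_left_cancel₀ hb.ne'
  rw [e]
  have e2 : b * (2 * a / b * src i (j + 1)) = 2 * a * src i (j + 1) := by field_simp
  linear_combination -(t1 - b ^ 2 * t2 + a * t3 - a * b * t4) + e2 +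
    b * (cNW Φ (i + 1) j + cNW Φ (i + 1 + 1) (j + 1)) * hab

/-- The corner correlation between `c` and `d`. -/
def corner (Φ : V → V → (Ed → ZMod 2) → ℝ) (c d : V) : ℝ :=
  cNW (pull (trV d) (trE d) Φ) (c.1 - d.1) (c.2 - d.2)

lemma corner_eq (Φ : V → V → (Ed → ZMod 2) → ℝ) (c d : V) : corner Φ c d =
    kNW (c.1 - d.1) (c.2 - d.2) * Φ c d (dpath (c.1 - d.1 - 1, c.2 - d.2) ∘ (trE d).symm) := by
  unfold corner cNW pull
  congr 2
  · show ((c.1 - d.1, c.2 - d.2) : V) + d = c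
    ext <;> simp
  · show (0 : V) + d = d
    simp

/-- The source of the corner correlation. -/
def source (a b : ℝ) (v : V) : ℝ := 2 * a * del v - 2 * a / b * del (v - e1)

lemma src_eq (i j : ℤ) : src i j = del (i, j) := by
  simp [src, del, Prod.ext_iff]

lemma IsState.corner_lap (hΦ : IsState a b Φ) (hb : 0 < b) (hab : a ^ 2 - b ^ 2 = 1) (c d : V) :
    2 * a ^ 2 / b * corner Φ c d = lap (fun c => corner Φ c d) c + source a b (c - d) := by
  have h := (hΦ.pull (compat_tr d)).helmholtz hb hab (c.1 - d.1 - 1) (c.2 - d.2 - 1)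
  rw [src_eq, src_eq] at h
  simp only [sub_add_cancel] at h
  unfold corner lap source
  simp only [Prod.fst_add, Prod.snd_add, Prod.fst_sub, Prod.snd_sub, e1, e2, add_zero, sub_zero]
  rw [show c.1 + 1 - d.1 = c.1 - d.1 + 1 by ring, show c.1 - 1 - d.1 = c.1 - d.1 - 1 by ring,
    show c.2 + 1 - d.2 = c.2 - d.2 + 1 by ring, show c.2 - 1 - d.2 = c.2 - d.2 - 1 by ring, h]
  have e : c - d - ((1, 0) : V) = (c.1 - d.1 - 1, c.2 - d.2) := by ext <;> simp
  rw [e, show c - d = (c.1 - d.1, c.2 - d.2) from rfl]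

/-- The rectangle between the two dual paths joining the corners of `c` and `d`. -/
def rect (c d v : V) : ZMod 2 :=
  if (d.1 + 1 ≤ v.1 ∧ v.1 ≤ c.1 - 1 ∨ c.1 ≤ v.1 ∧ v.1 ≤ d.1) ∧ ivl (c.2 - d.2) (v.2 - d.2) then 1 else 0

lemma rect_finite (c d : V) : (Function.support (rect c d)).Finite := by
  obtain ⟨c1, c2⟩ := c
  obtain ⟨d1, d2⟩ := d
  apply Set.Finite.subset ((Set.finite_Icc (-|c1| - |d1|) (|c1| + |d1|)).prod
    (Set.finite_Icc (-|c2| - |d2|) (|c2| + |d2|)))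
  rintro ⟨x, y⟩ h
  have h' : (d1 + 1 ≤ x ∧ x ≤ c1 - 1 ∨ c1 ≤ x ∧ x ≤ d1) ∧ ivl (c2 - d2) (y - d2) := by
    by_contra hc
    exact h (by simp only [rect]; rw [if_neg hc])
  obtain ⟨h₁, h₂⟩ := h'
  unfold ivl at h₂
  simp only [Set.mem_prod, Set.mem_Icc]
  refine ⟨⟨?_, ?_⟩, ?_, ?_⟩ <;>
    [rcases abs_cases c1 with hx | hx <;> rcases abs_cases d1 with hj | hj;
     rcases abs_cases c1 with hx | hx <;> rcases abs_cases d1 with hj | hj;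
     rcases abs_cases c2 with hx | hx <;> rcases abs_cases d2 with hj | hj;
     rcases abs_cases c2 with hx | hx <;> rcases abs_cases d2 with hj | hj] <;> omega

lemma dpath_rect (c d : V) :
    (dpath ((reV d).1 - (reV c).1 - 1, (reV d).2 - (reV c).2) ∘ (trE (reV c)).symm) ∘ reE.symm =
      dpath (c.1 - d.1 - 1, c.2 - d.2) ∘ (trE d).symm + cob (rect c d) := by
  obtain ⟨c1, c2⟩ := c
  obtain ⟨d1, d2⟩ := d
  funext e
  obtain ⟨⟨x, y⟩, _ | _⟩ := e
  · have e : cob (rect (c1, c2) (d1, d2)) ((x, y), false) =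
        rect (c1, c2) (d1, d2) (x, y) + rect (c1, c2) (d1, d2) (x + 1, y) := by
      simp [cob, tl, hd, e1]
    simp only [Pi.add_apply, e, rect, dpath, Function.comp, reV, reE, trE, Equiv.coe_fn_mk,
      Equiv.coe_fn_symm_mk, Bool.false_eq_true, if_false, Equiv.prodCongr_symm,
      Equiv.prodCongr_apply, Prod.map, Equiv.addRight_symm, Equiv.coe_addRight, Equiv.refl_symm,
      Equiv.refl_apply, Prod.fst_add, Prod.snd_add, Prod.fst_neg, Prod.snd_neg]
    rw [← ite_add_ite_zmod2 (R := ¬ (((d1 + 1 ≤ x ∧ x ≤ c1 - 1 ∨ c1 ≤ x ∧ x ≤ d1) ∧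
      ivl (c2 - d2) (y - d2)) ↔ ((d1 + 1 ≤ x + 1 ∧ x + 1 ≤ c1 - 1 ∨ c1 ≤ x + 1 ∧ x + 1 ≤ d1) ∧
      ivl (c2 - d2) (y - d2)))) Iff.rfl]
    apply ite_add_ite_zmod2
    unfold ivl
    omega
  · have e : cob (rect (c1, c2) (d1, d2)) ((x, y), true) =
        rect (c1, c2) (d1, d2) (x, y) + rect (c1, c2) (d1, d2) (x, y + 1) := by
      simp [cob, tl, hd, e2]
    simp only [Pi.add_apply, e, rect, dpath, Function.comp, reV, reE, trE, Equiv.coe_fn_mk,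
      Equiv.coe_fn_symm_mk, if_true, Equiv.prodCongr_symm,
      Equiv.prodCongr_apply, Prod.map, Equiv.addRight_symm, Equiv.coe_addRight, Equiv.refl_symm,
      Equiv.refl_apply, Prod.fst_add, Prod.snd_add, Prod.fst_neg, Prod.snd_neg]
    rw [← ite_add_ite_zmod2 (R := ¬ (((d1 + 1 ≤ x ∧ x ≤ c1 - 1 ∨ c1 ≤ x ∧ x ≤ d1) ∧
      ivl (c2 - d2) (y - d2)) ↔ ((d1 + 1 ≤ x ∧ x ≤ c1 - 1 ∨ c1 ≤ x ∧ x ≤ d1) ∧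
      ivl (c2 - d2) (y + 1 - d2)))) Iff.rfl]
    apply ite_add_ite_zmod2
    unfold ivl
    omega

lemma IsState.corner_reflect (hΦ : IsState a b Φ) (c d : V) :
    corner Φ c d = corner (EP.pull reV reE Φ) (reV d) (reV c) := by
  rw [corner_eq, corner_eq]
  unfold EP.pull
  rw [dpath_rect, hΦ.gauge _ _ _ _ (rect_finite c d)]
  rw [show reV (reV d) = d from reV.left_inv d, show reV (reV c) = c from reV.left_inv c,
    hΦ.symm d c, ← mul_assoc]
  congr 1
  simp only [rect, reV, Equiv.coe_fn_mk]
  rw [sg_add, sg_ite, sg_ite]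
  unfold kNW ivl
  split_ifs <;> first | omega | norm_num

lemma IsState.corner_lap' (hΦ : IsState a b Φ) (hb : 0 < b) (hab : a ^ 2 - b ^ 2 = 1) (c d : V) :
    2 * a ^ 2 / b * corner Φ c d = lap (corner Φ c) d + source a b (c - d) := by
  have h := (hΦ.pull compat_re).corner_lap hb hab (reV d) (reV c)
  rw [← hΦ.corner_reflect] at h
  rw [h]
  unfold lap
  simp only [hΦ.corner_reflect c]
  have h1 : reV (d + e1) = reV d - e1 := by
    simp [reV, e1]; ring
  have h2 : reV (d - e1) = reV d + e1 := by
    simp [reV, e1]; ring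
  have h3 : reV (d + e2) = reV d + e2 := by
    simp [reV, e2]
  have h4 : reV (d - e2) = reV d - e2 := by
    simp [reV, e2]
  rw [h1, h2, h3, h4]
  have h5 : source a b (reV d - reV c) = source a b (c - d) := by
    unfold source del
    congr 3
    · simp only [reV, Equiv.coe_fn_mk, Prod.ext_iff, Prod.fst_sub, Prod.snd_sub, Prod.fst_zero,
        Prod.snd_zero, eq_iff_iff]
      omega
    · simp only [reV, Equiv.coe_fn_mk, Prod.ext_iff, Prod.fst_sub, Prod.snd_sub, Prod.fst_zero,
        Prod.snd_zero, eq_iff_iff, e1]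
      omega
  rw [h5]
  ring

lemma abs_kNW (i j : ℤ) : |kNW i j| = 1 := by
  unfold kNW; split_ifs <;> simp

lemma IsState.abs_corner_le (hΦ : IsState a b Φ) (c d : V) : |corner Φ c d| ≤ Φ c d 0 := by
  rw [corner_eq, abs_mul, abs_kNW, one_mul]
  exact hΦ.bound _ _ _

lemma corner_self (Φ : V → V → (Ed → ZMod 2) → ℝ) (d : V) :
    corner Φ d d = Φ d d (Pi.single (d, true) 1) := by
  rw [corner_eq]
  simp only [sub_self]
  rw [show kNW 0 0 = 1 by simp [kNW], one_mul]
  congr 1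
  funext e
  obtain ⟨⟨x, y⟩, _ | _⟩ := e
  · simp [dpath, trE, ivl, Pi.single_apply]
    intros
    omega
  · simp [dpath, trE, ivl, Pi.single_apply, Prod.ext_iff]
    congr 1
    simp only [eq_iff_iff]
    omega

variable {a b : ℝ} {Φ : V → V → (Ed → ZMod 2) → ℝ}

/-! ### Rigidity of states and explicit formula for the free state -/

lemma lam_ge (hb : 0 < b) (hab : a ^ 2 - b ^ 2 = 1) : 4 ≤ 2 * a ^ 2 / b := by
  rw [le_div_iff₀ hb]
  nlinarith [sq_nonneg (b - 1)]

lemma lam_gt (hb : 0 < b) (hb1 : b ≠ 1) (hab : a ^ 2 - b ^ 2 = 1) : 4 < 2 * a ^ 2 / b := by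
  rw [lt_div_iff₀ hb]
  have : 0 < (b - 1) ^ 2 := by
    have : b - 1 ≠ 0 := sub_ne_zero.2 hb1
    positivity
  nlinarith

lemma IsState.corner_shift {u w : V}
    (huw : ∀ (f : V → ℝ) v, lap f v = f (v + u) + f (v + -u) + (f (v + w) + f (v + -w)))
    (hΦ : IsState a b Φ) (hb : 0 < b) (hab : a ^ 2 - b ^ 2 = 1)
    (hC : ∀ ε : ℝ, 0 < ε → ε < 1 → ∃ l', 4 < l' ∧ l' ≤ 2 * a ^ 2 / b + 2 * ε ∧
      ∀ c d, Φ c d 0 * (ε * green l' (c - d)) ≤ 1) (c d : V) :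
    corner Φ (c + u) (d + u) = corner Φ c d := by
  obtain ⟨B, hB⟩ : ∃ B : V → ℝ, ∀ c d, |corner Φ c d| ≤ B (c - d) := by
    obtain ⟨l', h4, -, h⟩ := hC (1 / 2) (by norm_num) (by norm_num)
    refine ⟨fun v => 1 / (1 / 2 * green l' v), fun c d => ?_⟩
    rw [le_div_iff₀ (by have := green_pos h4 (c - d); positivity)]
    refine le_trans ?_ (h c d)
    exact mul_le_mul_of_nonneg_right (hΦ.abs_corner_le c d)
      (mul_nonneg (by norm_num) (green_nonneg h4 _))
  have hsol : IsBisol (2 * a ^ 2 / b) (diagDiff u (corner Φ)) := by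
    constructor
    · intro c d
      have h1 := hΦ.corner_lap hb hab (c + u) (d + u)
      have h2 := hΦ.corner_lap hb hab c d
      have h3 := lap_shift (fun c => corner Φ c (d + u)) u c
      unfold diagDiff
      rw [lap_sub, h3, mul_sub, h1, h2, show c + u - (d + u) = c - d by abel]
      ring
    · intro c d
      have h1 := hΦ.corner_lap' hb hab (c + u) (d + u)
      have h2 := hΦ.corner_lap' hb hab c d
      have h3 := lap_shift (corner Φ (c + u)) u d
      show _ = lap (fun d => corner Φ (c + u) (d + u) - corner Φ c d) d
      unfold diagDiff
      rw [lap_sub, h3, mul_sub, h1, h2, show c + u - (d + u) = c - d by abel]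
      ring
  have h0 := diagDiff_eq_zero_of_sq hB (u := u) (fun c d => by
    have := liouville huw (lam_ge hb hab) hsol (C := 2) (fun ε h0 h1 => by
      obtain ⟨l', h4, h5, h⟩ := hC ε h0 h1
      refine ⟨l', h4, h5, fun c d => ?_⟩
      have hg : 0 ≤ ε * green l' (c - d) := mul_nonneg h0.le (green_nonneg h4 _)
      have a1 := h c d
      have a2 := h (c + u) (d + u)
      rw [show c + u - (d + u) = c - d by abel] at a2
      calc _ ≤ (Φ (c + u) (d + u) 0 + Φ c d 0) * (ε * green l' (c - d)) := by
            apply mul_le_mul_of_nonneg_right _ hg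
            unfold diagDiff
            exact (abs_sub _ _).trans (add_le_add (hΦ.abs_corner_le _ _) (hΦ.abs_corner_le _ _))
        _ ≤ 2 := by linarith) c d
    rw [diagDiff, this, sub_self]) c d
  unfold diagDiff at h0
  linarith

lemma const_of_shift {f : V → ℝ} (h1 : ∀ v, f (v + e1) = f v) (h2 : ∀ v, f (v + e2) = f v) (v : V) :
    f v = f 0 := by
  have k1 : ∀ (n : ℤ) v, f (v + (n, 0)) = f v := by
    intro n
    induction n using Int.induction_on with
    | zero => intro v; rw [show ((0 : ℤ), (0 : ℤ)) = (0 : V) from rfl, add_zero]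
    | succ n ih =>
      intro v
      rw [← ih v, ← h1 (v + ((n : ℤ), 0))]
      congr 1
      ext <;> simp [e1] <;> ring
    | pred n ih =>
      intro v
      rw [← ih v, ← h1 (v + (-(n : ℤ) - 1, 0))]
      congr 1
      ext <;> simp [e1] <;> ring
  have k2 : ∀ (n : ℤ) v, f (v + (0, n)) = f v := by
    intro n
    induction n using Int.induction_on with
    | zero => intro v; rw [show ((0 : ℤ), (0 : ℤ)) = (0 : V) from rfl, add_zero]
    | succ n ih =>
      intro v
      rw [← ih v, ← h2 (v + (0, (n : ℤ)))]
      congr 1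
      ext <;> simp [e2] <;> ring
    | pred n ih =>
      intro v
      rw [← ih v, ← h2 (v + (0, -(n : ℤ) - 1))]
      congr 1
      ext <;> simp [e2] <;> ring
  rw [← k1 v.1 0, ← k2 v.2 (0 + (v.1, 0))]
  congr 1
  ext <;> simp

lemma IsState.vertical_const (hΦ : IsState a b Φ) (hb : 0 < b) (hab : a ^ 2 - b ^ 2 = 1)
    (hC : ∀ ε : ℝ, 0 < ε → ε < 1 → ∃ l', 4 < l' ∧ l' ≤ 2 * a ^ 2 / b + 2 * ε ∧
      ∀ c d, Φ c d 0 * (ε * green l' (c - d)) ≤ 1) (d : V) :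
    Φ d d (Pi.single (d, true) 1) = Φ 0 0 (Pi.single (0, true) 1) := by
  rw [← corner_self Φ, ← corner_self Φ]
  exact const_of_shift (f := fun d => corner Φ d d) (fun d => hΦ.corner_shift lap_e1 hb hab hC d d)
    (fun d => hΦ.corner_shift lap_e2 hb hab hC d d) d

lemma pull_sw_single (Φ : V → V → (Ed → ZMod 2) → ℝ) (d : V) :
    pull swV swE Φ d d (Pi.single (d, true) 1) = Φ d.swap d.swap (Pi.single (d.swap, false) 1) := by
  have := single_comp_symm swE (d, true) 0
  rw [zero_add, show (0 : Ed → ZMod 2) ∘ swE.symm = 0 from rfl, zero_add] at this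
  unfold pull
  rw [this]
  rfl

lemma IsState.horizontal_const (hΦ : IsState a b Φ) (hb : 0 < b) (hab : a ^ 2 - b ^ 2 = 1)
    (hC : ∀ ε : ℝ, 0 < ε → ε < 1 → ∃ l', 4 < l' ∧ l' ≤ 2 * a ^ 2 / b + 2 * ε ∧
      ∀ c d, Φ c d 0 * (ε * green l' (c - d)) ≤ 1) (d : V) :
    Φ d d (Pi.single (d, false) 1) = Φ 0 0 (Pi.single (0, false) 1) := by
  have h := (hΦ.pull compat_sw).vertical_const hb hab (fun ε h0 h1 => by
    obtain ⟨l', h4, h5, h⟩ := hC ε h0 h1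
    refine ⟨l', h4, h5, fun c d => ?_⟩
    have := h (swV c) (swV d)
    have e : green l' (swV c - swV d) = green l' (c - d) := by
      rw [← green_swap]; rfl
    rw [e] at this
    exact this) d.swap
  rw [pull_sw_single, pull_sw_single] at h
  simpa using h

/-- Infinite volume energy of an edge of the free state. -/
def energy (b : ℝ) : ℝ :=
  Real.sqrt (1 + b ^ 2) * (1 / (2 * b) + green (2 * (1 + b ^ 2) / b) 0 * (b ^ 2 - 1) / b ^ 2)

lemma IsState.corner_formula (hΦ : IsState a b Φ) (hb : 0 < b) (hb1 : b ≠ 1) (ha : 0 < a)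
    (hab : a ^ 2 - b ^ 2 = 1) (h1 : ∀ c d, Φ c d 0 ≤ 1) (c d : V) :
    corner Φ c d = 2 * a * (green (2 * a ^ 2 / b) (c - d) - green (2 * a ^ 2 / b) (c - d - e1) / b) := by
  have h4 := lam_gt hb hb1 hab
  set l := 2 * a ^ 2 / b with hl
  set g : V → ℝ := fun c => 2 * a * (green l (c - d) - green l (c - d - e1) / b) with hg
  have hgl : ∀ v, |g v| ≤ 2 * a * (1 / (l - 4) + 1 / (l - 4) / b) := by
    intro v
    rw [hg]
    simp only
    rw [abs_mul, abs_of_pos (by positivity : 0 < 2 * a)]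
    apply mul_le_mul_of_nonneg_left _ (by positivity)
    refine (abs_sub _ _).trans (add_le_add ?_ ?_)
    · rw [abs_of_nonneg (green_nonneg h4 _)]; exact green_le h4 _
    · rw [abs_div, abs_of_pos hb, abs_of_nonneg (green_nonneg h4 _)]
      exact div_le_div_of_nonneg_right (green_le h4 _) hb.le
  have := bounded_unique h4 (f := fun c => corner Φ c d) (g := g)
    (s := fun c => source a b (c - d)) (B := max 1 (2 * a * (1 / (l - 4) + 1 / (l - 4) / b)))
    (fun v => ((hΦ.abs_corner_le _ _).trans (h1 _ _)).trans (le_max_left _ _))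
    (fun v => (hgl v).trans (le_max_right _ _))
    (fun v => hΦ.corner_lap hb hab v d)
    (fun v => by
      have e1' := green_eq h4 (v - d)
      have e2' := green_eq h4 (v - d - e1)
      have s1 : lap (fun v => green l (v - d)) v = lap (green l) (v - d) := by
        have := lap_shift (green l) (-d) v
        simpa [← sub_eq_add_neg] using this
      have s2 : lap (fun v => green l (v - d - e1)) v = lap (green l) (v - d - e1) := by
        have := lap_shift (green l) (-d + -e1) v
        rw [show v - d - e1 = v + (-d + -e1) by abel, ← this]
        congr 1
        funext v
        rw [show v - d - e1 = v + (-d + -e1) by abel]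
      have s3 : lap g v = 2 * a * (lap (fun v => green l (v - d)) v -
          lap (fun v => green l (v - d - e1)) v / b) := by
        unfold lap; rw [hg]; ring
      rw [s3, s1, s2]
      unfold source
      rw [hg]
      simp only
      linear_combination 2 * a * e1' - 2 * a / b * e2')
  exact congrFun this c

lemma IsState.vertical_eq_energy (hΦ : IsState a b Φ) (hb : 0 < b) (hb1 : b ≠ 1) (ha : 0 < a)
    (hab : a ^ 2 - b ^ 2 = 1) (h1 : ∀ c d, Φ c d 0 ≤ 1) (d : V) :
    Φ d d (Pi.single (d, true) 1) = energy b := by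
  rw [← corner_self Φ, hΦ.corner_formula hb hb1 ha hab h1, sub_self, zero_sub, green_neg]
  have h4 := lam_gt hb hb1 hab
  have ha2 : a ^ 2 = 1 + b ^ 2 := by linarith
  have h := green_eq h4 0
  have s : lap (green (2 * a ^ 2 / b)) 0 = 4 * green (2 * a ^ 2 / b) e1 := by
    unfold lap
    rw [zero_add, zero_sub, zero_add, zero_sub, green_neg, green_neg]
    have : green (2 * a ^ 2 / b) e2 = green (2 * a ^ 2 / b) e1 := by
      rw [← green_swap]; rfl
    rw [this]; ring
  rw [s, show del 0 = 1 by simp [del]] at h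
  unfold energy
  rw [← ha2, Real.sqrt_sq ha.le]
  have e : green (2 * a ^ 2 / b) e1 = (2 * a ^ 2 / b * green (2 * a ^ 2 / b) 0 - 1) / 4 := by
    linarith
  rw [e]
  field_simp
  rw [ha2]
  ring

lemma IsState.horizontal_eq_energy (hΦ : IsState a b Φ) (hb : 0 < b) (hb1 : b ≠ 1) (ha : 0 < a)
    (hab : a ^ 2 - b ^ 2 = 1) (h1 : ∀ c d, Φ c d 0 ≤ 1) (d : V) :
    Φ d d (Pi.single (d, false) 1) = energy b := by
  have := (hΦ.pull compat_sw).vertical_eq_energy hb hb1 ha hab (fun c d => h1 _ _) d.swap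
  rw [pull_sw_single] at this
  simpa using this

lemma IsState.green_le_two_point (hΦ : IsState a b Φ) (hb : 1 < b) (ha : 0 < a)
    (hab : a ^ 2 - b ^ 2 = 1) (h1 : ∀ c d, Φ c d 0 ≤ 1) (c d : V) :
    2 * (b - 1) * green (2 * a ^ 2 / b) (c - d) ≤ Φ c d 0 := by
  have hb0 : 0 < b := by linarith
  have h4 := lam_gt hb0 hb.ne' hab
  have key : ∀ c d : V, (c - d).1 ≤ 0 → 2 * (b - 1) * green (2 * a ^ 2 / b) (c - d) ≤ Φ c d 0 := by
    intro c d hcd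
    have h := hΦ.abs_corner_le c d
    rw [hΦ.corner_formula hb0 hb.ne' ha hab h1] at h
    have h2 := green_halfplane h4 (c - d) hcd
    have hg := green_nonneg h4 (c - d)
    refine le_trans ?_ ((le_abs_self _).trans h)
    have hba : b ≤ a := by nlinarith
    set G := green (2 * a ^ 2 / b) (c - d)
    set G' := green (2 * a ^ 2 / b) (c - d - e1)
    have h3 : G' / b ≤ G / b := div_le_div_of_nonneg_right h2 hb0.le
    have h5 : b * (G - G / b) = (b - 1) * G := by field_simp
    have h6 : 0 ≤ G - G / b := by
      have : 0 ≤ (b - 1) * G := mul_nonneg (by linarith) hg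
      rw [← h5] at this
      exact nonneg_of_mul_nonneg_right this hb0
    nlinarith
  rcases le_or_gt (c - d).1 0 with h | h
  · exact key c d h
  · rw [hΦ.symm, ← green_neg, neg_sub]
    apply key
    simp only [Prod.fst_sub] at h ⊢
    omega

/-! ### Finite-volume correlations -/

/-- The boundary of an edge. -/
def Dd (e : Ed) : V → ZMod 2 := Pi.single (tl e) 1 + Pi.single (hd e) 1

/-- The boundary of a path from `v` to `w`. -/
def pr (v w : V) : V → ZMod 2 := Pi.single v 1 + Pi.single w 1

lemma pr_comm (v w : V) : pr v w = pr w v := add_comm _ _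

lemma pr_self (v : V) : pr v v = 0 := add_self _

lemma Dd_eq (e : Ed) : Dd e = pr (tl e) (hd e) := rfl

lemma pr_add (u v w : V) : pr u v + pr v w = pr u w := by
  unfold pr
  rw [add_assoc, ← add_assoc (Pi.single v 1), add_self, zero_add]

lemma pr_finite (v w : V) : (Function.support (pr v w)).Finite := by
  refine Set.Finite.subset (Set.toFinite {v, w}) ?_
  intro u hu
  by_contra h
  simp only [Set.mem_insert_iff, Set.mem_singleton_iff, not_or] at h
  exact hu (by simp [pr, h.1, h.2])

lemma Dd_finite (e : Ed) : (Function.support (Dd e)).Finite := pr_finite _ _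

lemma bdy_finite (γ : Finset Ed) : (Function.support (bdy Dd γ)).Finite := by
  obtain ⟨S, h1, h2⟩ := exists_support Dd Dd_finite γ 0 (by simp)
  refine Set.Finite.subset S.finite_toSet ?_
  intro v hv
  by_contra h
  apply hv
  unfold bdy
  rw [Finset.sum_apply]
  exact Finset.sum_eq_zero fun e he => h1 e he v h

/-- Signed high-temperature weights. -/
def wgt (x : ℝ) (δ : Ed → ZMod 2) (e : Ed) : ℝ := x * sg (δ e)

lemma wgt_zero (x : ℝ) : wgt x 0 = fun _ => x := by
  funext e; simp [wgt, sg_zero]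

/-- Finite-volume correlations with boundary sources `A`. -/
def ph (x : ℝ) (Λ : Finset Ed) (A B : V → ZMod 2) (δ : Ed → ZMod 2) : ℝ :=
  Zw Dd (wgt x δ) Λ (A + B) / Zw Dd (fun _ => x) Λ A

lemma Zw_wgt_step {a b x : ℝ} (h1 : x = a - b) (h2 : x * (a + b) = 1) {Λ : Finset Ed} {e : Ed}
    (he : e ∈ Λ) (C : V → ZMod 2) (δ : Ed → ZMod 2) :
    Zw Dd (wgt x δ) Λ (C + Dd e) = sg (δ e) * (a * Zw Dd (wgt x δ) Λ C -
      b * Zw Dd (wgt x (δ + Pi.single e 1)) Λ C) := by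
  obtain ⟨Λ', h', rfl⟩ : ∃ Λ', e ∉ Λ' ∧ insert e Λ' = Λ :=
    ⟨Λ.erase e, Finset.notMem_erase e Λ, Finset.insert_erase he⟩
  have hc : ∀ A, Zw Dd (wgt x (δ + Pi.single e 1)) Λ' A = Zw Dd (wgt x δ) Λ' A := fun A =>
    Zw_congr Dd (fun f hf => by
      have : f ≠ e := fun h => h' (h ▸ hf)
      simp [wgt, this]) A
  simp only [Zw_insert _ _ h', hc]
  rw [add_assoc C, add_self, add_zero]
  have hw : wgt x (δ + Pi.single e 1) e = - wgt x δ e := by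
    simp [wgt, sg_add, sg_one]
  rw [hw]
  unfold wgt
  rcases sg_eq (δ e) with hs | hs <;> rw [hs]
  · linear_combination (Zw Dd (fun e => x * sg (δ e)) Λ' C) * h1 -
      (Zw Dd (fun e => x * sg (δ e)) Λ' (C + Dd e)) * h2
  · linear_combination -(Zw Dd (fun e => x * sg (δ e)) Λ' C) * h1 -
      (Zw Dd (fun e => x * sg (δ e)) Λ' (C + Dd e)) * h2

lemma chi_single (T : Finset V) (v : V) : chi T (Pi.single v 1) = if v ∈ T then -1 else 1 := by
  unfold chi
  split_ifs with h
  · rw [Finset.prod_eq_single v]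
    · simp [sg_one]
    · intro w _ hw; simp [hw, sg_zero]
    · exact fun h' => absurd h h'
  · apply Finset.prod_eq_one
    intro w hw
    have : w ≠ v := fun h' => h (h' ▸ hw)
    simp [this, sg_zero]

lemma chi_support_single {U : V → ZMod 2} (hU : (Function.support U).Finite) (v : V) :
    chi hU.toFinset (Pi.single v 1) = sg (U v) := by
  rw [chi_single]
  rcases zmod2_cases (U v) with h | h <;> simp [h, sg_zero, sg_one]

lemma chi_support_pr {U : V → ZMod 2} (hU : (Function.support U).Finite) (v w : V) :
    chi hU.toFinset (pr v w) = sg (U v + U w) := by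
  unfold pr
  rw [chi_add, chi_support_single, chi_support_single, sg_add]

lemma chi_support_bdy {U : V → ZMod 2} (hU : (Function.support U).Finite) (η : Finset Ed) :
    chi hU.toFinset (bdy Dd η) = ∏ e ∈ η, sg (cob U e) := by
  unfold bdy
  rw [chi_sum]
  apply Finset.prod_congr rfl
  intro e _
  rw [Dd_eq, chi_support_pr]; rfl

lemma Zw_wgt_gauge (x : ℝ) (Λ : Finset Ed) (C : V → ZMod 2) (δ : Ed → ZMod 2) {U : V → ZMod 2}
    (hU : (Function.support U).Finite) :
    Zw Dd (wgt x (δ + cob U)) Λ C = chi hU.toFinset C * Zw Dd (wgt x δ) Λ C := by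
  unfold Zw
  rw [Finset.mul_sum]
  apply Finset.sum_congr rfl
  intro η _
  split_ifs with h
  · rw [← h, chi_support_bdy, ← Finset.prod_mul_distrib]
    apply Finset.prod_congr rfl
    intro e _
    simp only [wgt, Pi.add_apply, sg_add]; ring
  · simp

lemma abs_Zw_wgt_le {x : ℝ} (hx : 0 ≤ x) (Λ : Finset Ed) (C : V → ZMod 2) (δ : Ed → ZMod 2) :
    |Zw Dd (wgt x δ) Λ C| ≤ Zw Dd (fun _ => x) Λ C := by
  unfold Zw
  refine (Finset.abs_sum_le_sum_abs _ _).trans (Finset.sum_le_sum fun η _ => ?_)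
  split_ifs
  · rw [Finset.abs_prod]
    apply le_of_eq
    apply Finset.prod_congr rfl
    intro e _
    rw [wgt, abs_mul, abs_sg, abs_of_nonneg hx, mul_one]
  · simp

lemma Zw_bdy_pos {x : ℝ} (hx : 0 < x) {Λ ξ : Finset Ed} (h : ξ ⊆ Λ) :
    0 < Zw Dd (fun _ => x) Λ (bdy Dd ξ) :=
  lt_of_lt_of_le (Finset.prod_pos fun _ _ => hx) (prod_le_Zw Dd _ (fun _ => hx.le) Λ h)

lemma pow_mul_Zw_le {x : ℝ} (hx0 : 0 ≤ x) (hx1 : x ≤ 1) {Λ γ : Finset Ed} (hγ : γ ⊆ Λ)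
    (A : V → ZMod 2) :
    x ^ γ.card * Zw Dd (fun _ => x) Λ (A + bdy Dd γ) ≤ Zw Dd (fun _ => x) Λ A := by
  induction γ using Finset.induction_on generalizing A with
  | empty => simp [bdy_empty]
  | insert e γ he ih =>
    have h1 := ih (fun f hf => hγ (Finset.mem_insert_of_mem hf)) (A + Dd e)
    have h2 := mul_Zw_le_add Dd hx0 hx1 (hγ (Finset.mem_insert_self e γ)) (A + Dd e)
    rw [add_assoc A, add_self, add_zero] at h2
    rw [bdy_insert Dd he, Finset.card_insert_of_notMem he, pow_succ, ← add_assoc A]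
    calc _ = x * (x ^ γ.card * Zw Dd (fun _ => x) Λ (A + Dd e + bdy Dd γ)) := by ring
      _ ≤ x * Zw Dd (fun _ => x) Λ (A + Dd e) := mul_le_mul_of_nonneg_left h1 hx0
      _ ≤ _ := h2

section
variable {x : ℝ} (hx0 : 0 < x) (hx1 : x ≤ 1)

lemma ph_zero (hx0 : 0 < x) {Λ ξ : Finset Ed} (h : ξ ⊆ Λ) : ph x Λ (bdy Dd ξ) 0 0 = 1 := by
  unfold ph
  rw [wgt_zero, add_zero, div_self (Zw_bdy_pos hx0 h).ne']

lemma abs_ph_le (hx0 : 0 < x) (Λ : Finset Ed) (A B : V → ZMod 2) (δ : Ed → ZMod 2) :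
    |ph x Λ A B δ| ≤ ph x Λ A B 0 := by
  unfold ph
  have h := Zw_nonneg Dd (fun _ => x) (fun _ => hx0.le) Λ A
  rw [abs_div, abs_of_nonneg h, wgt_zero]
  exact div_le_div_of_nonneg_right (abs_Zw_wgt_le hx0.le Λ _ δ) h

lemma ph_bdy_le (hx0 : 0 < x) (hx1 : x ≤ 1) {Λ γ ξ : Finset Ed} (hγ : γ ⊆ Λ) (hξ : ξ ⊆ Λ) :
    ph x Λ (bdy Dd ξ) (bdy Dd γ) 0 ≤ (x ^ γ.card)⁻¹ := by
  unfold ph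
  rw [wgt_zero, div_le_iff₀ (Zw_bdy_pos hx0 hξ), le_inv_mul_iff₀ (by positivity)]
  exact pow_mul_Zw_le hx0.le hx1 hγ _

lemma Dw_eq_ph (x : ℝ) (Λ : Finset Ed) (B : V → ZMod 2) :
    Dw Dd (fun _ => x) Λ B = ph x Λ 0 B 0 := by
  unfold ph Dw; rw [wgt_zero, zero_add]

lemma ph_mul_Dw_le (hx0 : 0 < x) (hx1 : x ≤ 1) {Λ ξ : Finset Ed} (hξ : ξ ⊆ Λ) {B : V → ZMod 2}
    (hB : (Function.support B).Finite) :
    ph x Λ (bdy Dd ξ) B 0 * Dw Dd (fun _ => x) Λ B ≤ 1 := by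
  have h := griffiths Dd_finite (w := fun _ => x) (fun _ => ⟨hx0.le, hx1⟩) Λ (bdy Dd ξ + B) B hB
  rw [add_assoc, add_self, add_zero] at h
  unfold ph Dw
  have h0 := one_le_Zw_zero Dd (fun _ => x) (fun _ => hx0.le) Λ
  have hA := Zw_bdy_pos hx0 hξ
  rw [wgt_zero, div_mul_div_comm, div_le_one (by positivity)]
  linarith

lemma Dw_le_ph (hx0 : 0 < x) (hx1 : x ≤ 1) {Λ ξ : Finset Ed} (hξ : ξ ⊆ Λ) {B : V → ZMod 2}
    (hB : (Function.support B).Finite) :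
    Dw Dd (fun _ => x) Λ B ≤ ph x Λ (bdy Dd ξ) B 0 := by
  have h := griffiths Dd_finite (w := fun _ => x) (fun _ => ⟨hx0.le, hx1⟩) Λ (bdy Dd ξ) B hB
  unfold ph Dw
  have h0 := one_le_Zw_zero Dd (fun _ => x) (fun _ => hx0.le) Λ
  have hA := Zw_bdy_pos hx0 hξ
  rw [wgt_zero, div_le_div_iff₀ (by linarith) hA]
  linarith

lemma Dw_nonneg (hx0 : 0 < x) (Λ : Finset Ed) (B : V → ZMod 2) : 0 ≤ Dw Dd (fun _ => x) Λ B :=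
  div_nonneg (Zw_nonneg _ _ (fun _ => hx0.le) _ _) (Zw_nonneg _ _ (fun _ => hx0.le) _ _)

lemma Dw_le_one (hx0 : 0 < x) (hx1 : x ≤ 1) (Λ : Finset Ed) {B : V → ZMod 2}
    (hB : (Function.support B).Finite) : Dw Dd (fun _ => x) Λ B ≤ 1 := by
  have h := ph_mul_Dw_le hx0 hx1 (Finset.empty_subset Λ) hB
  rw [bdy_empty, ← Dw_eq_ph] at h
  nlinarith [Dw_nonneg hx0 Λ B]

lemma pow_le_Dw (hx0 : 0 < x) (hx1 : x ≤ 1) {Λ γ : Finset Ed} (hγ : γ ⊆ Λ) :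
    x ^ γ.card ≤ Dw Dd (fun _ => x) Λ (bdy Dd γ) := by
  have h0 := one_le_Zw_zero Dd (fun _ => x) (fun _ => hx0.le) Λ
  have h := pow_mul_Zw_le hx0.le hx1 hγ (bdy Dd γ)
  rw [add_self] at h
  unfold Dw
  rwa [le_div_iff₀ (by linarith)]

lemma ph_lebowitz (hx0 : 0 < x) (hx1 : x ≤ 1) {Λ ξ : Finset Ed} (hξ : ξ ⊆ Λ) {B : V → ZMod 2}
    (hB : (Function.support B).Finite) (e : Ed) :
    |ph x Λ (bdy Dd ξ) (B + Dd e) 0 * Dw Dd (fun _ => x) Λ B -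
      ph x Λ (bdy Dd ξ) B 0 * Dw Dd (fun _ => x) Λ (B + Dd e)| ≤
      ph x Λ (bdy Dd ξ) (Dd e) 0 - Dw Dd (fun _ => x) Λ (Dd e) := by
  have h := lebowitz Dd_finite (w := fun _ => x) (fun _ => ⟨hx0.le, hx1⟩) Λ (bdy Dd ξ) B hB e
  unfold ph Dw
  have h0 := one_le_Zw_zero Dd (fun _ => x) (fun _ => hx0.le) Λ
  have hA := Zw_bdy_pos hx0 hξ
  have h0' : 0 < Zw Dd (fun _ => x) Λ 0 := by linarith
  rw [wgt_zero, div_mul_div_comm, div_mul_div_comm, ← sub_div, div_sub_div _ _ hA.ne' h0'.ne',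
    abs_div, abs_of_pos (mul_pos hA h0'), ← add_assoc]
  exact div_le_div_of_nonneg_right h (by positivity)

end

/-! ### Infinite-volume correlations -/

/-- The edges with both endpoints in the box `[-n, n]²`. -/
def bx (n : ℕ) : Finset Ed :=
  ((Finset.Icc (-n : ℤ) n ×ˢ Finset.Icc (-n : ℤ) n) ×ˢ Finset.univ).filter fun e =>
    (hd e).1 ≤ n ∧ (hd e).2 ≤ n

lemma mem_bx {n : ℕ} {e : Ed} : e ∈ bx n ↔
    (-n ≤ (tl e).1 ∧ (tl e).1 ≤ n) ∧ (-n ≤ (tl e).2 ∧ (tl e).2 ≤ n) ∧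
    (hd e).1 ≤ n ∧ (hd e).2 ≤ n := by
  simp only [bx, tl, Finset.mem_filter, Finset.mem_product, Finset.mem_Icc, Finset.mem_univ,
    and_true, and_assoc]

lemma bx_mono {m n : ℕ} (h : m ≤ n) : bx m ⊆ bx n := by
  intro e he
  rw [mem_bx] at *
  have : (m : ℤ) ≤ n := by exact_mod_cast h
  omega

lemma eventually_mem_bx (e : Ed) : ∀ᶠ n in Filter.atTop, e ∈ bx n := by
  obtain ⟨⟨i, j⟩, s⟩ := e
  filter_upwards [Filter.eventually_ge_atTop (i.natAbs + j.natAbs + 1)] with n hn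
  rw [mem_bx]
  cases s <;> simp [tl, hd, e1, e2] <;> omega

lemma eventually_subset_bx (γ : Finset Ed) : ∀ᶠ n in Filter.atTop, γ ⊆ bx n := by
  have : ∀ᶠ n in Filter.atTop, ∀ e ∈ γ, e ∈ bx n :=
    (Filter.eventually_all_finset γ).2 fun e _ => eventually_mem_bx e
  exact this

/-- Limits along a fixed non-principal ultrafilter. -/
def ul (f : ℕ → ℝ) : ℝ := (Filter.hyperfilter ℕ : Filter ℕ).limUnder f

lemma tendsto_ul {f : ℕ → ℝ} {K : ℝ} (h : ∀ᶠ n in Filter.atTop, |f n| ≤ K) :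
    Filter.Tendsto f (Filter.hyperfilter ℕ : Filter ℕ) (nhds (ul f)) := by
  apply tendsto_nhds_limUnder
  have h' : ∀ᶠ n in (Filter.hyperfilter ℕ : Filter ℕ), f n ∈ Set.Icc (-K) K :=
    (h.filter_mono Nat.hyperfilter_le_atTop).mono fun n hn => abs_le.1 hn
  obtain ⟨y, _, hy⟩ := (isCompact_Icc (a := -K) (b := K)).ultrafilter_le_nhds
    ((Filter.hyperfilter ℕ).map f) (by
      rw [Filter.le_principal_iff]; exact h')
  exact ⟨y, hy⟩

lemma ul_eq {f : ℕ → ℝ} {y : ℝ} (h : Filter.Tendsto f (Filter.hyperfilter ℕ : Filter ℕ) (nhds y)) :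
    ul f = y := h.limUnder_eq

lemma ul_const {f : ℕ → ℝ} {y : ℝ} (h : ∀ᶠ n in Filter.atTop, f n = y) : ul f = y :=
  ul_eq (Filter.Tendsto.congr' ((h.filter_mono Nat.hyperfilter_le_atTop).mono
    fun n hn => hn.symm) tendsto_const_nhds)

/-- A family of random boundary conditions on the boxes, with sources only at the boundary. -/
structure IsBdry (ρ : ℕ → Finset Ed → ℝ) : Prop where
  nonneg : ∀ n ξ, 0 ≤ ρ n ξ
  total : ∀ n, ∑ ξ ∈ (bx n).powerset, ρ n ξ = 1
  source : ∀ n, ∀ ξ ⊆ bx n, ρ n ξ ≠ 0 → ∀ v : V, |v.1| < n → |v.2| < n → bdy Dd ξ v = 0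

/-- Finite-volume correlations averaged over the boundary condition. -/
def ps (x : ℝ) (ρ : ℕ → Finset Ed → ℝ) (B : V → ZMod 2) (δ : Ed → ZMod 2) (n : ℕ) : ℝ :=
  ∑ ξ ∈ (bx n).powerset, ρ n ξ * ph x (bx n) (bdy Dd ξ) B δ

/-- Infinite-volume correlations. -/
def st (x : ℝ) (ρ : ℕ → Finset Ed → ℝ) (B : V → ZMod 2) (δ : Ed → ZMod 2) : ℝ :=
  ul (ps x ρ B δ)

/-- Free boundary conditions. -/
def rho0 (n : ℕ) (ξ : Finset Ed) : ℝ := if ξ = ∅ then 1 else 0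

lemma isBdry_rho0 : IsBdry rho0 where
  nonneg n ξ := by unfold rho0; split_ifs <;> norm_num
  total n := by simp [rho0]
  source n ξ _ h v _ _ := by
    have : ξ = ∅ := by by_contra h'; simp [rho0, h'] at h
    simp [this, bdy_empty]

lemma ps_rho0 (x : ℝ) (B : V → ZMod 2) (δ : Ed → ZMod 2) (n : ℕ) :
    ps x rho0 B δ n = ph x (bx n) 0 B δ := by
  simp [ps, rho0, bdy_empty]

section
variable {x : ℝ} {ρ : ℕ → Finset Ed → ℝ}

lemma abs_ps_le (hx0 : 0 < x) (hρ : IsBdry ρ) (B : V → ZMod 2) (δ : Ed → ZMod 2) (n : ℕ) :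
    |ps x ρ B δ n| ≤ ps x ρ B 0 n := by
  unfold ps
  refine (Finset.abs_sum_le_sum_abs _ _).trans (Finset.sum_le_sum fun ξ _ => ?_)
  rw [abs_mul, abs_of_nonneg (hρ.nonneg n ξ)]
  exact mul_le_mul_of_nonneg_left (abs_ph_le hx0 _ _ _ _) (hρ.nonneg n ξ)

lemma ps_le (hρ : IsBdry ρ) {B : V → ZMod 2} {δ : Ed → ZMod 2} {n : ℕ} {K : ℝ}
    (h : ∀ ξ ⊆ bx n, ph x (bx n) (bdy Dd ξ) B δ ≤ K) : ps x ρ B δ n ≤ K := by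
  calc ps x ρ B δ n ≤ ∑ ξ ∈ (bx n).powerset, ρ n ξ * K := Finset.sum_le_sum fun ξ hξ =>
        mul_le_mul_of_nonneg_left (h ξ (Finset.mem_powerset.1 hξ)) (hρ.nonneg n ξ)
    _ = K := by rw [← Finset.sum_mul, hρ.total, one_mul]

lemma le_ps (hρ : IsBdry ρ) {B : V → ZMod 2} {δ : Ed → ZMod 2} {n : ℕ} {K : ℝ}
    (h : ∀ ξ ⊆ bx n, K ≤ ph x (bx n) (bdy Dd ξ) B δ) : K ≤ ps x ρ B δ n := by
  calc K = ∑ ξ ∈ (bx n).powerset, ρ n ξ * K := by rw [← Finset.sum_mul, hρ.total, one_mul]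
    _ ≤ ps x ρ B δ n := Finset.sum_le_sum fun ξ hξ =>
        mul_le_mul_of_nonneg_left (h ξ (Finset.mem_powerset.1 hξ)) (hρ.nonneg n ξ)

lemma ps_bdy_bound (hx0 : 0 < x) (hx1 : x ≤ 1) (hρ : IsBdry ρ) (γ : Finset Ed)
    (δ : Ed → ZMod 2) : ∀ᶠ n in Filter.atTop, |ps x ρ (bdy Dd γ) δ n| ≤ (x ^ γ.card)⁻¹ := by
  filter_upwards [eventually_subset_bx γ] with n hn
  exact (abs_ps_le hx0 hρ _ δ n).trans (ps_le hρ fun ξ hξ => ph_bdy_le hx0 hx1 hn hξ)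

lemma st_tendsto (hx0 : 0 < x) (hx1 : x ≤ 1) (hρ : IsBdry ρ) (γ : Finset Ed)
    (δ : Ed → ZMod 2) : Filter.Tendsto (ps x ρ (bdy Dd γ) δ)
      (Filter.hyperfilter ℕ : Filter ℕ) (nhds (st x ρ (bdy Dd γ) δ)) :=
  tendsto_ul (ps_bdy_bound hx0 hx1 hρ γ δ)

lemma pr_tl_hd (e : Ed) : pr (tl e) (hd e) = Dd e := rfl

lemma exists_bdy_add {B : V → ZMod 2} (h : ∃ γ, bdy Dd γ = B) (e : Ed) :
    ∃ γ, bdy Dd γ = B + Dd e := by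
  obtain ⟨γ, rfl⟩ := h
  exact ⟨symmDiff γ {e}, by rw [bdy_symmDiff, bdy_singleton]⟩

lemma exists_bdy_pr (v w : V) : ∃ γ, bdy Dd γ = pr v w := by
  classical
  have hr : ∀ u : V, (∃ γ, bdy Dd γ = pr v u) ↔ ∃ γ, bdy Dd γ = pr v (u + e1) := fun u => by
    have hD : Dd (u, false) = pr u (u + e1) := by simp [Dd_eq, tl, hd]
    constructor
    · intro h
      have := exists_bdy_add h (u, false)
      rwa [hD, pr_add] at this
    · intro h
      have := exists_bdy_add h (u, false)
      rwa [hD, pr_comm u, pr_add] at this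
  have hu : ∀ u : V, (∃ γ, bdy Dd γ = pr v u) ↔ ∃ γ, bdy Dd γ = pr v (u + e2) := fun u => by
    have hD : Dd (u, true) = pr u (u + e2) := by simp [Dd_eq, tl, hd]
    constructor
    · intro h
      have := exists_bdy_add h (u, true)
      rwa [hD, pr_add] at this
    · intro h
      have := exists_bdy_add h (u, true)
      rwa [hD, pr_comm u, pr_add] at this
  have h := const_of_shift (f := fun u => if ∃ γ, bdy Dd γ = pr v u then 1 else 0)
    (fun u => if_congr (hr u).symm rfl rfl) (fun u => if_congr (hu u).symm rfl rfl)
  have h1 := h v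
  rw [← h w, if_pos ⟨∅, by rw [bdy_empty, pr_self]⟩] at h1
  by_contra hc
  rw [if_neg hc] at h1
  norm_num at h1

lemma st_tendsto_pr (hx0 : 0 < x) (hx1 : x ≤ 1) (hρ : IsBdry ρ) (v w : V)
    (δ : Ed → ZMod 2) : Filter.Tendsto (ps x ρ (pr v w) δ)
      (Filter.hyperfilter ℕ : Filter ℕ) (nhds (st x ρ (pr v w) δ)) := by
  obtain ⟨γ, hγ⟩ := exists_bdy_pr v w
  rw [← hγ]
  exact st_tendsto hx0 hx1 hρ γ δ

lemma ps_step {a b : ℝ} (h1 : x = a - b) (h2 : x * (a + b) = 1) {n : ℕ} {e : Ed} (he : e ∈ bx n)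
    (B : V → ZMod 2) (δ : Ed → ZMod 2) :
    ps x ρ (B + Dd e) δ n =
      sg (δ e) * (a * ps x ρ B δ n - b * ps x ρ B (δ + Pi.single e 1) n) := by
  unfold ps ph
  simp only [← add_assoc, Zw_wgt_step h1 h2 he]
  rw [Finset.mul_sum, Finset.mul_sum, ← Finset.sum_sub_distrib, Finset.mul_sum]
  apply Finset.sum_congr rfl
  intro ξ _
  ring

lemma ps_gauge (hρ : IsBdry ρ) {U : V → ZMod 2} (hU : (Function.support U).Finite) {n : ℕ}
    (hn : ∀ v, U v ≠ 0 → |v.1| < n ∧ |v.2| < n) (v w : V) (δ : Ed → ZMod 2) :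
    ps x ρ (pr v w) (δ + cob U) n = sg (U v + U w) * ps x ρ (pr v w) δ n := by
  unfold ps ph
  rw [Finset.mul_sum]
  apply Finset.sum_congr rfl
  intro ξ hξ
  by_cases h0 : ρ n ξ = 0
  · simp [h0]
  have hs : chi hU.toFinset (bdy Dd ξ) = 1 := by
    unfold chi
    apply Finset.prod_eq_one
    intro u hu
    have := hn u (by simpa using hu)
    rw [hρ.source n ξ (Finset.mem_powerset.1 hξ) h0 u this.1 this.2, sg_zero]
  rw [Zw_wgt_gauge x _ _ δ hU, chi_add, hs, chi_support_pr]
  ring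

theorem isState_st {a b : ℝ} (h1 : x = a - b) (h2 : x * (a + b) = 1) (hx0 : 0 < x) (hx1 : x ≤ 1)
    (hρ : IsBdry ρ) : IsState a b fun v w δ => st x ρ (pr v w) δ where
  symm v w δ := by rw [pr_comm]
  diag v w δ := by rw [pr_self, pr_self]
  one v := by
    rw [pr_self]
    apply ul_const
    filter_upwards with n
    unfold ps
    rw [← hρ.total n]
    exact Finset.sum_congr rfl fun ξ hξ => by
      rw [ph_zero hx0 (Finset.mem_powerset.1 hξ), mul_one]
  step e w δ := by
    apply ul_eq
    have ht := (((st_tendsto_pr hx0 hx1 hρ (tl e) w δ).const_mul a).sub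
      ((st_tendsto_pr hx0 hx1 hρ (tl e) w (δ + Pi.single e 1)).const_mul b)).const_mul (sg (δ e))
    refine ht.congr' ?_
    filter_upwards [(eventually_mem_bx e).filter_mono Nat.hyperfilter_le_atTop] with n hn
    rw [← ps_step h1 h2 hn, add_comm, ← pr_tl_hd, pr_comm (tl e) (hd e), pr_add]
  step' e w δ := by
    apply ul_eq
    have ht := (((st_tendsto_pr hx0 hx1 hρ (hd e) w δ).const_mul a).sub
      ((st_tendsto_pr hx0 hx1 hρ (hd e) w (δ + Pi.single e 1)).const_mul b)).const_mul (sg (δ e))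
    refine ht.congr' ?_
    filter_upwards [(eventually_mem_bx e).filter_mono Nat.hyperfilter_le_atTop] with n hn
    rw [← ps_step h1 h2 hn, add_comm, ← pr_tl_hd, pr_add]
  gauge v w δ U hU := by
    apply ul_eq
    refine ((st_tendsto_pr hx0 hx1 hρ v w δ).const_mul (sg (U v + U w))).congr' ?_
    have : ∀ᶠ n : ℕ in Filter.atTop, ∀ u ∈ hU.toFinset, |u.1| < n ∧ |u.2| < n := by
      refine (Filter.eventually_all_finset hU.toFinset).2 fun u _ => ?_
      filter_upwards [Filter.eventually_ge_atTop (u.1.natAbs + u.2.natAbs + 1)] with n hn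
      constructor <;> rw [abs_lt] <;> omega
    filter_upwards [this.filter_mono Nat.hyperfilter_le_atTop] with n hn
    exact (ps_gauge hρ hU (fun u hu => hn u (by simpa using hu)) v w δ).symm
  bound v w δ := le_of_tendsto_of_tendsto' (st_tendsto_pr hx0 hx1 hρ v w δ).abs
    (st_tendsto_pr hx0 hx1 hρ v w 0) fun n => abs_ps_le hx0 hρ _ δ n

lemma st_mul_free_le (hx0 : 0 < x) (hx1 : x ≤ 1) (hρ : IsBdry ρ) (γ : Finset Ed) :
    st x ρ (bdy Dd γ) 0 * st x rho0 (bdy Dd γ) 0 ≤ 1 := by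
  refine le_of_tendsto' ((st_tendsto hx0 hx1 hρ γ 0).mul (st_tendsto hx0 hx1 isBdry_rho0 γ 0))
    fun n => ?_
  rw [ps_rho0, ← Dw_eq_ph]
  unfold ps
  rw [Finset.sum_mul, ← hρ.total n]
  refine Finset.sum_le_sum fun ξ hξ => ?_
  rw [mul_assoc]
  exact mul_le_of_le_one_right (hρ.nonneg n ξ)
    (ph_mul_Dw_le hx0 hx1 (Finset.mem_powerset.1 hξ) (bdy_finite γ))

lemma free_le_st (hx0 : 0 < x) (hx1 : x ≤ 1) (hρ : IsBdry ρ) (γ : Finset Ed) :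
    st x rho0 (bdy Dd γ) 0 ≤ st x ρ (bdy Dd γ) 0 := by
  refine le_of_tendsto_of_tendsto' (st_tendsto hx0 hx1 isBdry_rho0 γ 0)
    (st_tendsto hx0 hx1 hρ γ 0) fun n => ?_
  rw [ps_rho0, ← Dw_eq_ph]
  exact le_ps hρ fun ξ hξ => Dw_le_ph hx0 hx1 hξ (bdy_finite γ)

lemma free_le_one (hx0 : 0 < x) (hx1 : x ≤ 1) (γ : Finset Ed) : st x rho0 (bdy Dd γ) 0 ≤ 1 :=
  le_of_tendsto' (st_tendsto hx0 hx1 isBdry_rho0 γ 0) fun n => by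
    rw [ps_rho0, ← Dw_eq_ph]
    exact Dw_le_one hx0 hx1 _ (bdy_finite γ)

lemma free_nonneg (hx0 : 0 < x) (hx1 : x ≤ 1) (γ : Finset Ed) : 0 ≤ st x rho0 (bdy Dd γ) 0 :=
  ge_of_tendsto' (st_tendsto hx0 hx1 isBdry_rho0 γ 0) fun n => by
    rw [ps_rho0, ← Dw_eq_ph]
    exact Dw_nonneg hx0 _ _

lemma free_pos (hx0 : 0 < x) (hx1 : x ≤ 1) (γ : Finset Ed) : 0 < st x rho0 (bdy Dd γ) 0 := by
  refine lt_of_lt_of_le (pow_pos hx0 γ.card) ?_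
  refine ge_of_tendsto (st_tendsto hx0 hx1 isBdry_rho0 γ 0) ?_
  filter_upwards [(eventually_subset_bx γ).filter_mono Nat.hyperfilter_le_atTop] with n hn
  rw [ps_rho0, ← Dw_eq_ph]
  exact pow_le_Dw hx0 hx1 hn

lemma free_mono {x' : ℝ} (hx0 : 0 < x') (hxx : x' ≤ x) (hx1 : x ≤ 1) (γ : Finset Ed) :
    st x' rho0 (bdy Dd γ) 0 ≤ st x rho0 (bdy Dd γ) 0 := by
  refine le_of_tendsto_of_tendsto' (st_tendsto hx0 (hxx.trans hx1) isBdry_rho0 γ 0)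
    (st_tendsto (hx0.trans_le hxx) hx1 isBdry_rho0 γ 0) fun n => ?_
  rw [ps_rho0, ps_rho0, ← Dw_eq_ph, ← Dw_eq_ph]
  exact Dw_mono_weight Dd_finite (fun _ => ⟨hx0.le, hxx.trans hx1⟩) _
    (fun _ => ⟨(hx0.trans_le hxx).le, hx1⟩) (fun _ => hxx) _ (bdy_finite γ)

lemma Dw_le_free (hx0 : 0 < x) (hx1 : x ≤ 1) (n : ℕ) (γ : Finset Ed) :
    Dw Dd (fun _ => x) (bx n) (bdy Dd γ) ≤ st x rho0 (bdy Dd γ) 0 := by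
  refine ge_of_tendsto (st_tendsto hx0 hx1 isBdry_rho0 γ 0) ?_
  filter_upwards [(Filter.eventually_ge_atTop n).filter_mono
    Nat.hyperfilter_le_atTop] with m hm
  rw [ps_rho0, ← Dw_eq_ph]
  exact Dw_mono_set Dd_finite (fun _ => ⟨hx0.le, hx1⟩) (bx_mono hm) _ (bdy_finite γ)

lemma st_lebowitz (hx0 : 0 < x) (hx1 : x ≤ 1) (hρ : IsBdry ρ) (γ : Finset Ed) {e : Ed}
    (he : e ∉ γ) :
    |st x ρ (bdy Dd (insert e γ)) 0 * st x rho0 (bdy Dd γ) 0 -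
      st x ρ (bdy Dd γ) 0 * st x rho0 (bdy Dd (insert e γ)) 0| ≤
      st x ρ (bdy Dd {e}) 0 - st x rho0 (bdy Dd {e}) 0 := by
  have h0 := isBdry_rho0
  refine le_of_tendsto_of_tendsto' (((st_tendsto hx0 hx1 hρ (insert e γ) 0).mul
    (st_tendsto hx0 hx1 h0 γ 0)).sub ((st_tendsto hx0 hx1 hρ γ 0).mul
    (st_tendsto hx0 hx1 h0 (insert e γ) 0))).abs
    ((st_tendsto hx0 hx1 hρ {e} 0).sub (st_tendsto hx0 hx1 h0 {e} 0)) fun n => ?_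
  simp only [ps_rho0, ← Dw_eq_ph]
  rw [bdy_insert Dd he, add_comm (Dd e), bdy_singleton]
  set d := Dw Dd (fun _ => x) (bx n)
  have hd : d (Dd e) = ∑ ξ ∈ (bx n).powerset, ρ n ξ * d (Dd e) := by
    rw [← Finset.sum_mul, hρ.total, one_mul]
  rw [hd]
  unfold ps
  rw [Finset.sum_mul, Finset.sum_mul, ← Finset.sum_sub_distrib, ← Finset.sum_sub_distrib]
  refine (Finset.abs_sum_le_sum_abs _ _).trans (Finset.sum_le_sum fun ξ hξ => ?_)
  rw [mul_assoc, mul_assoc, ← mul_sub, ← mul_sub, abs_mul, abs_of_nonneg (hρ.nonneg n ξ)]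
  exact mul_le_mul_of_nonneg_left
    (ph_lebowitz hx0 hx1 (Finset.mem_powerset.1 hξ) (bdy_finite γ) e) (hρ.nonneg n ξ)

/-- If all single-edge correlations agree with the free ones, then all correlations do. -/
theorem st_eq_free (hx0 : 0 < x) (hx1 : x ≤ 1) (hρ : IsBdry ρ)
    (h : ∀ e, st x ρ (Dd e) 0 = st x rho0 (Dd e) 0) (γ : Finset Ed) :
    st x ρ (bdy Dd γ) 0 = st x rho0 (bdy Dd γ) 0 := by
  induction γ using Finset.induction_on with
  | empty =>
    have h1 : ∀ {ρ}, IsBdry ρ → st x ρ (bdy Dd ∅) 0 = 1 := fun {ρ} hρ => by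
      have := (isState_st (x := x) (a := (x⁻¹ + x) / 2) (b := (x⁻¹ - x) / 2) (by ring)
        (by field_simp; ring) hx0 hx1 hρ).one 0
      simpa [pr_self, bdy_empty] using this
    rw [h1 hρ, h1 isBdry_rho0]
  | insert e γ he ih =>
    have hl := st_lebowitz hx0 hx1 hρ γ he
    rw [bdy_singleton, h e, sub_self, ih, mul_comm (st x rho0 (bdy Dd γ) 0), ← sub_mul] at hl
    have h0 := abs_nonpos_iff.1 hl
    have hp := free_pos hx0 hx1 γ
    rcases mul_eq_zero.1 h0 with h0 | h0
    · linarith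
    · linarith

end

/-! ### The free state -/

/-- The edge weight with coupling parameter `b`. -/
def xb (b : ℝ) : ℝ := Real.sqrt (1 + b ^ 2) - b

lemma sqrt_sq_sub (b : ℝ) : Real.sqrt (1 + b ^ 2) ^ 2 - b ^ 2 = 1 := by
  rw [Real.sq_sqrt (by positivity)]; ring

lemma sqrt_pos' (b : ℝ) : 0 < Real.sqrt (1 + b ^ 2) := Real.sqrt_pos.2 (by positivity)

lemma xb_mul (b : ℝ) : xb b * (Real.sqrt (1 + b ^ 2) + b) = 1 := by
  have := sqrt_sq_sub b
  unfold xb; linarith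

lemma xb_pos {b : ℝ} (hb : 0 < b) : 0 < xb b := by
  have h := xb_mul b
  have h2 := sqrt_pos' b
  by_contra hc
  nlinarith

lemma xb_anti {b b' : ℝ} (hb : 0 < b) (h : b < b') : xb b' < xb b := by
  have h1 := xb_mul b
  have h2 := xb_mul b'
  have h3 := sqrt_pos' b
  have h4 : Real.sqrt (1 + b ^ 2) ≤ Real.sqrt (1 + b' ^ 2) := Real.sqrt_le_sqrt (by nlinarith)
  have h5 := xb_pos hb
  have h6 := xb_pos (hb.trans h)
  by_contra hc
  push Not at hc
  nlinarith

lemma xb_lt_one {b : ℝ} (hb : 0 < b) : xb b < 1 := by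
  have h1 := xb_mul b
  have h3 : 1 ≤ Real.sqrt (1 + b ^ 2) := Real.one_le_sqrt.2 (by nlinarith)
  have h5 := xb_pos hb
  nlinarith

lemma exists_xb {x : ℝ} (h0 : 0 < x) (h1 : x < 1) : ∃ b, 0 < b ∧ xb b = x := by
  refine ⟨(x⁻¹ - x) / 2, ?_, ?_⟩
  · have : 1 < x⁻¹ := (one_lt_inv₀ h0).2 h1
    linarith
  · have h : 1 + ((x⁻¹ - x) / 2) ^ 2 = ((x⁻¹ + x) / 2) ^ 2 := by
      field_simp; ring
    unfold xb
    rw [h, Real.sqrt_sq (by positivity)]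
    ring

section
variable {b : ℝ} {ρ : ℕ → Finset Ed → ℝ}

lemma isState_xb (hb : 0 < b) (hρ : IsBdry ρ) :
    IsState (Real.sqrt (1 + b ^ 2)) b fun v w δ => st (xb b) ρ (pr v w) δ :=
  isState_st rfl (xb_mul b) (xb_pos hb) (xb_lt_one hb).le hρ

lemma free_pr_le_one (hb : 0 < b) (c d : V) : st (xb b) rho0 (pr c d) 0 ≤ 1 := by
  obtain ⟨γ, hγ⟩ := exists_bdy_pr c d
  rw [← hγ]
  exact free_le_one (xb_pos hb) (xb_lt_one hb).le γ

lemma free_edge (hb : 0 < b) (hb1 : b ≠ 1) (e : Ed) :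
    st (xb b) rho0 0 (Pi.single e 1) = energy b := by
  have hΦ := isState_xb hb isBdry_rho0
  obtain ⟨d, s⟩ := e
  rw [← pr_self d]
  cases s
  · exact hΦ.horizontal_eq_energy hb hb1 (sqrt_pos' b) (sqrt_sq_sub b) (free_pr_le_one hb) d
  · exact hΦ.vertical_eq_energy hb hb1 (sqrt_pos' b) (sqrt_sq_sub b) (free_pr_le_one hb) d

lemma st_edge (hb : 0 < b) (hρ : IsBdry ρ) (e : Ed) : st (xb b) ρ (Dd e) 0 =
    Real.sqrt (1 + b ^ 2) - b * st (xb b) ρ 0 (Pi.single e 1) := by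
  have hΦ := isState_xb hb hρ
  have h := hΦ.step e (tl e) 0
  have h1 := hΦ.one (tl e)
  simp only [pr_self, Pi.zero_apply, sg_zero, one_mul, zero_add] at h h1
  rw [pr_comm, ← Dd_eq, h1, mul_one] at h
  exact h

lemma st_green_le (hb : 0 < b) (hρ : IsBdry ρ) (ε : ℝ) (h0 : 0 < ε) (h1 : ε < 1) :
    ∃ l', 4 < l' ∧ l' ≤ 2 * Real.sqrt (1 + b ^ 2) ^ 2 / b + 2 * ε ∧
      ∀ c d : V, st (xb b) ρ (pr c d) 0 * (ε * green l' (c - d)) ≤ 1 := by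
  obtain ⟨M, hM1, hMb, hMs⟩ : ∃ M : ℝ, 1 ≤ M ∧ b ≤ M ∧ M + 1 / M = b + 1 / b := by
    rcases le_total 1 b with h | h
    · exact ⟨b, h, le_rfl, rfl⟩
    · refine ⟨1 / b, (one_le_div hb).2 h, h.trans ((one_le_div hb).2 h), ?_⟩
      rw [one_div_one_div]; ring
  set b' := M + ε with hb'
  have hb'1 : 1 < b' := by linarith
  have hb'0 : 0 < b' := by linarith
  have h4 := lam_gt hb'0 hb'1.ne' (sqrt_sq_sub b')
  refine ⟨_, h4, ?_, fun c d => ?_⟩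
  · rw [Real.sq_sqrt (by positivity), Real.sq_sqrt (by positivity)]
    have e1 : ∀ t : ℝ, 0 < t → 2 * (1 + t ^ 2) / t = 2 * (t + 1 / t) := fun t ht => by
      field_simp; ring
    rw [e1 b' hb'0, e1 b hb, ← hMs]
    have : 1 / b' ≤ 1 / M := one_div_le_one_div_of_le (by linarith) (by linarith)
    linarith
  · have hg := green_nonneg h4 (c - d)
    have h2 := (isState_xb hb'0 isBdry_rho0).green_le_two_point hb'1 (sqrt_pos' b')
      (sqrt_sq_sub b') (free_pr_le_one hb'0) c d
    obtain ⟨γ, hγ⟩ := exists_bdy_pr c d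
    simp only [← hγ] at h2 ⊢
    have h3 := free_mono (xb_pos hb'0) (xb_anti hb (by linarith : b < b')).le (xb_lt_one hb).le γ
    have h5 := st_mul_free_le (xb_pos hb) (xb_lt_one hb).le hρ γ
    have h6 := (free_nonneg (xb_pos hb) (xb_lt_one hb).le γ).trans
      (free_le_st (xb_pos hb) (xb_lt_one hb).le hρ γ)
    refine (mul_le_mul_of_nonneg_left ?_ h6).trans h5
    refine le_trans ?_ (h2.trans h3)
    apply mul_le_mul_of_nonneg_right _ hg
    linarith

lemma st_edge_const (hb : 0 < b) (hρ : IsBdry ρ) (d : V) (s : Bool) :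
    st (xb b) ρ 0 (Pi.single (d, s) 1) = st (xb b) ρ 0 (Pi.single (0, s) 1) := by
  have hΦ := isState_xb hb hρ
  have hC := st_green_le hb hρ
  cases s
  · have := hΦ.horizontal_const hb (sqrt_sq_sub b) hC d
    simpa [pr_self] using this
  · have := hΦ.vertical_const hb (sqrt_sq_sub b) hC d
    simpa [pr_self] using this

lemma free_edge_le (hb : 0 < b) {b' : ℝ} (hb' : b < b') (hb1 : b' ≠ 1) (hρ : IsBdry ρ) (e : Ed) :
    Real.sqrt (1 + b' ^ 2) - b' * energy b' ≤ st (xb b) ρ (Dd e) 0 := by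
  have h0 : 0 < b' := hb.trans hb'
  rw [← free_edge h0 hb1 e, ← st_edge h0 isBdry_rho0, ← bdy_singleton Dd e]
  exact (free_mono (xb_pos h0) (xb_anti hb hb').le (xb_lt_one hb).le {e}).trans
    (free_le_st (xb_pos hb) (xb_lt_one hb).le hρ {e})

end

/-! ### Continuity of the energy -/

lemma green_term_tendsto : Filter.Tendsto
    (fun b : ℝ => green (2 * (1 + b ^ 2) / b) 0 * (b ^ 2 - 1)) (nhds 1) (nhds 0) := by
  have hcube : Filter.Tendsto (fun b : ℝ => |green (2 * (1 + b ^ 2) / b) 0 * (b ^ 2 - 1)| ^ 3)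
      (nhds 1) (nhds 0) := by
    have hlim : Filter.Tendsto (fun b : ℝ => |b - 1| * ((b + 1) ^ 3 * b / 2 *
        (8 + 2 * (b - 1) ^ 2 / b))) (nhds 1) (nhds 0) := by
      have : ContinuousAt (fun b : ℝ => |b - 1| * ((b + 1) ^ 3 * b / 2 *
        (8 + 2 * (b - 1) ^ 2 / b))) 1 := by
        have : (1 : ℝ) ≠ 0 := one_ne_zero
        fun_prop (disch := assumption)
      simpa [ContinuousAt] using this
    refine squeeze_zero' (Filter.Eventually.of_forall fun b => by positivity) ?_ hlim
    filter_upwards [Ioi_mem_nhds (show (0 : ℝ) < 1 by norm_num)] with b hb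
    rcases eq_or_ne b 1 with rfl | h1
    · simp
    have hb0 : (0 : ℝ) < b := hb
    have hl : 2 * (1 + b ^ 2) / b - 4 = 2 * (b - 1) ^ 2 / b := by field_simp; ring
    have hpos : 0 < 2 * (b - 1) ^ 2 / b := by
      have : b - 1 ≠ 0 := sub_ne_zero.2 h1
      positivity
    have h4 : 4 < 2 * (1 + b ^ 2) / b := by linarith
    have hc := green_cube h4
    rw [hl] at hc
    have hg := green_nonneg h4 0
    set G := green (2 * (1 + b ^ 2) / b) 0
    rw [abs_mul, abs_of_nonneg hg, mul_pow, show b ^ 2 - 1 = (b - 1) * (b + 1) by ring, abs_mul,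
      abs_of_pos (show 0 < b + 1 by linarith)]
    have e : G ^ 3 * (|b - 1| * (b + 1)) ^ 3 =
        |b - 1| * ((b + 1) ^ 3 * b / 2 * (2 * (b - 1) ^ 2 / b * G ^ 3)) := by
      rw [← sq_abs (b - 1)]
      field_simp
    rw [e]
    gcongr
  have h2 := hcube.rpow_const (p := 1 / 3) (Or.inr (by norm_num))
  have h3 : ∀ t : ℝ, (|t| ^ 3) ^ (1 / 3 : ℝ) = |t| := fun t => by
    rw [← Real.rpow_natCast, ← Real.rpow_mul (abs_nonneg t)]; norm_num
  simp only [h3] at h2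
  rw [Real.zero_rpow (by norm_num)] at h2
  exact (tendsto_zero_iff_abs_tendsto_zero _).2 h2

lemma energy_continuousAt {b : ℝ} (hb : 0 < b) : ContinuousAt energy b := by
  have hb0 : b ≠ 0 := hb.ne'
  have hg : ContinuousAt (fun b : ℝ => green (2 * (1 + b ^ 2) / b) 0 * (b ^ 2 - 1)) b := by
    rcases eq_or_ne b 1 with rfl | h1
    · have := green_term_tendsto
      unfold ContinuousAt
      simpa using this
    · have h4 : 4 < 2 * (1 + b ^ 2) / b := by
        have := lam_gt hb h1 (sqrt_sq_sub b)
        rwa [Real.sq_sqrt (by positivity)] at this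
      have hc : ContinuousAt (fun b : ℝ => 2 * (1 + b ^ 2) / b) b := by
        fun_prop (disch := assumption)
      have := ContinuousAt.comp (f := fun b : ℝ => 2 * (1 + b ^ 2) / b)
        (g := fun l => green l 0) (green_continuousAt h4 0) hc
      exact ContinuousAt.mul this (by fun_prop)
  unfold energy
  refine ContinuousAt.mul (by fun_prop) (ContinuousAt.add ?_ (hg.div (by fun_prop) (by positivity)))
  have : 2 * b ≠ 0 := by positivity
  fun_prop (disch := assumption)

/-! ### Comparison of the mean energy with the free mean energy -/

open Classical in
/-- Mean number of edges in the finite-volume system with sources `A`. -/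
def meanEdges (x : ℝ) (Λ : Finset Ed) (A : V → ZMod 2) : ℝ :=
  (∑ η ∈ Λ.powerset, if bdy Dd η = A then x ^ η.card * (η.card : ℝ) else 0) /
    Zw Dd (fun _ => x) Λ A

lemma prod_wgt_single (x : ℝ) (e : Ed) (η : Finset Ed) :
    ∏ f ∈ η, wgt x (Pi.single e 1) f = x ^ η.card * (if e ∈ η then -1 else 1) := by
  unfold wgt
  rw [Finset.prod_mul_distrib, Finset.prod_const]
  congr 1
  split_ifs with h
  · rw [Finset.prod_eq_single e]
    · simp [sg_one]
    · intro w _ hw; simp [hw, sg_zero]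
    · exact fun h' => absurd h h'
  · apply Finset.prod_eq_one
    intro w hw
    have : w ≠ e := fun h' => h (h' ▸ hw)
    simp [this, sg_zero]

lemma sum_ph_single {x : ℝ} {Λ : Finset Ed} {A : V → ZMod 2} (hZ : 0 < Zw Dd (fun _ => x) Λ A) :
    ∑ e ∈ Λ, ph x Λ A 0 (Pi.single e 1) = Λ.card - 2 * meanEdges x Λ A := by
  unfold ph meanEdges
  rw [← Finset.sum_div, div_eq_iff hZ.ne', sub_mul, mul_assoc, div_mul_cancel₀ _ hZ.ne', add_zero]
  unfold Zw
  rw [Finset.sum_comm, Finset.mul_sum, Finset.mul_sum, ← Finset.sum_sub_distrib]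
  refine Finset.sum_congr rfl fun η hη => ?_
  split_ifs
  · simp only [prod_wgt_single, Finset.prod_const]
    rw [← Finset.mul_sum]
    have : ∑ e ∈ Λ, (if e ∈ η then (-1 : ℝ) else 1) = Λ.card - 2 * η.card := by
      have h1 : ∀ e, (if e ∈ η then (-1 : ℝ) else 1) = 1 - 2 * (if e ∈ η then 1 else 0) := by
        intro e; split_ifs <;> norm_num
      simp only [h1]
      rw [Finset.sum_sub_distrib, ← Finset.mul_sum, Finset.sum_ite_mem,
        Finset.inter_eq_right.2 (Finset.mem_powerset.1 hη)]
      simp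
    rw [this]; ring
  · simp

lemma exp_mean_mul_le {x : ℝ} (hx : 0 < x) (Λ : Finset Ed) (A : V → ZMod 2)
    (hZ : 0 < Zw Dd (fun _ => x) Λ A) (r : ℝ) :
    Real.exp (r * meanEdges x Λ A) * Zw Dd (fun _ => x) Λ A ≤
      Zw Dd (fun _ => x * Real.exp r) Λ A := by
  classical
  set M := meanEdges x Λ A with hM
  have hMZ : M * Zw Dd (fun _ => x) Λ A =
      ∑ η ∈ Λ.powerset, if bdy Dd η = A then x ^ η.card * (η.card : ℝ) else 0 := by
    rw [hM, meanEdges, div_mul_cancel₀ _ hZ.ne']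
  have key : ∑ η ∈ Λ.powerset, Real.exp (r * M) * (if bdy Dd η = A then
      x ^ η.card * (1 + r * (η.card - M)) else 0) ≤ Zw Dd (fun _ => x * Real.exp r) Λ A := by
    unfold Zw
    refine Finset.sum_le_sum fun η _ => ?_
    split_ifs
    · rw [Finset.prod_const, mul_pow, ← Real.exp_nat_mul, mul_left_comm]
      apply mul_le_mul_of_nonneg_left _ (by positivity)
      have h1 : Real.exp (η.card * r) = Real.exp (r * M) * Real.exp (r * (η.card - M)) := by
        rw [← Real.exp_add]; congr 1; ring
      rw [h1]
      apply mul_le_mul_of_nonneg_left _ (Real.exp_pos _).le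
      have := Real.add_one_le_exp (r * (η.card - M))
      linarith
    · simp
  refine le_trans (le_of_eq ?_) key
  rw [← Finset.mul_sum]
  congr 1
  have : ∀ η : Finset Ed, (if bdy Dd η = A then x ^ η.card * (1 + r * (η.card - M)) else 0) =
      (1 - r * M) * (if bdy Dd η = A then x ^ η.card else 0) +
      r * (if bdy Dd η = A then x ^ η.card * (η.card : ℝ) else 0) := fun η => by
    split_ifs
    · ring
    · simp
  simp only [this]
  rw [Finset.sum_add_distrib, ← Finset.mul_sum, ← Finset.mul_sum, ← hMZ]
  have hz : ∑ η ∈ Λ.powerset, (if bdy Dd η = A then x ^ η.card else 0) =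
      Zw Dd (fun _ => x) Λ A := by
    unfold Zw
    refine Finset.sum_congr rfl fun η _ => ?_
    rw [Finset.prod_const]
  rw [hz]; ring

lemma Zw_le_zero {x : ℝ} (hx0 : 0 < x) (hx1 : x ≤ 1) (Λ : Finset Ed) {A : V → ZMod 2}
    (hA : (Function.support A).Finite) : Zw Dd (fun _ => x) Λ A ≤ Zw Dd (fun _ => x) Λ 0 := by
  have h := griffiths Dd_finite (w := fun _ => x) (fun _ => ⟨hx0.le, hx1⟩) Λ A A hA
  rw [add_self] at h
  have h0 := one_le_Zw_zero Dd (fun _ => x) (fun _ => hx0.le) Λ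
  exact abs_le_of_sq_le_sq' (by nlinarith) (by linarith) |>.2

lemma sum_ph_single_ge {x r : ℝ} (hx0 : 0 < x) (hr : 0 < r) (hx1 : x * Real.exp r ≤ 1)
    {Λ γ : Finset Ed} (hγ : γ ⊆ Λ) :
    ∑ e ∈ Λ, ph (x * Real.exp r) Λ 0 0 (Pi.single e 1) - 2 * γ.card * (-Real.log x) / r ≤
      ∑ e ∈ Λ, ph x Λ (bdy Dd γ) 0 (Pi.single e 1) := by
  have hx' : 0 < x * Real.exp r := mul_pos hx0 (Real.exp_pos r)
  have hx1' : x ≤ 1 := by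
    have := Real.add_one_le_exp r
    nlinarith
  have hA := Zw_bdy_pos hx0 hγ
  have h0 : 0 < Zw Dd (fun _ => x) Λ 0 :=
    lt_of_lt_of_le one_pos (one_le_Zw_zero Dd _ (fun _ => hx0.le) Λ)
  have h0' : 0 < Zw Dd (fun _ => x * Real.exp r) Λ 0 :=
    lt_of_lt_of_le one_pos (one_le_Zw_zero Dd _ (fun _ => hx'.le) Λ)
  rw [sum_ph_single hA, sum_ph_single h0']
  have i1 := exp_mean_mul_le hx0 Λ _ hA r
  have i2 := exp_mean_mul_le hx' Λ 0 h0' (-r)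
  rw [mul_assoc, ← Real.exp_add, add_neg_cancel, Real.exp_zero, mul_one] at i2
  have i3 := Zw_le_zero hx' hx1 Λ (bdy_finite γ)
  have i4 := pow_mul_Zw_le hx0.le hx1' hγ (bdy Dd γ)
  rw [add_self] at i4
  set M := meanEdges x Λ (bdy Dd γ)
  set M' := meanEdges (x * Real.exp r) Λ 0
  have i5 : Real.exp (r * M) * (x ^ γ.card * Zw Dd (fun _ => x) Λ 0) ≤
      Real.exp (r * M') * Zw Dd (fun _ => x) Λ 0 := by
    calc _ ≤ Real.exp (r * M) * Zw Dd (fun _ => x) Λ (bdy Dd γ) :=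
          mul_le_mul_of_nonneg_left i4 (Real.exp_pos _).le
      _ ≤ Zw Dd (fun _ => x * Real.exp r) Λ 0 := i1.trans i3
      _ = Real.exp (r * M') * (Real.exp (-r * M') * Zw Dd (fun _ => x * Real.exp r) Λ 0) := by
          rw [← mul_assoc, ← Real.exp_add]; simp
      _ ≤ _ := mul_le_mul_of_nonneg_left i2 (Real.exp_pos _).le
  rw [← mul_assoc] at i5
  have i6 := le_of_mul_le_mul_right i5 h0
  have i7 := Real.log_le_log (by positivity) i6
  rw [Real.log_mul (Real.exp_pos _).ne' (by positivity), Real.log_exp, Real.log_exp,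
    Real.log_pow] at i7
  have i8 : M - M' ≤ γ.card * (-Real.log x) / r := by
    rw [le_div_iff₀ hr]; linarith
  have : 2 * (γ.card : ℝ) * (-Real.log x) / r = 2 * (γ.card * (-Real.log x) / r) := by ring
  rw [this]
  linarith

/-! ### Sources on the boundary of a box -/

/-- The edges on the boundary of a box. -/
def rim (n : ℕ) : Finset Ed :=
  (Finset.range (2 * n)).image (fun k : ℕ => (((-n + k, -n) : V), false)) ∪
  (Finset.range (2 * n)).image (fun k : ℕ => (((-n + k, n) : V), false)) ∪
  (Finset.range (2 * n)).image (fun k : ℕ => (((-n, -n + k) : V), true)) ∪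
  (Finset.range (2 * n)).image (fun k : ℕ => (((n, -n + k) : V), true))

lemma card_rim_le (n : ℕ) : (rim n).card ≤ 8 * n := by
  have h : ∀ f : ℕ → Ed, ((Finset.range (2 * n)).image f).card ≤ 2 * n := fun f =>
    Finset.card_image_le.trans (by simp)
  unfold rim
  refine (Finset.card_union_le _ _).trans ?_
  refine (Nat.add_le_add ((Finset.card_union_le _ _).trans
    (Nat.add_le_add (Finset.card_union_le _ _) le_rfl)) le_rfl).trans ?_
  have h1 := h (fun k : ℕ => (((-n + k, -n) : V), false))
  have h2 := h (fun k : ℕ => (((-n + k, n) : V), false))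
  have h3 := h (fun k : ℕ => (((-n, -n + k) : V), true))
  have h4 := h (fun k : ℕ => (((n, -n + k) : V), true))
  omega

lemma rim_subset (n : ℕ) : rim n ⊆ bx n := by
  intro e he
  simp only [rim, Finset.mem_union, Finset.mem_image, Finset.mem_range] at he
  rw [mem_bx]
  rcases he with ((⟨k, hk, rfl⟩ | ⟨k, hk, rfl⟩) | ⟨k, hk, rfl⟩) | ⟨k, hk, rfl⟩ <;>
    simp [tl, hd, e1, e2] <;> omega

/-- `v` can be joined to the corner of the box along the boundary. -/
def OnRim (n : ℕ) (v : V) : Prop := ∃ γ ⊆ rim n, bdy Dd γ = pr (-n, -n) v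

lemma OnRim.step {n : ℕ} {e : Ed} (he : e ∈ rim n) (h : OnRim n (tl e)) : OnRim n (hd e) := by
  obtain ⟨γ, hγ, h⟩ := h
  refine ⟨symmDiff γ {e}, ?_, ?_⟩
  · intro f hf
    rw [Finset.mem_symmDiff, Finset.mem_singleton] at hf
    rcases hf with hf | hf
    · exact hγ hf.1
    · exact hf.1 ▸ he
  · rw [bdy_symmDiff, h, bdy_singleton, Dd_eq, pr_add]

lemma onRim_corner (n : ℕ) : OnRim n (-n, -n) := ⟨∅, by simp, by rw [bdy_empty, pr_self]⟩

lemma onRim_bottom (n k : ℕ) (hk : k ≤ 2 * n) : OnRim n (-n + k, -n) := by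
  induction k with
  | zero => simpa using onRim_corner n
  | succ k ih =>
    have := OnRim.step (e := ((-n + k, -n), false)) (by
      simp only [rim, Finset.mem_union, Finset.mem_image, Finset.mem_range]
      exact Or.inl (Or.inl (Or.inl ⟨k, by omega, rfl⟩))) (ih (by omega))
    simpa [hd, e1, add_assoc] using this

lemma onRim_left (n k : ℕ) (hk : k ≤ 2 * n) : OnRim n (-n, -n + k) := by
  induction k with
  | zero => simpa using onRim_corner n
  | succ k ih =>
    have := OnRim.step (e := ((-n, -n + k), true)) (by
      simp only [rim, Finset.mem_union, Finset.mem_image, Finset.mem_range]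
      exact Or.inl (Or.inr ⟨k, by omega, rfl⟩)) (ih (by omega))
    simpa [hd, e2, add_assoc] using this

lemma onRim_top (n k : ℕ) (hk : k ≤ 2 * n) : OnRim n (-n + k, n) := by
  induction k with
  | zero =>
    have := onRim_left n (2 * n) le_rfl
    convert this using 2
    · simp
    · push_cast; ring
  | succ k ih =>
    have := OnRim.step (e := ((-n + k, n), false)) (by
      simp only [rim, Finset.mem_union, Finset.mem_image, Finset.mem_range]
      exact Or.inl (Or.inl (Or.inr ⟨k, by omega, rfl⟩))) (ih (by omega))
    simpa [hd, e1, add_assoc] using this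

lemma onRim_right (n k : ℕ) (hk : k ≤ 2 * n) : OnRim n (n, -n + k) := by
  induction k with
  | zero =>
    have := onRim_bottom n (2 * n) le_rfl
    convert this using 2
    · push_cast; ring
    · simp
  | succ k ih =>
    have := OnRim.step (e := ((n, -n + k), true)) (by
      simp only [rim, Finset.mem_union, Finset.mem_image, Finset.mem_range]
      exact Or.inr ⟨k, by omega, rfl⟩) (ih (by omega))
    simpa [hd, e2, add_assoc] using this

lemma onRim_of {n : ℕ} {v : V} (h1 : |v.1| ≤ n) (h2 : |v.2| ≤ n)
    (h : ¬ (|v.1| < n ∧ |v.2| < n)) : OnRim n v := by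
  obtain ⟨i, j⟩ := v
  simp only at h1 h2 h
  rw [abs_le] at h1 h2
  rw [abs_lt, abs_lt] at h
  have hc : i = -n ∨ i = n ∨ j = -n ∨ j = n := by omega
  rcases hc with rfl | rfl | rfl | rfl
  · have := onRim_left n (j + n).toNat (by omega)
    rwa [show (-n : ℤ) + (j + n).toNat = j by omega] at this
  · have := onRim_right n (j + n).toNat (by omega)
    rwa [show (-n : ℤ) + (j + n).toNat = j by omega] at this
  · have := onRim_bottom n (i + n).toNat (by omega)
    rwa [show (-n : ℤ) + (i + n).toNat = i by omega] at this
  · have := onRim_top n (i + n).toNat (by omega)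
    rwa [show (-n : ℤ) + (i + n).toNat = i by omega] at this

lemma exists_rim_sum {n : ℕ} (S : Finset V) (hS : ∀ v ∈ S, OnRim n v) :
    ∃ γ ⊆ rim n, bdy Dd γ = ∑ v ∈ S, pr (-n, -n) v := by
  induction S using Finset.induction_on with
  | empty => exact ⟨∅, by simp, by simp [bdy_empty]⟩
  | insert v S hv ih =>
    obtain ⟨γ, hγ, h⟩ := ih fun u hu => hS u (Finset.mem_insert_of_mem hu)
    obtain ⟨γ', hγ', h'⟩ := hS v (Finset.mem_insert_self v S)
    refine ⟨symmDiff γ' γ, ?_, ?_⟩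
    · intro f hf
      rw [Finset.mem_symmDiff] at hf
      rcases hf with hf | hf
      · exact hγ' hf.1
      · exact hγ hf.1
    · rw [bdy_symmDiff, h, h', Finset.sum_insert hv]

lemma chi_box_bdy {n : ℕ} {η : Finset Ed} (hη : η ⊆ bx n) :
    chi (Finset.Icc (-n : ℤ) n ×ˢ Finset.Icc (-n : ℤ) n) (bdy Dd η) = 1 := by
  unfold bdy
  rw [chi_sum]
  apply Finset.prod_eq_one
  intro e he
  have h := mem_bx.1 (hη he)
  have hh : hd e ∈ Finset.Icc (-n : ℤ) n ×ˢ Finset.Icc (-n : ℤ) n := by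
    obtain ⟨⟨i, j⟩, s⟩ := e
    cases s <;> simp [tl, hd, e1, e2] at h ⊢ <;> omega
  have ht : tl e ∈ Finset.Icc (-n : ℤ) n ×ˢ Finset.Icc (-n : ℤ) n := by
    simp only [Finset.mem_product, Finset.mem_Icc]; exact ⟨h.1, h.2.1⟩
  unfold Dd
  rw [chi_add, chi_single, chi_single, if_pos ht, if_pos hh]
  norm_num

lemma exists_rim {n : ℕ} {ξ : Finset Ed} (hξ : ξ ⊆ bx n)
    (h : ∀ v : V, |v.1| < n → |v.2| < n → bdy Dd ξ v = 0) :
    ∃ γ ⊆ rim n, bdy Dd γ = bdy Dd ξ := by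
  classical
  set B : Finset V := Finset.Icc (-n : ℤ) n ×ˢ Finset.Icc (-n : ℤ) n with hB
  have hout : ∀ v ∉ B, bdy Dd ξ v = 0 := by
    intro v hv
    unfold bdy
    rw [Finset.sum_apply]
    refine Finset.sum_eq_zero fun e he => ?_
    have hb := mem_bx.1 (hξ he)
    have h1 : v ≠ tl e := by
      rintro rfl
      apply hv
      simp only [hB, Finset.mem_product, Finset.mem_Icc]; exact ⟨hb.1, hb.2.1⟩
    have h2 : v ≠ hd e := by
      rintro rfl
      apply hv
      obtain ⟨⟨i, j⟩, s⟩ := e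
      cases s <;> simp [hB, tl, hd, e1, e2] at hb ⊢ <;> omega
    simp [Dd, h1, h2]
  set S := B.filter fun v => bdy Dd ξ v = 1 with hS
  have hrim : ∀ v ∈ S, OnRim n v := by
    intro v hv
    rw [hS, Finset.mem_filter, hB, Finset.mem_product, Finset.mem_Icc, Finset.mem_Icc] at hv
    refine onRim_of (abs_le.2 hv.1.1) (abs_le.2 hv.1.2) fun hc => ?_
    rw [h v hc.1 hc.2] at hv
    exact absurd hv.2 (by decide)
  obtain ⟨γ, hγ, hb⟩ := exists_rim_sum S hrim
  refine ⟨γ, hγ, ?_⟩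
  have hsum : ∑ v ∈ S, (Pi.single v 1 : V → ZMod 2) = bdy Dd ξ := by
    funext u
    rw [Finset.sum_apply]
    simp only [Pi.single_apply, Finset.sum_ite_eq, hS, Finset.mem_filter]
    by_cases hu : u ∈ B
    · rcases zmod2_cases (bdy Dd ξ u) with h0 | h0 <;> simp [hu, h0]
    · simp [hu, hout u hu]
  have hb2 : bdy Dd γ = (∑ v ∈ S, Pi.single ((-n, -n) : V) 1) + bdy Dd ξ := by
    rw [hb, ← hsum, ← Finset.sum_add_distrib]; rfl
  rw [Finset.sum_const, ← Pi.single_smul, nsmul_eq_mul, mul_one] at hb2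
  rcases zmod2_cases (S.card : ZMod 2) with h0 | h0
  · rw [h0] at hb2; simpa using hb2
  · exfalso
    have c1 := chi_box_bdy (hγ.trans (rim_subset n))
    have hm : ((-n, -n) : V) ∈ Finset.Icc (-n : ℤ) n ×ˢ Finset.Icc (-n : ℤ) n := by
      simp
    rw [hb2, h0, chi_add, chi_box_bdy hξ, chi_single, if_pos hm] at c1
    norm_num at c1

/-! ### Boundary conditions do not matter -/

lemma bx_eq (n : ℕ) : bx n =
    (Finset.Icc (-n : ℤ) (n - 1) ×ˢ Finset.Icc (-n : ℤ) n) ×ˢ {false} ∪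
    (Finset.Icc (-n : ℤ) n ×ˢ Finset.Icc (-n : ℤ) (n - 1)) ×ˢ {true} := by
  ext ⟨⟨i, j⟩, s⟩
  rw [mem_bx]
  cases s <;> simp [tl, hd, e1, e2] <;> omega

lemma sum_bx (n : ℕ) (c : Bool → ℝ) :
    ∑ e ∈ bx n, c e.2 = (2 * n * (2 * n + 1)) * (c false + c true) := by
  rw [bx_eq, Finset.sum_union, Finset.sum_product (t := {false}), Finset.sum_product (t := {true})]
  · simp only [Finset.sum_singleton, Finset.sum_const, Finset.card_product, Int.card_Icc,
      nsmul_eq_mul]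
    rw [show ((n : ℤ) - 1 + 1 - -n).toNat = 2 * n by omega,
      show ((n : ℤ) + 1 - -n).toNat = 2 * n + 1 by omega]
    push_cast
    ring
  · rw [Finset.disjoint_left]
    rintro ⟨v, s⟩ h1 h2
    simp only [Finset.mem_product, Finset.mem_singleton] at h1 h2
    rw [h1.2] at h2
    exact absurd h2.2 (by decide)

section
variable {b : ℝ} {ρ : ℕ → Finset Ed → ℝ}

lemma energy_le_ph {b : ℝ} (hb : 0 < b) (hb1 : b ≠ 1) {n : ℕ} {e : Ed} (he : e ∈ bx n) :
    energy b ≤ ph (xb b) (bx n) 0 0 (Pi.single e 1) := by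
  have h0 := one_le_Zw_zero Dd (fun _ => xb b) (fun _ => (xb_pos hb).le) (bx n)
  have h := Zw_wgt_step (x := xb b) rfl (xb_mul b) he 0 0
  have h1 := Dw_le_free (xb_pos hb) (xb_lt_one hb).le n {e}
  rw [bdy_singleton, st_edge hb isBdry_rho0, free_edge hb hb1] at h1
  simp only [zero_add, Pi.zero_apply, sg_zero, one_mul] at h
  rw [wgt_zero] at h
  unfold Dw at h1
  rw [h, sub_div, mul_div_assoc, div_self (by linarith), mul_one, mul_div_assoc] at h1
  unfold ph
  rw [add_zero]
  have : b * energy b ≤ b * (Zw Dd (wgt (xb b) (Pi.single e 1)) (bx n) 0 /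
    Zw Dd (fun _ => xb b) (bx n) 0) := by linarith
  exact le_of_mul_le_mul_left this hb

lemma two_energy_le (hb : 0 < b) (hρ : IsBdry ρ)
    (hc : ∀ n, ∀ e ∈ bx n, ps (xb b) ρ 0 (Pi.single e 1) n = st (xb b) ρ 0 (Pi.single e 1))
    {b' : ℝ} (hb' : 0 < b') (hbb : b' < b) (hb1 : b' ≠ 1) :
    2 * energy b' ≤ st (xb b) ρ 0 (Pi.single (0, false) 1) +
      st (xb b) ρ 0 (Pi.single (0, true) 1) := by
  set s := st (xb b) ρ 0 (Pi.single (0, false) 1) + st (xb b) ρ 0 (Pi.single (0, true) 1) with hs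
  have hx0 := xb_pos hb
  have hxx := xb_anti hb' hbb
  set r := Real.log (xb b' / xb b) with hr
  have hr0 : 0 < r := Real.log_pos ((one_lt_div hx0).2 hxx)
  have hxr : xb b * Real.exp r = xb b' := by
    rw [hr, Real.exp_log (div_pos (xb_pos hb') hx0), mul_div_cancel₀ _ hx0.ne']
  set L := -Real.log (xb b) with hL
  have hL0 : 0 ≤ L := neg_nonneg.2 (Real.log_nonpos hx0.le (xb_lt_one hb).le)
  have main : ∀ n : ℕ, (2 * n * (2 * n + 1)) * (2 * energy b') - 16 * n * L / r ≤
      (2 * n * (2 * n + 1)) * s := by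
    intro n
    have h1 : (2 * n * (2 * n + 1)) * s = ∑ e ∈ bx n, ps (xb b) ρ 0 (Pi.single e 1) n := by
      rw [hs, ← sum_bx n fun t => st (xb b) ρ 0 (Pi.single (0, t) 1)]
      refine Finset.sum_congr rfl fun e he => ?_
      rw [hc n e he, ← st_edge_const hb hρ e.1 e.2]
    rw [h1]
    unfold ps
    rw [Finset.sum_comm]
    set K := (2 * n * (2 * n + 1)) * (2 * energy b') - 16 * n * L / r
    have hK : K = ∑ ξ ∈ (bx n).powerset, ρ n ξ * K := by
      rw [← Finset.sum_mul, hρ.total, one_mul]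
    rw [hK]
    refine Finset.sum_le_sum fun ξ hξ => ?_
    rw [← Finset.mul_sum]
    rcases eq_or_ne (ρ n ξ) 0 with h0 | h0
    · simp [h0]
    refine mul_le_mul_of_nonneg_left ?_ (hρ.nonneg n ξ)
    obtain ⟨γ, hγ, hγb⟩ := exists_rim (Finset.mem_powerset.1 hξ)
      (hρ.source n ξ (Finset.mem_powerset.1 hξ) h0)
    rw [← hγb]
    refine le_trans ?_ (sum_ph_single_ge hx0 hr0 (by rw [hxr]; exact (xb_lt_one hb').le)
      (hγ.trans (rim_subset n)))
    rw [hxr]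
    have h2 : (2 * n * (2 * n + 1)) * (2 * energy b') ≤
        ∑ e ∈ bx n, ph (xb b') (bx n) 0 0 (Pi.single e 1) := by
      rw [two_mul (energy b'), ← sum_bx n fun _ => energy b']
      exact Finset.sum_le_sum fun e he => energy_le_ph hb' hb1 he
    have h3 : (γ.card : ℝ) ≤ 8 * n := by
      exact_mod_cast (Finset.card_le_card hγ).trans (card_rim_le n)
    have h4 : 2 * (γ.card : ℝ) * L / r ≤ 16 * n * L / r := by
      apply div_le_div_of_nonneg_right _ hr0.le
      apply mul_le_mul_of_nonneg_right _ hL0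
      linarith
    linarith
  by_contra hlt
  push Not at hlt
  obtain ⟨n, hn⟩ := exists_nat_gt (16 * L / r / (2 * energy b' - s))
  have hpos : 0 < 2 * energy b' - s := by linarith
  rw [div_lt_iff₀ hpos] at hn
  have hm := main (n + 1)
  push_cast at hm
  have h5 : 16 * ((n : ℝ) + 1) * L / r = (n + 1) * (16 * L / r) := by ring
  rw [h5] at hm
  have h6 : ((n : ℝ) + 1) * (16 * L / r) < (n + 1) * (n * (2 * energy b' - s)) :=
    mul_lt_mul_of_pos_left hn (by positivity)
  nlinarith [mul_pos (show 0 < (n : ℝ) + 1 by positivity) hpos,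
    mul_nonneg (mul_nonneg (show 0 ≤ (n : ℝ) + 1 by positivity) (Nat.cast_nonneg n : 0 ≤ (n : ℝ))) hpos.le]

/-- Any boundary condition for which finite-volume single-edge correlations are consistent gives
the same correlations as the free one. -/
theorem st_edge_eq_free (hb : 0 < b) (hρ : IsBdry ρ)
    (hc : ∀ n, ∀ e ∈ bx n, ps (xb b) ρ 0 (Pi.single e 1) n = st (xb b) ρ 0 (Pi.single e 1))
    (e : Ed) : st (xb b) ρ (Dd e) 0 = st (xb b) rho0 (Dd e) 0 := by
  set g : ℝ → ℝ := fun t => Real.sqrt (1 + t ^ 2) - t * energy t with hg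
  have hgc : ContinuousAt g b := by
    have := energy_continuousAt hb
    exact ContinuousAt.sub (by fun_prop) (continuousAt_id.mul this)
  have hne : ∀ᶠ t in nhdsWithin b {b}ᶜ, t ≠ 1 := by
    rcases eq_or_ne b 1 with rfl | h1
    · exact eventually_mem_nhdsWithin
    · exact nhdsWithin_le_nhds (isOpen_ne.mem_nhds h1)
  have lower : ∀ {ρ}, IsBdry ρ → ∀ e, g b ≤ st (xb b) ρ (Dd e) 0 := by
    intro ρ hρ e
    have ht : Filter.Tendsto g (nhdsWithin b (Set.Ioi b)) (nhds (g b)) := hgc.mono_left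
      nhdsWithin_le_nhds
    refine le_of_tendsto ht ?_
    filter_upwards [eventually_mem_nhdsWithin,
      hne.filter_mono (nhdsWithin_mono b fun t (ht : b < t) => ht.ne')] with t h1 h2
    exact free_edge_le hb h1 h2 hρ e
  have upper : 2 * energy b ≤ st (xb b) ρ 0 (Pi.single (0, false) 1) +
      st (xb b) ρ 0 (Pi.single (0, true) 1) := by
    have ht : Filter.Tendsto (fun t => 2 * energy t) (nhdsWithin b (Set.Iio b))
        (nhds (2 * energy b)) :=
      ((energy_continuousAt hb).const_mul 2).mono_left nhdsWithin_le_nhds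
    refine le_of_tendsto ht ?_
    filter_upwards [eventually_mem_nhdsWithin,
      hne.filter_mono (nhdsWithin_mono b fun t (ht : t < b) => ht.ne),
      nhdsWithin_le_nhds (Ioi_mem_nhds hb)] with t h1 h2 h3
    exact two_energy_le hb hρ hc h3 h1 h2
  have hub : ∀ e, st (xb b) ρ (Dd e) 0 ≤ g b := by
    have k1 := lower hρ (0, false)
    have k2 := lower hρ (0, true)
    rw [st_edge hb hρ] at k1 k2
    simp only [hg] at k1 k2
    rintro ⟨d, s⟩
    rw [st_edge hb hρ, st_edge_const hb hρ]
    simp only [hg]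
    cases s <;> nlinarith
  refine le_antisymm ((hub e).trans (lower isBdry_rho0 e)) ?_
  rw [← bdy_singleton Dd e]
  exact free_le_st (xb_pos hb) (xb_lt_one hb).le hρ {e}

end

/-! ### Edge coordinates -/

/-- The edge with given coordinates. -/
def toE (e : Ed) : Edge := incEdge e.1 (if e.2 then 2 else 0)

lemma toE_val (e : Ed) : (toE e).1 = s(tl e, hd e) := by
  obtain ⟨v, s⟩ := e
  cases s <;> rfl

lemma toE_injective : Function.Injective toE := by
  rintro ⟨⟨i, j⟩, s⟩ ⟨⟨k, l⟩, t⟩ h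
  have h' := congrArg Subtype.val h
  rw [toE_val, toE_val, Sym2.eq_iff] at h'
  cases s <;> cases t <;> simp [tl, hd, e1, e2] at h' ⊢ <;> omega

lemma incEdge_one (v : V) : incEdge v 1 = toE (v - e1, false) := by
  apply Subtype.ext
  rw [toE_val]
  have : v + dir 1 = v - e1 := by simp [dir, e1, sub_eq_add_neg]
  simp only [incEdge, this, tl, hd]
  rw [Sym2.eq_swap]; simp

lemma incEdge_three (v : V) : incEdge v 3 = toE (v - e2, true) := by
  apply Subtype.ext
  rw [toE_val]
  have : v + dir 3 = v - e2 := by simp [dir, e2, sub_eq_add_neg]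
  simp only [incEdge, this, tl, hd]
  rw [Sym2.eq_swap]; simp

lemma incEdge_zero (v : V) : incEdge v 0 = toE (v, false) := rfl

lemma incEdge_two (v : V) : incEdge v 2 = toE (v, true) := rfl

lemma toE_surjective : Function.Surjective toE := by
  rintro ⟨_, ⟨x, y, h, rfl⟩⟩
  have : ∃ d : Fin 4, y = x + dir d := by
    obtain ⟨i, j⟩ := x
    obtain ⟨k, l⟩ := y
    simp only [latAdj] at h
    have hc : (k = i + 1 ∧ l = j) ∨ (k = i + -1 ∧ l = j) ∨ (k = i ∧ l = j + 1) ∨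
        (k = i ∧ l = j + -1) := by
      rcases abs_cases (i - k) with h1 | h1 <;> rcases abs_cases (j - l) with h2 | h2 <;> omega
    rcases hc with ⟨rfl, rfl⟩ | ⟨rfl, rfl⟩ | ⟨rfl, rfl⟩ | ⟨rfl, rfl⟩
    · exact ⟨0, by simp [dir]⟩
    · exact ⟨1, by simp [dir]⟩
    · exact ⟨2, by simp [dir]⟩
    · exact ⟨3, by simp [dir]⟩
  obtain ⟨d, rfl⟩ := this
  change ∃ a, toE a = incEdge x d
  fin_cases d
  · exact ⟨(x, false), rfl⟩
  · exact ⟨_, (incEdge_one x).symm⟩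
  · exact ⟨(x, true), rfl⟩
  · exact ⟨_, (incEdge_three x).symm⟩

/-- The open edges of a configuration inside a finite set. -/
def tr (Λ : Finset Ed) (ω : Config) : Finset Ed := Λ.filter fun e => ω (toE e) = true

lemma tr_subset (Λ : Finset Ed) (ω : Config) : tr Λ ω ⊆ Λ := Finset.filter_subset _ _

/-- Indicator with values modulo two. -/
def ind (P : Prop) [Decidable P] : ZMod 2 := if P then 1 else 0

lemma bdy_apply (ξ : Finset Ed) (v : V) : bdy Dd ξ v = ind ((v, false) ∈ ξ) +
    ind ((v - e1, false) ∈ ξ) + ind ((v, true) ∈ ξ) + ind ((v - e2, true) ∈ ξ) := by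
  have h : ∀ e : Ed, Dd e v = (if e = (v, false) then 1 else 0) +
      (if e = (v - e1, false) then 1 else 0) + (if e = (v, true) then 1 else 0) +
      (if e = (v - e2, true) then 1 else 0) := by
    rintro ⟨u, s⟩
    simp only [Dd, tl, hd, Pi.add_apply, Pi.single_apply, Prod.mk.injEq]
    cases s <;> simp [eq_sub_iff_add_eq, eq_comm] <;> ring
  unfold bdy
  rw [Finset.sum_apply]
  simp only [h, Finset.sum_add_distrib, Finset.sum_ite_eq', ind]

/-- Parity of the degree. -/
def par (ω : Config) (v : V) : ZMod 2 := ind (ω (toE (v, false)) = true) +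
    ind (ω (toE (v - e1, false)) = true) + ind (ω (toE (v, true)) = true) +
    ind (ω (toE (v - e2, true)) = true)

lemma degEven_iff (ω : Config) (v : V) : degEven ω v ↔ par ω v = 0 := by
  unfold degEven
  rw [← ZMod.natCast_eq_zero_iff_even, Finset.natCast_card_filter, Fin.sum_univ_four,
    incEdge_zero, incEdge_one, incEdge_two, incEdge_three]
  rfl

lemma bdy_tr_eq_par {Λ : Finset Ed} {v : V} (h1 : (v, false) ∈ Λ) (h2 : (v - e1, false) ∈ Λ)
    (h3 : (v, true) ∈ Λ) (h4 : (v - e2, true) ∈ Λ) (ω : Config) :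
    bdy Dd (tr Λ ω) v = par ω v := by
  rw [bdy_apply]
  simp only [tr, Finset.mem_filter, h1, h2, h3, h4, true_and, par]

/-- Finite sets of edges, in both descriptions. -/
def toEs (Λ : Finset Ed) : Finset Edge := Λ.map ⟨toE, toE_injective⟩

lemma mem_toEs {Λ : Finset Ed} {e : Ed} : toE e ∈ toEs Λ ↔ e ∈ Λ := by
  simp [toEs, toE_injective.eq_iff]

/-- The set of open edges of a local configuration. -/
def lset (Λ : Finset Ed) (η : ↥(toEs Λ) → Bool) : Finset Ed :=
  Λ.attach.filter (fun e => η ⟨toE e.1, mem_toEs.2 e.2⟩ = true) |>.map (Function.Embedding.subtype _)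

lemma mem_lset {Λ : Finset Ed} {η : ↥(toEs Λ) → Bool} {e : Ed} :
    e ∈ lset Λ η ↔ ∃ h : e ∈ Λ, η ⟨toE e, mem_toEs.2 h⟩ = true := by
  simp [lset]

lemma lset_subset (Λ : Finset Ed) (η : ↥(toEs Λ) → Bool) : lset Λ η ⊆ Λ := by
  intro e he
  exact (mem_lset.1 he).1

lemma patch_toE (Λ : Finset Ed) (η : ↥(toEs Λ) → Bool) (ω : Config) (e : Ed) :
    patch (toEs Λ) η ω (toE e) = true ↔ (e ∈ lset Λ η ∨ e ∉ Λ ∧ ω (toE e) = true) := by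
  unfold patch
  by_cases h : e ∈ Λ
  · simp [mem_toEs, h, mem_lset]
  · simp [mem_toEs, h, mem_lset]

lemma tr_patch (Λ : Finset Ed) (η : ↥(toEs Λ) → Bool) (ω : Config) :
    tr Λ (patch (toEs Λ) η ω) = lset Λ η := by
  ext e
  simp only [tr, Finset.mem_filter, patch_toE]
  constructor
  · rintro ⟨h, h' | h'⟩
    · exact h'
    · exact absurd h h'.1
  · exact fun h => ⟨lset_subset _ _ h, Or.inl h⟩

lemma ind_patch (Λ : Finset Ed) (η : ↥(toEs Λ) → Bool) (ω : Config) (e : Ed) :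
    ind (patch (toEs Λ) η ω (toE e) = true) =
      ind (ω (toE e) = true) + (ind (e ∈ lset Λ η) + ind (e ∈ tr Λ ω)) := by
  have h2 : (1 : ZMod 2) + 1 = 0 := by decide
  have hp := patch_toE Λ η ω e
  by_cases h : e ∈ Λ
  · by_cases h1 : e ∈ lset Λ η <;> by_cases h3 : ω (toE e) = true <;>
      simp [ind, hp, h1, h, h3, tr, h2]
  · have h1 : e ∉ lset Λ η := fun h' => h (lset_subset _ _ h')
    by_cases h3 : ω (toE e) = true <;> simp [ind, hp, h1, h, h3, tr]

lemma par_patch (Λ : Finset Ed) (η : ↥(toEs Λ) → Bool) (ω : Config) (v : V) :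
    par (patch (toEs Λ) η ω) v = par ω v + (bdy Dd (lset Λ η) v + bdy Dd (tr Λ ω) v) := by
  unfold par
  simp only [ind_patch, bdy_apply]
  ring

lemma patch_mem_iff {Λ : Finset Ed} (η : ↥(toEs Λ) → Bool) {ω : Config} (hω : ω ∈ ΩEP) :
    patch (toEs Λ) η ω ∈ ΩEP ↔ bdy Dd (lset Λ η) = bdy Dd (tr Λ ω) := by
  have h0 : ∀ v, par ω v = 0 := fun v => (degEven_iff ω v).1 (hω v)
  have : patch (toEs Λ) η ω ∈ ΩEP ↔ ∀ v, bdy Dd (lset Λ η) v + bdy Dd (tr Λ ω) v = 0 := by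
    change (∀ v, degEven _ v) ↔ _
    simp only [degEven_iff, par_patch, h0, zero_add]
  rw [this, funext_iff]
  exact forall_congr' fun v => CharTwo.add_eq_zero

lemma numOpen_eq (Λ : Finset Ed) (η : ↥(toEs Λ) → Bool) : numOpen η = (lset Λ η).card := by
  unfold numOpen lset
  rw [Finset.card_map]
  symm
  refine Finset.card_bij (fun e _ => ⟨toE e.1, mem_toEs.2 e.2⟩) ?_ ?_ ?_
  · intro e he
    simpa using he
  · intro e _ f _ h
    exact Subtype.ext (toE_injective (congrArg Subtype.val h))
  · rintro ⟨f, hf⟩ h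
    obtain ⟨e, rfl⟩ := toE_surjective f
    exact ⟨⟨e, mem_toEs.1 hf⟩, by simpa using h, rfl⟩

lemma sum_lset (Λ : Finset Ed) (f : Finset Ed → ℝ) :
    ∑ η : ↥(toEs Λ) → Bool, f (lset Λ η) = ∑ ξ ∈ Λ.powerset, f ξ := by
  classical
  refine Finset.sum_bij (fun η _ => lset Λ η) ?_ ?_ ?_ ?_
  · intro η _
    exact Finset.mem_powerset.2 (lset_subset _ _)
  · intro η _ η' _ h
    funext ⟨f, hf⟩
    obtain ⟨e, rfl⟩ := toE_surjective f
    have he := mem_toEs.1 hf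
    have := Finset.ext_iff.1 h e
    simp only [mem_lset, he, exists_true_left] at this
    exact Bool.eq_iff_iff.2 this
  · intro ξ hξ
    rw [Finset.mem_powerset] at hξ
    refine ⟨fun f => decide (f.1 ∈ toEs ξ), Finset.mem_univ _, ?_⟩
    ext e
    simp only [mem_lset, decide_eq_true_eq, mem_toEs]
    exact ⟨fun h => h.2, fun h => ⟨hξ h, h⟩⟩
  · intro η _
    rfl

/-- Conditional mean of a local observable given the sources. -/
def cmean (x : ℝ) (Λ : Finset Ed) (F : Finset Ed → ℝ) (A : V → ZMod 2) : ℝ :=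
  open Classical in
  (∑ η ∈ Λ.powerset, if bdy Dd η = A then F η * x ^ η.card else 0) / Zw Dd (fun _ => x) Λ A

lemma Mop_tr (p : ℝ) (Λ : Finset Ed) (F : Finset Ed → ℝ) {ω : Config} (hω : ω ∈ ΩEP) :
    open Classical in
    Mop p (toEs Λ) (fun ω => F (tr Λ ω)) ω =
      ∑ η ∈ Λ.powerset, if bdy Dd η = bdy Dd (tr Λ ω) then F η * qratio p ^ η.card else 0 := by
  classical
  rw [← sum_lset]
  unfold Mop
  refine Finset.sum_congr rfl fun η _ => ?_
  simp only [patch_mem_iff η hω, tr_patch, numOpen_eq]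

lemma muOp_tr (p : ℝ) (Λ : Finset Ed) (F : Finset Ed → ℝ) {ω : Config} (hω : ω ∈ ΩEP) :
    muOp p (toEs Λ) (fun ω => F (tr Λ ω)) ω = cmean (qratio p) Λ F (bdy Dd (tr Λ ω)) := by
  unfold muOp cmean
  rw [Mop_tr p Λ F hω, Mop_tr p Λ (fun _ => 1) hω]
  congr 1
  unfold Zw
  refine Finset.sum_congr rfl fun η _ => ?_
  simp only [one_mul, Finset.prod_const]

lemma tr_eq_restrict (Λ : Finset Ed) (ω : Config) : tr Λ ω = lset Λ fun e => ω e := by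
  ext e
  simp [tr, mem_lset]

lemma continuous_tr (Λ : Finset Ed) (F : Finset Ed → ℝ) : Continuous fun ω => F (tr Λ ω) := by
  have h1 : Continuous fun η : ↥(toEs Λ) → Bool => F (lset Λ η) := continuous_of_discreteTopology
  have h2 : Continuous fun ω : Config => fun e : ↥(toEs Λ) => ω e :=
    continuous_pi fun e => continuous_apply _
  simpa only [tr_eq_restrict, Function.comp_def] using h1.comp h2

lemma measurableSet_tr (Λ : Finset Ed) (S : Set (Finset Ed)) : MeasurableSet {ω | tr Λ ω ∈ S} := by
  have h2 : Measurable fun ω : Config => fun e : ↥(toEs Λ) => ω e :=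
    measurable_pi_lambda _ fun e => measurable_pi_apply _
  have h3 := h2 (Set.Finite.measurableSet (Set.toFinite {η | lset Λ η ∈ S}))
  simp only [tr_eq_restrict]
  exact h3

/-- The law of the configuration inside a finite set. -/
def law (m : Measure Config) (Λ : Finset Ed) (ξ : Finset Ed) : ℝ := m.real {ω | tr Λ ω = ξ}

lemma integral_tr (m : Measure Config) [IsProbabilityMeasure m] (Λ : Finset Ed)
    (F : Finset Ed → ℝ) : ∫ ω, F (tr Λ ω) ∂m = ∑ ξ ∈ Λ.powerset, law m Λ ξ * F ξ := by
  have h : ∀ ω, F (tr Λ ω) = ∑ ξ ∈ Λ.powerset, {ω | tr Λ ω = ξ}.indicator (fun _ => F ξ) ω := by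
    intro ω
    rw [Finset.sum_eq_single (tr Λ ω)]
    · simp
    · intro ξ _ hξ
      exact Set.indicator_of_notMem (fun h => hξ h.symm) _
    · intro h
      exact absurd (Finset.mem_powerset.2 (tr_subset Λ ω)) h
  simp_rw [h]
  have hm : ∀ ξ, MeasurableSet {ω | tr Λ ω = ξ} := fun ξ => measurableSet_tr Λ {ξ}
  rw [integral_finsetSum]
  · refine Finset.sum_congr rfl fun ξ _ => ?_
    rw [integral_indicator_const _ (hm ξ)]
    rfl
  · intro ξ _
    exact (integrable_const _).indicator (hm ξ)

lemma gibbs_ae {p : ℝ} {m : Measure Config} (hm : IsGibbsEP p m) : ∀ᵐ ω ∂m, ω ∈ ΩEP := by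
  have := hm.1
  have hms : MeasurableSet ΩEP := by
    have : ΩEP = ⋂ v : V, {ω | par ω v = 0} := by
      ext ω
      simp only [ΩEP, Set.mem_ofPred_eq, degEven_iff, Set.mem_iInter]
    rw [this]
    refine MeasurableSet.iInter fun v => ?_
    have h := measurableSet_tr {(v, false), (v - e1, false), (v, true), (v - e2, true)}
      {ξ | bdy Dd ξ v = 0}
    convert h using 3 with ω
    simp only [Set.mem_ofPred_eq]
    rw [bdy_tr_eq_par] <;> simp
  exact (prob_compl_eq_zero_iff hms).2 hm.2.1

theorem gibbs_dlr {p : ℝ} {m : Measure Config} (hm : IsGibbsEP p m) (Λ : Finset Ed)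
    (F : Finset Ed → ℝ) : ∑ ξ ∈ Λ.powerset, law m Λ ξ * cmean (qratio p) Λ F (bdy Dd ξ) =
      ∫ ω, F (tr Λ ω) ∂m := by
  have := hm.1
  rw [hm.2.2 _ (continuous_tr Λ F) (toEs Λ), ← integral_tr m Λ fun ξ =>
    cmean (qratio p) Λ F (bdy Dd ξ)]
  refine integral_congr_ae ?_
  filter_upwards [gibbs_ae hm] with ω hω
  exact (muOp_tr p Λ F hω).symm

lemma isBdry_law {p : ℝ} {m : Measure Config} (hm : IsGibbsEP p m) :
    IsBdry fun n => law m (bx n) where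
  nonneg n ξ := measureReal_nonneg
  total n := by
    have := hm.1
    have h := integral_tr m (bx n) fun _ => 1
    simp only [mul_one] at h
    rw [← h]; simp
  source n ξ _ h v h1 h2 := by
    have hne : m {ω | tr (bx n) ω = ξ} ≠ 0 := fun h0 => h (by simp [law, measureReal_def, h0])
    obtain ⟨ω, hω1, hω2⟩ : ∃ ω, tr (bx n) ω = ξ ∧ ω ∈ ΩEP := by
      by_contra hc
      push Not at hc
      apply hne
      refine measure_mono_null (t := ΩEPᶜ) (fun ω hω => hc ω hω) (gibbs_ae hm)
    rw [← hω1, ← (degEven_iff ω v).1 (hω2 v)]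
    obtain ⟨i, j⟩ := v
    rw [abs_lt] at h1 h2
    simp only at h1 h2
    apply bdy_tr_eq_par <;> rw [mem_bx] <;> simp [tl, hd, e1, e2] <;> omega

lemma ph_single_eq_cmean (x : ℝ) (Λ : Finset Ed) (A : V → ZMod 2) (e : Ed) :
    ph x Λ A 0 (Pi.single e 1) = cmean x Λ (fun η => if e ∈ η then -1 else 1) A := by
  unfold ph cmean
  rw [add_zero]
  congr 1
  unfold Zw
  refine Finset.sum_congr rfl fun η _ => ?_
  split_ifs <;> simp_all [prod_wgt_single]

/-- The change of weight caused by toggling an edge. -/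
def tog (x : ℝ) (t : Bool) : ℝ := if t then x⁻¹ else x

lemma pow_card_symmDiff {x : ℝ} (hx : x ≠ 0) (η γ : Finset Ed) :
    x ^ (symmDiff η γ).card = (∏ e ∈ γ, if e ∈ η then x⁻¹ else x) * x ^ η.card := by
  induction γ using Finset.induction_on generalizing η with
  | empty =>
    have h : symmDiff η ∅ = η := symmDiff_bot η
    simp [h]
  | insert e γ he ih =>
    have h1 : symmDiff η (insert e γ) = symmDiff (symmDiff η {e}) γ := by
      rw [symmDiff_assoc]
      congr 1
      ext f
      simp only [Finset.mem_insert, Finset.mem_symmDiff, Finset.mem_singleton]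
      constructor
      · rintro (rfl | h)
        · exact Or.inl ⟨rfl, he⟩
        · exact Or.inr ⟨h, fun h' => he (h' ▸ h)⟩
      · rintro (⟨h, _⟩ | ⟨h, _⟩)
        · exact Or.inl h
        · exact Or.inr h
    rw [h1, ih, Finset.prod_insert he, mul_comm (if e ∈ η then x⁻¹ else x), mul_assoc]
    congr 1
    · refine Finset.prod_congr rfl fun f hf => ?_
      have hfe : f ≠ e := fun h => he (h ▸ hf)
      simp [Finset.mem_symmDiff, hfe]
    · by_cases h : e ∈ η
      · have : symmDiff η {e} = η.erase e := by
          ext f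
          simp only [Finset.mem_symmDiff, Finset.mem_singleton, Finset.mem_erase]
          constructor
          · rintro (h' | ⟨rfl, h'⟩)
            · exact ⟨h'.2, h'.1⟩
            · exact absurd h h'
          · exact fun h' => Or.inl ⟨h'.2, h'.1⟩
        rw [this, if_pos h, ← Finset.card_erase_add_one h, pow_succ]
        field_simp
      · have : symmDiff η {e} = insert e η := by
          ext f
          simp only [Finset.mem_symmDiff, Finset.mem_singleton, Finset.mem_insert]
          constructor
          · rintro (h' | h')
            · exact Or.inr h'.1
            · exact Or.inl h'.1
          · rintro (rfl | h')
            · exact Or.inr ⟨rfl, h⟩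
            · exact Or.inl ⟨h', fun h'' => h (h'' ▸ h')⟩
        rw [this, if_neg h, Finset.card_insert_of_notMem h, pow_succ, mul_comm]

lemma ph_bdy_eq_cmean {x : ℝ} (hx : x ≠ 0) {Λ γ : Finset Ed} (hγ : γ ⊆ Λ) (A : V → ZMod 2) :
    ph x Λ A (bdy Dd γ) 0 = cmean x Λ (fun η => ∏ e ∈ γ, if e ∈ η then x⁻¹ else x) A := by
  classical
  unfold ph cmean
  congr 1
  unfold Zw
  rw [← sum_powerset_symmDiff Λ γ hγ]
  refine Finset.sum_congr rfl fun η _ => ?_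
  rw [wgt_zero, Finset.prod_const, pow_card_symmDiff hx, bdy_symmDiff]
  simp only [add_left_inj]

section
variable {p : ℝ} {m : Measure Config}

lemma ps_single_law (hm : IsGibbsEP p m) {n : ℕ} {e : Ed} (he : e ∈ bx n) :
    ps (qratio p) (fun n => law m (bx n)) 0 (Pi.single e 1) n =
      ∫ ω, (if ω (toE e) = true then -1 else 1) ∂m := by
  unfold ps
  simp only [ph_single_eq_cmean]
  rw [gibbs_dlr hm]
  simp [tr, he]

lemma ps_bdy_law (hm : IsGibbsEP p m) (hx : qratio p ≠ 0) {n : ℕ} {γ : Finset Ed}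
    (hγ : γ ⊆ bx n) : ps (qratio p) (fun n => law m (bx n)) (bdy Dd γ) 0 n =
      ∫ ω, ∏ e ∈ γ, tog (qratio p) (ω (toE e)) ∂m := by
  unfold ps
  simp only [ph_bdy_eq_cmean hx hγ]
  rw [gibbs_dlr hm]
  congr 1
  funext ω
  refine Finset.prod_congr rfl fun e he => ?_
  simp [tr, hγ he, tog]

theorem gibbs_integral_tog (hp0 : 0 < p) (hp1 : p < 1 / 2) (hm : IsGibbsEP p m)
    (γ : Finset Ed) : ∫ ω, ∏ e ∈ γ, tog (qratio p) (ω (toE e)) ∂m =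
      st (qratio p) rho0 (bdy Dd γ) 0 := by
  have hx0 : 0 < qratio p := div_pos hp0 (by linarith)
  have hx1 : qratio p < 1 := (div_lt_one (by linarith)).2 (by linarith)
  have hρ := isBdry_law hm
  obtain ⟨b, hb, hxb⟩ := exists_xb hx0 hx1
  have hcons : ∀ n, ∀ e ∈ bx n, ps (qratio p) (fun n => law m (bx n)) 0 (Pi.single e 1) n =
      st (qratio p) (fun n => law m (bx n)) 0 (Pi.single e 1) := by
    intro n e he
    rw [ps_single_law hm he]
    symm
    apply ul_const
    filter_upwards [eventually_mem_bx e] with k hk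
    exact ps_single_law hm hk
  have h1 := st_eq_free hx0 hx1.le hρ (by
    rw [← hxb] at hcons ⊢
    exact st_edge_eq_free hb hρ hcons) γ
  rw [← h1]
  symm
  apply ul_const
  filter_upwards [eventually_subset_bx γ] with k hk
  exact ps_bdy_law hm hx0.ne' hk

end

/-- The event that all edges of a finite set are open. -/
def allOpen (γ : Finset Ed) : Set Config := {ω | ∀ e ∈ γ, ω (toE e) = true}

lemma measurableSet_allOpen (γ : Finset Ed) : MeasurableSet (allOpen γ) := by
  have h : allOpen γ = ⋂ e ∈ γ, (fun ω : Config => ω (toE e)) ⁻¹' {true} := by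
    ext ω
    simp [allOpen]
  rw [h]
  exact γ.measurableSet_biInter fun e _ => measurable_pi_apply (toE e) (measurableSet_singleton _)

lemma ext_of_allOpen {m₁ m₂ : Measure Config} [IsProbabilityMeasure m₁] [IsProbabilityMeasure m₂]
    (h : ∀ γ, m₁ (allOpen γ) = m₂ (allOpen γ)) : m₁ = m₂ := by
  refine ext_of_generate_finite (Set.range allOpen) ?_ ?_ ?_ (by simp)
  · refine le_antisymm ?_ ?_
    · refine iSup_le fun a => ?_
      obtain ⟨e, rfl⟩ := toE_surjective a
      rw [MeasurableSpace.comap_le_iff_le_map]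
      refine (measurable_to_bool (mα := MeasurableSpace.generateFrom (Set.range allOpen))
        (f := fun ω : Config => ω (toE e)) ?_).le_map
      refine MeasurableSpace.measurableSet_generateFrom ⟨{e}, ?_⟩
      ext ω
      simp [allOpen]
    · refine MeasurableSpace.generateFrom_le ?_
      rintro _ ⟨γ, rfl⟩
      exact measurableSet_allOpen γ
  · rintro _ ⟨γ, rfl⟩ _ ⟨γ', rfl⟩ _
    refine ⟨γ ∪ γ', ?_⟩
    ext ω
    simp only [allOpen, Set.mem_ofPred_eq, Finset.mem_union, Set.mem_inter_iff]
    exact ⟨fun h => ⟨fun e he => h e (Or.inl he), fun e he => h e (Or.inr he)⟩,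
      fun h e he => he.elim (h.1 e) (h.2 e)⟩
  · rintro _ ⟨γ, rfl⟩
    exact h γ

lemma prod_tog_sub (x : ℝ) (γ : Finset Ed) (ω : Config) :
    ∏ e ∈ γ, (tog x (ω (toE e)) + -x) =
      (x⁻¹ - x) ^ γ.card * (allOpen γ).indicator (fun _ => (1 : ℝ)) ω := by
  by_cases h : ω ∈ allOpen γ
  · rw [Set.indicator_of_mem h, mul_one, ← Finset.prod_const]
    refine Finset.prod_congr rfl fun e he => ?_
    rw [h e he]
    simp [tog, sub_eq_add_neg]
  · rw [Set.indicator_of_notMem h, mul_zero]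
    simp only [allOpen, Set.mem_ofPred_eq, not_forall] at h
    obtain ⟨e, he, hω⟩ := h
    refine Finset.prod_eq_zero he ?_
    simp [tog, hω]

lemma integrable_prod_tog (m : Measure Config) [IsProbabilityMeasure m] (x : ℝ) (γ : Finset Ed) :
    Integrable (fun ω => ∏ e ∈ γ, tog x (ω (toE e))) m := by
  have hc : Continuous fun ω : Config => ∏ e ∈ γ, tog x (ω (toE e)) :=
    continuous_finsetProd _ fun e _ =>
      (continuous_of_discreteTopology (f := tog x)).comp (continuous_apply (toE e))
  exact (BoundedContinuousFunction.mkOfCompact ⟨_, hc⟩).integrable m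

lemma measure_allOpen {p : ℝ} {m : Measure Config} (hp0 : 0 < p) (hp1 : p < 1 / 2)
    (hm : IsGibbsEP p m) (γ : Finset Ed) :
    ((qratio p)⁻¹ - qratio p) ^ γ.card * m.real (allOpen γ) =
      ∑ t ∈ γ.powerset, st (qratio p) rho0 (bdy Dd t) 0 * (-qratio p) ^ (γ \ t).card := by
  have := hm.1
  rw [← integral_indicator_one (measurableSet_allOpen γ), ← integral_const_mul]
  have h1 : ∀ ω : Config, ((qratio p)⁻¹ - qratio p) ^ γ.card *
      (allOpen γ).indicator (1 : Config → ℝ) ω =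
      ∑ t ∈ γ.powerset, (∏ e ∈ t, tog (qratio p) (ω (toE e))) * (-qratio p) ^ (γ \ t).card := by
    intro ω
    have h2 := prod_tog_sub (qratio p) γ ω
    rw [Finset.prod_add] at h2
    simp only [Finset.prod_const] at h2
    exact h2.symm
  simp only [h1]
  rw [integral_finsetSum _ fun t _ => (integrable_prod_tog m _ t).mul_const _]
  refine Finset.sum_congr rfl fun t _ => ?_
  rw [integral_mul_const, gibbs_integral_tog hp0 hp1 hm]

theorem gibbs_unique {p : ℝ} {m₁ m₂ : Measure Config} (hp0 : 0 < p) (hp1 : p < 1 / 2)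
    (h₁ : IsGibbsEP p m₁) (h₂ : IsGibbsEP p m₂) : m₁ = m₂ := by
  have := h₁.1
  have := h₂.1
  have hx0 : 0 < qratio p := div_pos hp0 (by linarith)
  have hx1 : qratio p < 1 := (div_lt_one (by linarith)).2 (by linarith)
  have hne : ((qratio p)⁻¹ - qratio p) ≠ 0 := by
    have := (one_lt_inv₀ hx0).2 hx1
    linarith
  refine ext_of_allOpen fun γ => ?_
  have h := (measure_allOpen hp0 hp1 h₁ γ).trans (measure_allOpen hp0 hp1 h₂ γ).symm
  have h3 := mul_left_cancel₀ (pow_ne_zero _ hne) h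
  exact (measureReal_eq_measureReal_iff (measure_ne_top _ _) (measure_ne_top _ _)).1 h3

/-- The black face of the lattice containing an edge, labelled by its lower left corner. -/
def face (e : Ed) : V :=
  if (e.1.1 + e.1.2) % 2 = 0 then e.1 else if e.2 then e.1 - e1 else e.1 - e2

/-- The black face containing an edge of the lattice. -/
def faceE (e : Edge) : V := face ((Equiv.ofBijective toE ⟨toE_injective, toE_surjective⟩).symm e)

lemma faceE_toE (e : Ed) : faceE (toE e) = face e := by
  unfold faceE
  exact congrArg face (Equiv.ofBijective_symm_apply_apply toE _ e)

lemma face_even (e : Ed) : ((face e).1 + (face e).2) % 2 = 0 := by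
  obtain ⟨⟨i, j⟩, s⟩ := e
  unfold face
  cases s <;> split_ifs <;> simp_all [e1, e2] <;> omega

/-- The configuration in which all edges of the selected faces are flipped. -/
def flip (P : V → Bool) (ω : Config) : Config := fun e => xor (ω e) (P (faceE e))

lemma ind_flip (P : V → Bool) (ω : Config) (e : Ed) :
    ind (flip P ω (toE e) = true) = ind (ω (toE e) = true) + ind (P (face e) = true) := by
  have h2 : (1 : ZMod 2) + 1 = 0 := by decide
  unfold flip
  rw [faceE_toE]
  cases ω (toE e) <;> cases P (face e) <;> simp [ind, h2]

lemma par_flip (P : V → Bool) (ω : Config) (v : V) : par (flip P ω) v = par ω v := by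
  have h : ∀ a b c d : V, (a = c ∧ b = d) ∨ (a = d ∧ b = c) →
      ind (P a = true) + ind (P b = true) + ind (P c = true) + ind (P d = true) = 0 := by
    rintro a b c d (⟨rfl, rfl⟩ | ⟨rfl, rfl⟩) <;> cases P a <;> cases P b <;> decide
  have h2 : ind (P (face (v, false)) = true) + ind (P (face (v - e1, false)) = true) +
      ind (P (face (v, true)) = true) + ind (P (face (v - e2, true)) = true) = 0 := by
    apply h
    obtain ⟨i, j⟩ := v
    by_cases hp : (i + j) % 2 = 0
    · have h1 : ¬ (i - 1 + j) % 2 = 0 := by omega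
      have h2 : ¬ (i + (j - 1)) % 2 = 0 := by omega
      simp [face, e1, e2, hp, h1, h2]
    · have h1 : (i - 1 + j) % 2 = 0 := by omega
      have h2 : (i + (j - 1)) % 2 = 0 := by omega
      simp [face, e1, e2, hp, h1, h2]
  unfold par
  simp only [ind_flip]
  calc _ = par ω v + (ind (P (face (v, false)) = true) + ind (P (face (v - e1, false)) = true) +
      ind (P (face (v, true)) = true) + ind (P (face (v - e2, true)) = true)) := by
        unfold par; ring
    _ = _ := by rw [h2, add_zero]; rfl

lemma flip_mem_iff (P : V → Bool) (ω : Config) : flip P ω ∈ ΩEP ↔ ω ∈ ΩEP := by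
  change (∀ v, degEven _ v) ↔ ∀ v, degEven _ v
  simp only [degEven_iff, par_flip]

lemma flip_flip (P P' : V → Bool) (ω : Config) :
    flip P (flip P' ω) = flip (fun v => xor (P v) (P' v)) ω := by
  funext e
  simp only [flip]
  cases ω e <;> cases P (faceE e) <;> cases P' (faceE e) <;> rfl

lemma flip_false (ω : Config) : flip (fun _ => false) ω = ω := by
  funext e
  simp [flip]

lemma flip_involutive (P : V → Bool) : Function.Involutive (flip P) := by
  intro ω
  rw [flip_flip]
  simp only [Bool.xor_self]
  exact flip_false ω

lemma continuous_flip (P : V → Bool) : Continuous (flip P) :=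
  continuous_pi fun e => (continuous_of_discreteTopology
    (f := fun t : Bool => xor t (P (faceE e)))).comp (continuous_apply e)

lemma measurable_flip (P : V → Bool) : Measurable (flip P) :=
  measurable_pi_lambda _ fun e => (measurable_from_top
    (f := fun t : Bool => xor t (P (faceE e)))).comp (measurable_pi_apply e)

/-- Flipping as a measurable equivalence. -/
def flipEquiv (P : V → Bool) : Config ≃ᵐ Config where
  toEquiv := (flip_involutive P).toPerm
  measurable_toFun := measurable_flip P
  measurable_invFun := measurable_flip P

/-- The complement of a local configuration. -/
def negEquiv (Λ : Finset Edge) : (↥Λ → Bool) ≃ (↥Λ → Bool) :=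
  Equiv.arrowCongr (Equiv.refl _) Equiv.boolNot

lemma negEquiv_apply {Λ : Finset Edge} (η : ↥Λ → Bool) (e : ↥Λ) : negEquiv Λ η e = !η e := rfl

lemma numOpen_neg {Λ : Finset Edge} (η : ↥Λ → Bool) :
    numOpen (negEquiv Λ η) + numOpen η = Λ.card := by
  unfold numOpen
  simp only [negEquiv_apply]
  have h := Finset.card_filter_add_card_filter_not (s := (Finset.univ : Finset ↥Λ))
    (p := fun e => η e = true)
  rw [Finset.card_univ, Fintype.card_coe] at h
  rw [add_comm, ← h]
  simp

lemma pow_numOpen_neg {x : ℝ} (hx : x ≠ 0) {Λ : Finset Edge} (η : ↥Λ → Bool) :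
    x ^ numOpen (negEquiv Λ η) = x ^ Λ.card * x⁻¹ ^ numOpen η := by
  rw [← numOpen_neg η, pow_add, mul_assoc, ← mul_pow, mul_inv_cancel₀ hx, one_pow, mul_one]

lemma qratio_one_sub (p : ℝ) : qratio (1 - p) = (qratio p)⁻¹ := by
  unfold qratio
  rw [inv_div, sub_sub_cancel]

lemma Mop_flip_all {p : ℝ} (hx : qratio p ≠ 0) (Λ : Finset Edge) (f : Config → ℝ) (ω : Config) :
    Mop p Λ f (flip (fun _ => true) ω) =
      qratio p ^ Λ.card * Mop (1 - p) Λ (fun ω => f (flip (fun _ => true) ω)) ω := by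
  unfold Mop
  rw [← Equiv.sum_comp (negEquiv Λ), Finset.mul_sum]
  refine Finset.sum_congr rfl fun η _ => ?_
  have h : patch Λ (negEquiv Λ η) (flip (fun _ => true) ω) =
      flip (fun _ => true) (patch Λ η ω) := by
    funext e
    simp only [patch, flip, negEquiv_apply]
    split_ifs <;> simp
  rw [h]
  rw [pow_numOpen_neg hx, qratio_one_sub]
  by_cases hω : patch Λ η ω ∈ ΩEP
  · rw [if_pos hω, if_pos ((flip_mem_iff _ _).2 hω)]
    ring
  · rw [if_neg hω, if_neg (mt (flip_mem_iff _ _).1 hω), mul_zero]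

lemma isGibbs_flip_all {p : ℝ} {m : Measure Config} (hp0 : 0 < p) (hp1 : p < 1)
    (hm : IsGibbsEP (1 - p) m) : IsGibbsEP p (m.map (flip fun _ => true)) := by
  have hP := hm.1
  have hx : qratio p ≠ 0 := (div_pos hp0 (by linarith)).ne'
  have hi : ∀ g : Config → ℝ, ∫ ω, g ω ∂(m.map (flip fun _ => true)) =
      ∫ ω, g (flip (fun _ => true) ω) ∂m := fun g =>
    (flipEquiv fun _ => true).measurableEmbedding.integral_map g
  refine ⟨Measure.isProbabilityMeasure_map (measurable_flip _).aemeasurable, ?_, ?_⟩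
  · have h := (flipEquiv fun _ => true).map_apply (μ := m) ΩEP
    refine h.trans ?_
    have h2 : (flipEquiv fun _ => true) ⁻¹' ΩEP = ΩEP := by
      ext ω
      exact flip_mem_iff (fun _ => true) ω
    rw [h2]
    exact hm.2.1
  · intro f hf Λ
    rw [hi, hi]
    refine (hm.2.2 _ (hf.comp (continuous_flip fun _ => true)) Λ).trans ?_
    refine integral_congr_ae (Filter.Eventually.of_forall fun ω => ?_)
    simp only [muOp, Mop_flip_all hx]
    rw [mul_div_mul_left _ _ (pow_ne_zero _ hx)]
    rfl

/-- The four edges of a face. -/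
def fc (z : V) : Finset Ed := {(z, false), (z + e2, false), (z, true), (z + e1, true)}

lemma card_fc (z : V) : (fc z).card = 4 := by
  unfold fc
  rw [Finset.card_insert_of_notMem, Finset.card_insert_of_notMem, Finset.card_insert_of_notMem,
    Finset.card_singleton] <;> simp [e1, e2, Prod.ext_iff]

lemma face_eq_iff {z : V} (hz : (z.1 + z.2) % 2 = 0) (e : Ed) : face e = z ↔ e ∈ fc z := by
  obtain ⟨⟨i, j⟩, s⟩ := e
  obtain ⟨k, l⟩ := z
  simp only at hz
  unfold face fc
  cases s <;> by_cases hp : (i + j) % 2 = 0 <;>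
    simp [e1, e2, Prod.ext_iff, hp] <;> omega

/-- The number of open edges of a face. -/
def fk (z : V) (ω : Config) : ℕ := (tr (fc z) ω).card

lemma fk_le (z : V) (ω : Config) : fk z ω ≤ 4 :=
  (Finset.card_le_card (tr_subset _ _)).trans (card_fc z).le

lemma fk_congr {z : V} {ω ω' : Config} (h : ∀ e ∈ fc z, ω (toE e) = ω' (toE e)) :
    fk z ω = fk z ω' := by
  unfold fk tr
  exact congrArg _ (Finset.filter_congr fun e he => by rw [h e he])

lemma flip_apply_of_mem {P : V → Bool} {ω : Config} {z : V} (hz : (z.1 + z.2) % 2 = 0) {e : Ed}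
    (he : e ∈ fc z) : flip P ω (toE e) = xor (ω (toE e)) (P z) := by
  unfold flip
  rw [faceE_toE, (face_eq_iff hz e).2 he]

lemma fk_flip_of_true {P : V → Bool} {z : V} (hz : (z.1 + z.2) % 2 = 0) (hP : P z = true)
    (ω : Config) : fk z (flip P ω) = 4 - fk z ω := by
  unfold fk tr
  have h := Finset.card_filter_add_card_filter_not (s := fc z)
    (p := fun e => ω (toE e) = true)
  rw [card_fc] at h
  have h2 : (fc z).filter (fun e => flip P ω (toE e) = true) =
      (fc z).filter fun e => ¬ ω (toE e) = true :=
    Finset.filter_congr fun e he => by rw [flip_apply_of_mem hz he, hP]; simp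
  rw [h2]
  omega

lemma fk_flip_of_false {P : V → Bool} {z : V} (hz : (z.1 + z.2) % 2 = 0) (hP : P z = false)
    (ω : Config) : fk z (flip P ω) = fk z ω :=
  fk_congr fun e he => by rw [flip_apply_of_mem hz he, hP, Bool.xor_false]

/-- The density of a flipped face. -/
def wk (x : ℝ) (k : ℕ) : ℝ := x ^ 4 * x⁻¹ ^ k * x⁻¹ ^ k

lemma Mop_flip_face {p : ℝ} (hx : qratio p ≠ 0) {z : V} (hz : (z.1 + z.2) % 2 = 0)
    (G : Config → ℝ) (ω : Config) :
    Mop p (toEs (fc z)) (fun ω => G (flip (fun v => decide (v = z)) ω)) ω =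
      Mop p (toEs (fc z)) (fun ω => wk (qratio p) (fk z ω) * G ω) ω := by
  unfold Mop
  rw [← Equiv.sum_comp (negEquiv (toEs (fc z)))]
  refine Finset.sum_congr rfl fun η _ => ?_
  have h : flip (fun v => decide (v = z)) (patch (toEs (fc z)) (negEquiv _ η) ω) =
      patch (toEs (fc z)) η ω := by
    funext e
    obtain ⟨e, rfl⟩ := toE_surjective e
    simp only [patch, flip, negEquiv_apply, faceE_toE, face_eq_iff hz, mem_toEs]
    split_ifs with h1 <;> simp [h1]
  have hk : fk z (patch (toEs (fc z)) η ω) = numOpen η := by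
    unfold fk
    rw [tr_patch, numOpen_eq]
  have hi := flip_mem_iff (fun v => decide (v = z)) (patch (toEs (fc z)) (negEquiv _ η) ω)
  rw [h] at hi
  beta_reduce
  rw [h, hk, pow_numOpen_neg hx]
  have hc : (toEs (fc z)).card = 4 := by
    unfold toEs
    rw [Finset.card_map, card_fc]
  rw [hc, wk]
  by_cases hω : patch (toEs (fc z)) η ω ∈ ΩEP
  · rw [if_pos hω, if_pos (hi.1 hω)]
    have h4 : (qratio p)⁻¹ ^ numOpen η * qratio p ^ numOpen η = 1 := by
      rw [← mul_pow, inv_mul_cancel₀ hx, one_pow]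
    linear_combination (-(G (patch (toEs (fc z)) η ω)) * qratio p ^ 4 *
      (qratio p)⁻¹ ^ numOpen η) * h4
  · rw [if_neg hω, if_neg (mt hi.2 hω)]

lemma continuous_fk (F : ℕ → ℝ) (z : V) : Continuous fun ω => F (fk z ω) :=
  continuous_tr (fc z) fun s => F s.card

lemma integral_flip_face {p : ℝ} {m : Measure Config} (hx : qratio p ≠ 0) (hm : IsGibbsEP p m)
    {z : V} (hz : (z.1 + z.2) % 2 = 0) {G : Config → ℝ} (hG : Continuous G) :
    ∫ ω, G (flip (fun v => decide (v = z)) ω) ∂m =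
      ∫ ω, wk (qratio p) (fk z ω) * G ω ∂m := by
  refine (hm.2.2 _ (hG.comp (continuous_flip _)) (toEs (fc z))).trans ?_
  refine Eq.trans ?_ (hm.2.2 _ ((continuous_fk (wk (qratio p)) z).mul hG) (toEs (fc z))).symm
  refine integral_congr_ae (Filter.Eventually.of_forall fun ω => ?_)
  simp only [muOp]
  exact congrArg (· / _) (Mop_flip_face hx hz G ω)

lemma openAdj_toE (ω : Config) (e : Ed) :
    openAdj ω (tl e) (hd e) ↔ ω (toE e) = true := by
  constructor
  · rintro ⟨h, h'⟩
    rwa [show toE e = ⟨s(tl e, hd e), h⟩ from Subtype.ext (toE_val e)]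
  · intro h
    refine ⟨toE_val e ▸ (toE e).2, ?_⟩
    rw [← h]
    exact congrArg ω (Subtype.ext (toE_val e).symm)

lemma openAdj_symm {ω : Config} {x y : V} (h : openAdj ω x y) : openAdj ω y x := by
  obtain ⟨h, h'⟩ := h
  have hs : s(y, x) = s(x, y) := Sym2.eq_swap
  refine ⟨hs ▸ h, ?_⟩
  rw [← h']
  exact congrArg ω (Subtype.ext hs)

lemma openConn_symm {ω : Config} {x y : V} (h : openConn ω x y) : openConn ω y x := by
  induction h with
  | refl => exact Relation.ReflTransGen.refl
  | tail _ h ih => exact Relation.ReflTransGen.head (openAdj_symm h) ih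

lemma openConn_of_open {ω : Config} {e : Ed} (h : ω (toE e) = true) :
    openConn ω (tl e) (hd e) := Relation.ReflTransGen.single ((openAdj_toE ω e).2 h)

/-- If all edges of a face but one are open, the ends of the last one are connected. -/
lemma openConn_around {ω : Config} {z : V} {e : Ed} (he : e ∈ fc z)
    (h : ∀ f ∈ fc z, f ≠ e → ω (toE f) = true) : openConn ω (tl e) (hd e) := by
  have h' : ∀ f ∈ fc z, f ≠ e → openConn ω (tl f) (hd f) := fun f hf hfe =>
    openConn_of_open (h f hf hfe)
  have hc : z + e1 + e2 = z + e2 + e1 := add_right_comm _ _ _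
  have n1 : ((z, false) : Ed) ≠ (z + e2, false) := by simp [e2, Prod.ext_iff]
  have n2 : ((z, true) : Ed) ≠ (z + e1, true) := by simp [e1, Prod.ext_iff]
  have n3 : ∀ a b : V, ((a, false) : Ed) ≠ (b, true) := by simp
  simp only [fc, Finset.mem_insert, Finset.mem_singleton] at he
  have m1 : ((z, false) : Ed) ∈ fc z := by simp [fc]
  have m2 : ((z + e2, false) : Ed) ∈ fc z := by simp [fc]
  have m3 : ((z, true) : Ed) ∈ fc z := by simp [fc]
  have m4 : ((z + e1, true) : Ed) ∈ fc z := by simp [fc]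
  rcases he with rfl | rfl | rfl | rfl
  · have a := h' _ m2 n1.symm
    have b := h' _ m3 (n3 _ _).symm
    have c := openConn_symm (h' _ m4 (n3 _ _).symm)
    simp only [tl, hd, if_true, Bool.false_eq_true, if_false, hc] at a b c ⊢
    exact (b.trans a).trans c
  · have a := h' _ m1 n1
    have b := openConn_symm (h' _ m3 (n3 _ _).symm)
    have c := h' _ m4 (n3 _ _).symm
    simp only [tl, hd, if_true, Bool.false_eq_true, if_false, hc] at a b c ⊢
    exact (b.trans a).trans c
  · have a := h' _ m1 (n3 _ _)
    have b := openConn_symm (h' _ m2 (n3 _ _))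
    have c := h' _ m4 n2.symm
    simp only [tl, hd, if_true, Bool.false_eq_true, if_false, hc] at a b c ⊢
    exact (a.trans c).trans b
  · have a := openConn_symm (h' _ m1 (n3 _ _))
    have b := h' _ m2 (n3 _ _)
    have c := h' _ m3 n2
    simp only [tl, hd, if_true, Bool.false_eq_true, if_false, hc] at a b c ⊢
    exact (a.trans c).trans b

/-- Flipping faces with at most one open edge increases connectivity. -/
theorem openConn_flip {ω : Config} {P : V → Bool} (hP : ∀ z, P z = true → fk z ω ≤ 1) {x y : V}
    (h : openConn ω x y) : openConn (flip P ω) x y := by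
  have key : ∀ e : Ed, ω (toE e) = true → openConn (flip P ω) (tl e) (hd e) := by
    intro e he
    have hz := face_even e
    have hm := (face_eq_iff hz e).1 rfl
    cases hPe : P (face e)
    · apply openConn_of_open
      rw [flip_apply_of_mem hz hm, he, hPe]
      rfl
    · refine openConn_around hm fun f hf hfe => ?_
      rw [flip_apply_of_mem hz hf, hPe]
      have h1 : e ∈ tr (fc (face e)) ω := Finset.mem_filter.2 ⟨hm, he⟩
      have h2 : f ∉ tr (fc (face e)) ω := fun h =>
        hfe (Finset.card_le_one.1 (hP _ hPe) f h e h1)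
      have h3 : ω (toE f) = false := by
        simpa [tr, hf] using h2
      rw [h3]
      rfl
  induction h with
  | refl => exact Relation.ReflTransGen.refl
  | tail _ h ih =>
    refine ih.trans ?_
    obtain ⟨hs, hω⟩ := h
    obtain ⟨e, he⟩ := toE_surjective ⟨_, hs⟩
    have hv := congrArg Subtype.val he
    rw [toE_val] at hv
    rw [← he] at hω
    rcases Sym2.eq_iff.1 hv with ⟨h1, h2⟩ | ⟨h1, h2⟩
    · rw [← h1, ← h2]
      exact key e hω
    · rw [← h1, ← h2]
      exact openConn_symm (key e hω)

/-- The probability of flipping a face. -/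
def fp (x : ℝ) (k : ℕ) : ℝ := if k ≤ 1 then 1 - wk x k else 0

lemma wk_zero (x : ℝ) : wk x 0 = x ^ 4 := by simp [wk]

lemma wk_one {x : ℝ} (hx : x ≠ 0) : wk x 1 = x ^ 2 := by
  unfold wk
  field_simp

lemma fp_mem {x : ℝ} (hx0 : 0 < x) (hx1 : x < 1) (k : ℕ) : fp x k ∈ Set.Icc (0 : ℝ) 1 := by
  have h2 : x ^ 2 ≤ 1 := pow_le_one₀ hx0.le hx1.le
  have h4 : x ^ 4 ≤ 1 := pow_le_one₀ hx0.le hx1.le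
  have h2' : 0 ≤ x ^ 2 := by positivity
  have h4' : 0 ≤ x ^ 4 := by positivity
  unfold fp
  split_ifs with h
  · interval_cases k
    · rw [wk_zero]
      constructor <;> linarith
    · rw [wk_one hx0.ne']
      constructor <;> linarith
  · simp

lemma wk_mul_fp {x : ℝ} (hx : x ≠ 0) {k : ℕ} (hk : k ≤ 4) :
    wk x k * (1 - fp x (4 - k)) = 1 - fp x k := by
  interval_cases k <;> simp [fp, wk] <;> field_simp

/-- One face may be flipped at random. -/
lemma integral_random_flip {p : ℝ} {m : Measure Config} (hx : qratio p ≠ 0) (hm : IsGibbsEP p m)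
    {z : V} (hz : (z.1 + z.2) % 2 = 0) {G : Config → ℝ} (hG : Continuous G) :
    ∫ ω, (fp (qratio p) (fk z ω) * G (flip (fun v => decide (v = z)) ω) +
      (1 - fp (qratio p) (fk z ω)) * G ω) ∂m = ∫ ω, G (flip (fun v => decide (v = z)) ω) ∂m := by
  have := hm.1
  have hint : ∀ g : Config → ℝ, Continuous g → Integrable g m := fun g hg =>
    (BoundedContinuousFunction.mkOfCompact ⟨g, hg⟩).integrable m
  set T : Config → Config := flip (fun v => decide (v = z)) with hT
  have hTc : Continuous T := continuous_flip _
  have hf : Continuous fun ω => fp (qratio p) (fk z ω) := continuous_fk _ z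
  have h := integral_flip_face hx hm hz
    ((continuous_fk (fun k => 1 - fp (qratio p) (4 - k)) z).mul hG)
  have h1 : ∀ ω, fk z (T ω) = 4 - fk z ω := fun ω => fk_flip_of_true hz (by simp) ω
  have h2 : ∀ ω, 4 - (4 - fk z ω) = fk z ω := fun ω => by
    have := fk_le z ω
    omega
  simp only [Pi.mul_apply, ← hT, h1, h2, ← mul_assoc, wk_mul_fp hx (fk_le z _)] at h
  have i1 : Integrable (fun ω => fp (qratio p) (fk z ω) * G (T ω)) m :=
    hint _ (hf.mul (hG.comp hTc))
  have i2 : Integrable (fun ω => (1 - fp (qratio p) (fk z ω)) * G ω) m :=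
    hint _ ((continuous_const.sub hf).mul hG)
  have i3 : Integrable (fun ω => (1 - fp (qratio p) (fk z ω)) * G (T ω)) m :=
    hint _ ((continuous_const.sub hf).mul (hG.comp hTc))
  rw [integral_add i1 i2, ← h, ← integral_add i1 i3]
  refine integral_congr_ae (Filter.Eventually.of_forall fun ω => ?_)
  ring

/-- Independent uniform random variables attached to the faces. -/
def noise : Measure (V → unitInterval) := Measure.infinitePi fun _ => volume

instance : IsProbabilityMeasure noise := by
  unfold noise
  infer_instance

lemma noise_real_lt (z : V) (c : unitInterval) : noise.real {u | u z < c} = c := by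
  have h := (measurePreserving_eval_infinitePi (fun _ : V => (volume : Measure unitInterval))
    z).measure_preimage (measurableSet_Iio (a := c)).nullMeasurableSet
  have h2 : noise {u | u z < c} = ENNReal.ofReal c := h.trans (unitInterval.volume_Iio c)
  rw [measureReal_def, h2, ENNReal.toReal_ofReal c.2.1]

lemma integral_noise_split {S : Finset V} {z : V} (hz : z ∉ S) {A B : (V → unitInterval) → ℝ}
    (hA : Measurable A) (hB : Measurable B) (hAi : Integrable A noise) (hBi : Integrable B noise)
    (hAS : ∀ u u', (∀ s ∈ S, u s = u' s) → A u = A u')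
    (hBS : ∀ u u', (∀ s ∈ S, u s = u' s) → B u = B u') (c : unitInterval) :
    ∫ u, (if u z < c then A u else B u) ∂noise =
      ∫ u, (c * A u + (1 - c) * B u) ∂noise := by
  classical
  set X : (V → unitInterval) → ℝ := {u | u z < c}.indicator 1 with hX
  have hms : MeasurableSet {u : V → unitInterval | u z < c} :=
    measurableSet_lt (measurable_pi_apply z) measurable_const
  have hXm : Measurable X := measurable_one.indicator hms
  set ext : (↥S → unitInterval) → V → unitInterval := fun v s => if h : s ∈ S then v ⟨s, h⟩ else 0
  have hext : Measurable ext := by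
    refine measurable_pi_lambda _ fun s => ?_
    by_cases h : s ∈ S
    · simpa only [ext, h, dif_pos] using measurable_pi_apply _
    · simpa only [ext, h, dif_neg, not_false_eq_true] using measurable_const
  have hext' : ∀ u : V → unitInterval, ∀ s ∈ S, u s = ext (fun i : ↥S => u i) s := by
    intro u s hs
    simp [ext, hs]
  have hind : ProbabilityTheory.IndepFun X (A - B) noise := by
    have h0 : ProbabilityTheory.iIndepFun (fun (i : V) (u : V → unitInterval) => u i) noise :=
      ProbabilityTheory.iIndepFun_infinitePi (X := fun (_ : V) (t : unitInterval) => t)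
        fun _ => measurable_id
    have h1 := h0.indepFun_finset {z} S (by simpa using hz) fun i => measurable_pi_apply i
    have h2 := h1.comp (φ := fun v : ↥({z} : Finset V) → unitInterval =>
      ({t | t < c}.indicator (1 : unitInterval → ℝ)) (v ⟨z, Finset.mem_singleton_self z⟩))
      (ψ := fun v => A (ext v) - B (ext v))
      ((measurable_one.indicator measurableSet_Iio).comp (measurable_pi_apply _))
      ((hA.comp hext).sub (hB.comp hext))
    have e2 : (A - B) = (fun v => A (ext v) - B (ext v)) ∘ fun u (i : ↥S) => u i := by
      funext u
      simp only [Pi.sub_apply, Function.comp_apply]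
      rw [hAS _ _ (hext' u), hBS _ _ (hext' u)]
    rw [e2]
    exact h2
  have hmul := hind.integral_mul_eq_mul_integral hXm.aestronglyMeasurable
    (hA.sub hB).aestronglyMeasurable
  have hXi : ∫ u, X u ∂noise = c := by
    rw [hX, integral_indicator_one hms, noise_real_lt]
  have hXb : Integrable (X * (A - B)) noise := by
    refine (hAi.sub hBi).bdd_mul (c := 1) hXm.aestronglyMeasurable
      (Filter.Eventually.of_forall fun u => ?_)
    by_cases h : u z < c <;> simp [hX, h]
  have hs : ∀ u, (if u z < c then A u else B u) = (X * (A - B)) u + B u := by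
    intro u
    by_cases h : u z < c <;> simp [hX, h]
  simp only [hs]
  rw [integral_add hXb hBi, hmul, hXi, integral_add (hAi.const_mul _) (hBi.const_mul _),
    integral_const_mul, integral_const_mul]
  have hsub : ∫ u, (A - B) u ∂noise = ∫ u, A u ∂noise - ∫ u, B u ∂noise := integral_sub hAi hBi
  rw [hsub]
  ring


/-- The threshold below which a face is flipped. -/
def thr (x : ℝ) (k : ℕ) : unitInterval := Set.projIcc 0 1 zero_le_one (fp x k)

lemma coe_thr {x : ℝ} (hx0 : 0 < x) (hx1 : x < 1) (k : ℕ) : (thr x k : ℝ) = fp x k := by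
  unfold thr
  rw [Set.projIcc_of_mem zero_le_one (fp_mem hx0 hx1 k)]

/-- The faces to be flipped. -/
def sw (x : ℝ) (ω : Config) (u : V → unitInterval) (z : V) : Bool := decide (u z < thr x (fk z ω))

lemma fk_le_one_of_sw {x : ℝ} (hx0 : 0 < x) (hx1 : x < 1) {ω : Config} {u : V → unitInterval}
    {z : V} (h : sw x ω u z = true) : fk z ω ≤ 1 := by
  by_contra hk
  have h1 : u z < thr x (fk z ω) := of_decide_eq_true h
  have h2 : ((u z : unitInterval) : ℝ) < fp x (fk z ω) := by
    rw [← coe_thr hx0 hx1]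
    exact_mod_cast h1
  rw [fp, if_neg hk] at h2
  exact absurd (u z).2.1 (not_le.2 h2)

lemma measurable_fk (z : V) : Measurable (fk z) := by
  refine measurable_to_countable' fun n => ?_
  exact measurableSet_tr (fc z) {s | s.card = n}

/-- The configuration after flipping randomly the faces of a set. -/
def rf (x : ℝ) (S : Set V) [DecidablePred (· ∈ S)] (q : Config × (V → unitInterval)) : Config :=
  flip (fun z => decide (z ∈ S) && sw x q.1 q.2 z) q.1

lemma measurable_rf (x : ℝ) (S : Set V) [DecidablePred (· ∈ S)] : Measurable (rf x S) := by
  refine measurable_pi_lambda _ fun e => ?_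
  have h1 : Measurable fun q : Config × (V → unitInterval) => sw x q.1 q.2 (faceE e) := by
    refine measurable_to_bool ?_
    have h2 : Measurable fun q : Config × (V → unitInterval) => thr x (fk (faceE e) q.1) :=
      (measurable_from_top (f := thr x)).comp ((measurable_fk _).comp measurable_fst)
    have h3 := measurableSet_lt ((measurable_pi_apply (faceE e)).comp measurable_snd) h2
    convert h3 using 1
    ext q
    simp [sw]
  have h4 : Measurable fun q : Config × (V → unitInterval) => q.1 e :=
    (measurable_pi_apply e).comp measurable_fst
  exact (measurable_of_countable fun t : Bool × Bool =>
    xor t.1 (decide (faceE e ∈ S) && t.2)).comp (h4.prodMk h1)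

lemma flip_singleton_flip (S : Finset V) {z : V} (hz : z ∉ S) (P : V → Bool) (ω : Config) :
    flip (fun v => decide (v = z)) (flip (fun v => decide (v ∈ S) && P v) ω) =
      flip (fun v => decide (v = z) || (decide (v ∈ S) && P v)) ω := by
  rw [flip_flip]
  congr 1
  funext v
  by_cases h : v = z
  · subst h
    simp [hz]
  · simp [h]

lemma integrable_of_continuous {α : Type*} [MeasurableSpace α] {m : Measure α}
    [IsProbabilityMeasure m] {G : Config → ℝ} (hG : Continuous G) {Y : α → Config}
    (hY : Measurable Y) : Integrable (fun a => G (Y a)) m := by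
  refine Integrable.of_bound (hG.measurable.comp hY).aestronglyMeasurable
    ‖BoundedContinuousFunction.mkOfCompact ⟨G, hG⟩‖ (Filter.Eventually.of_forall fun a => ?_)
  exact (BoundedContinuousFunction.mkOfCompact ⟨G, hG⟩).norm_coe_le_norm (Y a)

/-- Averaging over the randomness of one face. -/
lemma integral_rf_insert {x : ℝ} (hx0 : 0 < x) (hx1 : x < 1) {S : Finset V} {z : V}
    (hz : (z.1 + z.2) % 2 = 0) (hzS : z ∉ S) {G : Config → ℝ} (hG : Continuous G) (ω : Config) :
    ∫ u, G (rf x ↑(insert z S) (ω, u)) ∂noise =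
      ∫ u, (fp x (fk z (rf x ↑S (ω, u))) *
        G (flip (fun v => decide (v = z)) (rf x ↑S (ω, u))) +
        (1 - fp x (fk z (rf x ↑S (ω, u)))) * G (rf x ↑S (ω, u))) ∂noise := by
  have hm : Measurable fun u => rf x ↑S (ω, u) := (measurable_rf x ↑S).comp measurable_prodMk_left
  have hm' : Measurable fun u => flip (fun v => decide (v = z)) (rf x ↑S (ω, u)) :=
    (measurable_flip _).comp hm
  have hloc : ∀ u u' : V → unitInterval, (∀ s ∈ S, u s = u' s) →
      rf x ↑S (ω, u) = rf x ↑S (ω, u') := by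
    intro u u' h
    unfold rf
    congr 1
    funext v
    by_cases hv : v ∈ S
    · simp [sw, h v hv]
    · simp [hv]
  have hk : ∀ u, fk z (rf x ↑S (ω, u)) = fk z ω := fun u =>
    fk_flip_of_false hz (by simp [hzS]) ω
  have h := integral_noise_split hzS (hG.measurable.comp hm') (hG.measurable.comp hm)
    (integrable_of_continuous hG hm') (integrable_of_continuous hG hm)
    (fun u u' h => by simp only [Function.comp_apply, hloc u u' h])
    (fun u u' h => by simp only [Function.comp_apply, hloc u u' h]) (thr x (fk z ω))
  simp only [Function.comp_apply, coe_thr hx0 hx1] at h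
  simp only [hk]
  rw [← h]
  refine integral_congr_ae (Filter.Eventually.of_forall fun u => ?_)
  beta_reduce
  rw [← apply_ite G]
  congr 1
  by_cases hu : u z < thr x (fk z ω)
  · rw [if_pos hu]
    unfold rf
    simp only [Finset.mem_coe]
    rw [flip_singleton_flip S hzS]
    congr 1
    funext v
    by_cases hv : v = z
    · subst hv
      simp [sw, hu]
    · simp [hv]
  · rw [if_neg hu]
    unfold rf
    congr 1
    funext v
    by_cases hv : v = z
    · subst hv
      simp [sw, hu, hzS]
    · simp [hv]

lemma continuous_fp_flip {G : Config → ℝ} (hG : Continuous G) (x : ℝ) (z : V) :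
    Continuous fun ω => fp x (fk z ω) * G (flip (fun v => decide (v = z)) ω) +
      (1 - fp x (fk z ω)) * G ω :=
  ((continuous_fk (fp x) z).mul (hG.comp (continuous_flip _))).add
    ((continuous_const.sub (continuous_fk (fp x) z)).mul hG)

theorem integral_rf {p : ℝ} {m : Measure Config} (hx0 : 0 < qratio p) (hx1 : qratio p < 1)
    (hm : IsGibbsEP p m) (S : Finset V) (hS : ∀ z ∈ S, (z.1 + z.2) % 2 = 0) {G : Config → ℝ}
    (hG : Continuous G) :
    ∫ ω, ∫ u, G (rf (qratio p) ↑S (ω, u)) ∂noise ∂m =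
      ∫ ω, G (flip (fun v => decide (v ∈ S)) ω) ∂m := by
  induction S using Finset.induction_on generalizing G with
  | empty =>
    refine integral_congr_ae (Filter.Eventually.of_forall fun ω => ?_)
    simp [rf]
  | insert z S hzS ih =>
    have hz := hS z (Finset.mem_insert_self z S)
    simp only [integral_rf_insert hx0 hx1 hz hzS hG]
    rw [ih (fun s hs => hS s (Finset.mem_insert_of_mem hs)) (continuous_fp_flip hG _ z)]
    have hG' : Continuous fun ω => G (flip (fun v => decide (v ∈ S)) ω) :=
      hG.comp (continuous_flip _)
    have h := integral_random_flip hx0.ne' hm hz hG'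
    have hk : ∀ ω, fk z (flip (fun v => decide (v ∈ S)) ω) = fk z ω := fun ω =>
      fk_flip_of_false hz (by simp [hzS]) ω
    have hc : ∀ ω, flip (fun v => decide (v = z)) (flip (fun v => decide (v ∈ S)) ω) =
        flip (fun v => decide (v ∈ S)) (flip (fun v => decide (v = z)) ω) := fun ω => by
      rw [flip_flip, flip_flip]
      simp only [Bool.xor_comm]
    have hi : ∀ ω, flip (fun v => decide (v ∈ S)) (flip (fun v => decide (v = z)) ω) =
        flip (fun v => decide (v ∈ insert z S)) ω := fun ω => by
      rw [flip_flip]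
      congr 1
      funext v
      by_cases hv : v = z
      · subst hv
        simp [hzS]
      · simp [hv]
    simp only [hk, hc]
    rw [h]
    simp only [hi]

/-- The product of the states of finitely many edges. -/
def po (γ : Finset Ed) (ω : Config) : ℝ := ∏ e ∈ γ, if ω (toE e) then 1 else 0

lemma continuous_po (γ : Finset Ed) : Continuous (po γ) :=
  continuous_finsetProd _ fun e _ => (continuous_of_discreteTopology
    (f := fun t : Bool => if t then (1 : ℝ) else 0)).comp (continuous_apply (toE e))

lemma po_eq_indicator (γ : Finset Ed) : po γ = (allOpen γ).indicator 1 := by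
  funext ω
  unfold po
  by_cases h : ω ∈ allOpen γ
  · rw [Set.indicator_of_mem h]
    exact Finset.prod_eq_one fun e he => by simp [h e he]
  · rw [Set.indicator_of_notMem h]
    simp only [allOpen, Set.mem_ofPred_eq, not_forall] at h
    obtain ⟨e, he, hω⟩ := h
    exact Finset.prod_eq_zero he (by simp [hω])

lemma po_flip_congr {γ : Finset Ed} {P P' : V → Bool} (h : ∀ e ∈ γ, P (face e) = P' (face e))
    (ω : Config) : po γ (flip P ω) = po γ (flip P' ω) := by
  unfold po
  refine Finset.prod_congr rfl fun e he => ?_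
  simp only [flip, faceE_toE, h e he]

/-- Random flipping has the effect of flipping all faces. -/
theorem map_rf {p : ℝ} {m : Measure Config} (hx0 : 0 < qratio p) (hx1 : qratio p < 1)
    (hm : IsGibbsEP p m) :
    (m.prod noise).map (rf (qratio p) Set.univ) = m.map (flip fun _ => true) := by
  have := hm.1
  have hr := measurable_rf (qratio p) Set.univ
  have hf := measurable_flip fun _ => true
  have := Measure.isProbabilityMeasure_map (μ := m.prod noise) hr.aemeasurable
  have := Measure.isProbabilityMeasure_map (μ := m) hf.aemeasurable
  refine ext_of_allOpen fun γ => ?_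
  refine (measureReal_eq_measureReal_iff (measure_ne_top _ _) (measure_ne_top _ _)).1 ?_
  rw [← integral_indicator_one (measurableSet_allOpen γ),
    ← integral_indicator_one (measurableSet_allOpen γ), ← po_eq_indicator,
    integral_map hr.aemeasurable (continuous_po γ).aestronglyMeasurable,
    integral_map hf.aemeasurable (continuous_po γ).aestronglyMeasurable,
    integral_prod _ (integrable_of_continuous (continuous_po γ) hr)]
  have h := integral_rf hx0 hx1 hm (γ.image face) (fun z hz => by
    obtain ⟨e, _, rfl⟩ := Finset.mem_image.1 hz
    exact face_even e) (continuous_po γ)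
  have h1 : ∀ ω u, po γ (rf (qratio p) ↑(γ.image face) (ω, u)) =
      po γ (rf (qratio p) Set.univ (ω, u)) := fun ω u =>
    po_flip_congr (fun e he => by
      have : ∃ a ∈ γ, face a = face e := ⟨e, he, rfl⟩
      simp [this]) ω
  have h2 : ∀ ω, po γ (flip (fun v => decide (v ∈ γ.image face)) ω) =
      po γ (flip (fun _ => true) ω) := fun ω =>
    po_flip_congr (fun e he => decide_eq_true (Finset.mem_image_of_mem face he)) ω
  simpa only [h1, h2] using h

theorem exists_coupling {p : ℝ} (hp0 : 0 < p) (hp1 : p < 1 / 2) {μ ν : Measure Config}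
    (hμ : IsGibbsEP p μ) (hν : IsGibbsEP (1 - p) ν) :
    ∃ Q : Measure (Config × Config), IsProbabilityMeasure Q ∧
      Q.map Prod.fst = μ ∧ Q.map Prod.snd = ν ∧
      Q {ωp : Config × Config | ∀ x y : V, openConn ωp.1 x y → openConn ωp.2 x y} = 1 := by
  have := hμ.1
  have := hν.1
  have hx0 : 0 < qratio p := div_pos hp0 (by linarith)
  have hx1 : qratio p < 1 := (div_lt_one (by linarith)).2 (by linarith)
  have hf := measurable_flip fun _ => true
  have hμν : ν.map (flip fun _ => true) = μ :=
    gibbs_unique hp0 hp1 (isGibbs_flip_all hp0 (by linarith) hν) hμ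
  have hνμ : μ.map (flip fun _ => true) = ν := by
    rw [← hμν, Measure.map_map hf hf, (flip_involutive _).comp_self, Measure.map_id]
  have hr := measurable_rf (qratio p) Set.univ
  have hF : Measurable fun q : Config × (V → unitInterval) =>
      (q.1, rf (qratio p) Set.univ q) := measurable_fst.prodMk hr
  have hQ := Measure.isProbabilityMeasure_map (μ := μ.prod noise) hF.aemeasurable
  refine ⟨(μ.prod noise).map fun q => (q.1, rf (qratio p) Set.univ q), hQ, ?_, ?_, ?_⟩
  · rw [Measure.map_map measurable_fst hF]
    exact Measure.map_fst_prod.trans (by simp)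
  · rw [Measure.map_map measurable_snd hF]
    exact (map_rf hx0 hx1 hμ).trans hνμ
  · refine le_antisymm prob_le_one ?_
    refine le_trans (le_of_eq ?_) (Measure.le_map_apply hF.aemeasurable _)
    have hu : (fun q : Config × (V → unitInterval) => (q.1, rf (qratio p) Set.univ q)) ⁻¹'
        {ωp | ∀ x y : V, openConn ωp.1 x y → openConn ωp.2 x y} = Set.univ := by
      refine Set.eq_univ_of_forall fun q x y h => ?_
      change openConn (rf (qratio p) Set.univ q) x y
      unfold rf
      refine openConn_flip (fun z hz => ?_) h
      exact fk_le_one_of_sw hx0 hx1 (Bool.and_eq_true_iff.1 hz).2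
    rw [hu, measure_univ]

end EP

/-- For `p ∈ (0,1/2)` there is a coupling `Q̄` of `μ_p` and `μ_{1-p}` under which,
almost surely, every pair of vertices connected in the first configuration is connected
in the second one; in particular the connectivity field under `μ_p` is stochastically
dominated by the one under `μ_{1-p}`. -/
theorem eulerian_coupling_increases_connectivity (p : ℝ) (hp0 : 0 < p) (hp1 : p < 1 / 2)
    (μ ν : Measure Config) (hμ : IsGibbsEP p μ) (hν : IsGibbsEP (1 - p) ν) :
    ∃ Q : Measure (Config × Config), IsProbabilityMeasure Q ∧
      Q.map Prod.fst = μ ∧ Q.map Prod.snd = ν ∧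
      Q {ωp : Config × Config | ∀ x y : V, openConn ωp.1 x y → openConn ωp.2 x y} = 1 := by
  exact EP.exists_coupling hp0 hp1 hμ hν

end
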